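/- A class of finite graphs is monadically dependent if and only if it is flip-breakable. -/

import Mathlib

set_option autoImplicit false

/-- A class of finite graphs, given as a predicate singling out, for each `n`,
the graphs on vertex set `Fin n` that belong to the class. -/
abbrev GraphClass : Type := ∀ n : ℕ, SimpleGraph (Fin n) → Prop

open FirstOrder

/-- The first-order language of graphs expanded by `k` unary color predicates:
one binary relation symbol (adjacency) and `k` unary relation symbols (the colors). -/
def colLang (k : ℕ) : FirstOrder.Language where
  Functions := fun _ => Empty
  Relations := fun n =>
    match n with
    | 1 => Fin k
    | 2 => Unit
    | _ => Empty

/-- Interpretation of the relation symbols of `colLang k` in a graph `G`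
whose vertices are colored by `c`. -/
def colRelMap {k : ℕ} {V : Type} (G : SimpleGraph V) (c : V → Fin k) :
    ∀ n : ℕ, (colLang k).Relations n → (Fin n → V) → Prop
  | 0, r, _ => Empty.elim r
  | 1, i, x => c (x 0) = i
  | 2, _, x => G.Adj (x 0) (x 1)
  | _ + 3, r, _ => Empty.elim r

/-- The `colLang k`-structure determined by a graph `G` with coloring `c`. -/
def colStruct {k : ℕ} {V : Type} (G : SimpleGraph V) (c : V → Fin k) :
    (colLang k).Structure V where
  funMap := fun f _ => Empty.elim f
  RelMap := fun {n} => colRelMap G c n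

/-- Satisfaction of a formula `φ(x, y)` at a pair of vertices of the colored graph `(G, c)`. -/
def colSat {k : ℕ} {V : Type} (G : SimpleGraph V) (c : V → Fin k)
    (φ : (colLang k).Formula (Fin 2)) (u v : V) : Prop :=
  letI := colStruct G c
  φ.Realize ![u, v]

/-- The class `C` transduces the class of all graphs: for some number `k` of colors and
some first-order formula `φ(x,y)` over the language of graphs with `k` unary predicates,
every finite graph `H` is obtained by coloring some `G ∈ C`, taking the graph with edges
`{uv : u ≠ v and φ(u,v) ∨ φ(v,u)}`, and passing to an induced subgraph isomorphic to `H`. -/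
def TransducesAllGraphs (C : GraphClass) : Prop :=
  ∃ (k : ℕ) (φ : (colLang k).Formula (Fin 2)),
    ∀ (n : ℕ) (H : SimpleGraph (Fin n)),
      ∃ (N : ℕ) (G : SimpleGraph (Fin N)), C N G ∧
        ∃ (c : Fin N → Fin k) (e : Fin n → Fin N), Function.Injective e ∧
          ∀ u v : Fin n, H.Adj u v ↔
            (e u ≠ e v ∧ (colSat G c φ (e u) (e v) ∨ colSat G c φ (e v) (e u)))

/-- A graph class is monadically dependent if it does not transduce the class of all graphs. -/
def MonadicallyDependent (C : GraphClass) : Prop := ¬ TransducesAllGraphs C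

/-- `H` is a `k`-flip of `G`: for some partition of the vertex set into at most `k` parts
(given by `P : V → Fin k`) and some symmetric relation `F` on the parts, distinct vertices
`u, v` are adjacent in `H` iff (`uv ∈ E(G)`) XOR (`(P u, P v) ∈ F`). -/
def IsKFlip {V : Type} (k : ℕ) (G H : SimpleGraph V) : Prop :=
  ∃ (P : V → Fin k) (F : Fin k → Fin k → Prop), Symmetric F ∧
    ∀ u v : V, u ≠ v → (H.Adj u v ↔ Xor' (G.Adj u v) (F (P u) (P v)))

/-- A graph class `C` is flip-breakable: for every radius `r` there are `N : ℕ → ℕ` and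
`k : ℕ` such that for all `m`, every `W ⊆ V(G)` with `|W| ≥ N m` in a graph `G ∈ C`
contains subsets `A, B` of size at least `m` and there is a `k`-flip `H` of `G` in which
every path from `A` to `B` has length greater than `r` (i.e. `dist_H(A,B) > r`). -/
def FlipBreakable (C : GraphClass) : Prop :=
  ∀ r : ℕ, ∃ (N : ℕ → ℕ) (k : ℕ),
    ∀ (m n : ℕ) (G : SimpleGraph (Fin n)), C n G →
      ∀ W : Finset (Fin n), N m ≤ W.card →
        ∃ A B : Finset (Fin n), A ⊆ W ∧ B ⊆ W ∧ m ≤ A.card ∧ m ≤ B.card ∧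
          ∃ H : SimpleGraph (Fin n), IsKFlip k G H ∧
            ∀ a ∈ A, ∀ b ∈ B, ∀ p : H.Walk a b, r < p.length

set_option autoImplicit false
set_option linter.style.haveILetI false
open FirstOrder

/-! ### Semantic first-order definability -/

/-- Families of predicates on environments in colored graphs. -/
abbrev Fam (Γ : Type) : Type 1 := ∀ V : Type, SimpleGraph V → (V → Γ) → (ℕ → V) → Prop

/-- Families of binary relations in colored graphs. -/
abbrev Bin (Γ : Type) : Type 1 := ∀ V : Type, SimpleGraph V → (V → Γ) → V → V → Prop

/-- Prepend a value to an environment. -/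
def econs {V : Type} (a : V) (e : ℕ → V) : ℕ → V
  | 0 => a
  | n + 1 => e n

@[simp] lemma econs_zero {V : Type} (a : V) (e : ℕ → V) : econs a e 0 = a := rfl
@[simp] lemma econs_succ {V : Type} (a : V) (e : ℕ → V) (n : ℕ) : econs a e (n + 1) = e n := rfl

/-- First-order definable families (over graphs colored by `Γ`). -/
inductive IsDef (Γ : Type) : Fam Γ → Prop
  | adj (i j : ℕ) : IsDef Γ (fun _ G _ e => G.Adj (e i) (e j))
  | eq (i j : ℕ) : IsDef Γ (fun _ _ _ e => e i = e j)
  | col (i : ℕ) (g : Γ) : IsDef Γ (fun _ _ c e => c (e i) = g)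
  | bot : IsDef Γ (fun _ _ _ _ => False)
  | imp {P Q : Fam Γ} : IsDef Γ P → IsDef Γ Q → IsDef Γ (fun V G c e => P V G c e → Q V G c e)
  | all' {P : Fam Γ} : IsDef Γ P → IsDef Γ (fun V G c e => ∀ a : V, P V G c (econs a e))

namespace IsDef

variable {Γ : Type}

lemma congr {P Q : Fam Γ} (h : IsDef Γ P) (hPQ : ∀ V G c e, P V G c e ↔ Q V G c e) :
    IsDef Γ Q := by
  have : P = Q := by
    funext V G c e; exact propext (hPQ V G c e)
  exact this ▸ h

lemma ren {P : Fam Γ} (h : IsDef Γ P) : ∀ s : ℕ → ℕ,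
    IsDef Γ (fun V G c e => P V G c (fun i => e (s i))) := by
  induction h with
  | adj i j => intro s; exact adj _ _
  | eq i j => intro s; exact eq _ _
  | col i g => intro s; exact col _ _
  | bot => intro s; exact bot
  | imp _ _ h1 h2 => intro s; exact imp (h1 s) (h2 s)
  | @all' P _ ih =>
    intro s
    refine (all' (ih (fun i => Nat.casesOn i 0 (fun n => s n + 1)))).congr ?_
    intro V G c e
    refine forall_congr' fun a => ?_
    have : (fun i : ℕ => econs a e (Nat.casesOn i 0 (fun n => s n + 1))) =
        econs a (fun i => e (s i)) := by
      funext i; cases i <;> rfl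
    rw [this]

lemma lift {Δ : Type} (f : Δ → Γ) [Finite Δ] {P : Fam Γ} (h : IsDef Γ P) :
    IsDef Δ (fun V G c e => P V G (fun v => f (c v)) e) := by
  classical
  induction h with
  | adj i j => exact adj _ _
  | eq i j => exact eq _ _
  | col i g =>
    have key : ∀ s : Set Δ, s.Finite → IsDef Δ (fun V G c e => c (e i) ∈ s) := by
      intro s hs
      induction s, hs using Set.Finite.induction_on with
      | empty => exact bot
      | @insert a s _ _ ih =>
        refine (imp (imp (col i a) bot) ih).congr ?_
        intro V G c e
        simp only [Set.mem_insert_iff]; tauto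
    exact (key {d | f d = g} (Set.toFinite _))
  | bot => exact bot
  | imp _ _ h1 h2 => exact imp h1 h2
  | all' _ ih => exact all' ih

lemma not {P : Fam Γ} (h : IsDef Γ P) : IsDef Γ (fun V G c e => ¬ P V G c e) := imp h bot

lemma or {P Q : Fam Γ} (h : IsDef Γ P) (h' : IsDef Γ Q) :
    IsDef Γ (fun V G c e => P V G c e ∨ Q V G c e) :=
  (imp (not h) h').congr (by intros; tauto)

lemma and {P Q : Fam Γ} (h : IsDef Γ P) (h' : IsDef Γ Q) :
    IsDef Γ (fun V G c e => P V G c e ∧ Q V G c e) :=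
  (not (imp h (not h'))).congr (by intros; tauto)

lemma iff {P Q : Fam Γ} (h : IsDef Γ P) (h' : IsDef Γ Q) :
    IsDef Γ (fun V G c e => P V G c e ↔ Q V G c e) :=
  (and (imp h h') (imp h' h)).congr (by intros; tauto)

lemma all {P : ∀ V : Type, SimpleGraph V → (V → Γ) → V → (ℕ → V) → Prop}
    (h : IsDef Γ (fun V G c e => P V G c (e 0) (fun i => e (i + 1)))) :
    IsDef Γ (fun V G c e => ∀ a : V, P V G c a e) :=
  (all' h).congr (fun _ _ _ _ => Iff.rfl)

lemma ex {P : ∀ V : Type, SimpleGraph V → (V → Γ) → V → (ℕ → V) → Prop}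
    (h : IsDef Γ (fun V G c e => P V G c (e 0) (fun i => e (i + 1)))) :
    IsDef Γ (fun V G c e => ∃ a : V, P V G c a e) := by
  refine (not (all (P := fun V G c a e => ¬ P V G c a e) (not h))).congr ?_
  intro V G c e
  exact not_forall_not

lemma const (p : Prop) : IsDef Γ (fun _ _ _ _ => p) := by
  by_cases h : p
  · exact (not bot).congr (by intros; simp [h])
  · exact bot.congr (by intros; simp [h])

lemma finOr {κ : Type} [Finite κ] {P : κ → Fam Γ} (h : ∀ k, IsDef Γ (P k)) :
    IsDef Γ (fun V G c e => ∃ k, P k V G c e) := by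
  classical
  have key : ∀ s : Set κ, s.Finite → IsDef Γ (fun V G c e => ∃ k ∈ s, P k V G c e) := by
    intro s hs
    induction s, hs using Set.Finite.induction_on with
    | empty => exact bot.congr (by intros; simp)
    | @insert a s _ _ ih =>
      refine (or (h a) ih).congr ?_
      intro V G c e
      simp
  exact (key Set.univ Set.finite_univ).congr (by intros; simp)

lemma colp [Finite Γ] (i : ℕ) (Q : Γ → Prop) : IsDef Γ (fun _ _ c e => Q (c (e i))) :=
  (finOr (fun g : Γ => and (col i g) (const (Q g)))).congr (by intros; simp)

lemma colp2 [Finite Γ] (i j : ℕ) (Q : Γ → Γ → Prop) :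
    IsDef Γ (fun _ _ c e => Q (c (e i)) (c (e j))) :=
  (finOr (fun g : Γ => and (col i g) (colp j (Q g)))).congr (by intros; simp)

end IsDef

/-- Definable binary relation. -/
def IsDef2 {Γ : Type} (ψ : Bin Γ) : Prop := IsDef Γ (fun V G c e => ψ V G c (e 0) (e 1))

lemma IsDef2.app {Γ : Type} {ψ : Bin Γ} (h : IsDef2 ψ) (i j : ℕ) :
    IsDef Γ (fun V G c e => ψ V G c (e i) (e j)) :=
  (IsDef.ren h (fun n => if n = 0 then i else j))

lemma IsDef2.lapp {Γ Δ : Type} [Finite Δ] {ψ : Bin Γ} (h : IsDef2 ψ) (f : Δ → Γ) (i j : ℕ) :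
    IsDef Δ (fun V G c e => ψ V G (fun v => f (c v)) (e i) (e j)) :=
  IsDef.lift f (IsDef2.app h i j)

/-! ### Translation to Mathlib formulas -/

/-- The adjacency symbol. -/
def adjSym (k : ℕ) : (colLang k).Relations 2 := ()

/-- The color symbols. -/
def colSym {k : ℕ} (g : Fin k) : (colLang k).Relations 1 := g

lemma IsDef.toFormula {k : ℕ} {P : Fam (Fin k)} (h : IsDef (Fin k) P) :
    ∃ φ : (colLang k).Formula ℕ, ∀ (V : Type) (G : SimpleGraph V) (c : V → Fin k) (e : ℕ → V),
      (letI := colStruct G c; φ.Realize e) ↔ P V G c e := by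
  induction h with
  | adj i j =>
    refine ⟨Language.Relations.formula (L := colLang k) (n := 2) (adjSym k) ![Language.Term.var i, Language.Term.var j], ?_⟩
    intro V G c e
    let _ := colStruct G c
    rw [Language.Formula.realize_rel]
    change colRelMap G c 2 _ _ ↔ _
    simp [colRelMap, colSym]
  | eq i j =>
    refine ⟨Language.Term.equal (Language.Term.var i) (Language.Term.var j), ?_⟩
    intro V G c e
    let _ := colStruct G c
    rw [Language.Formula.realize_equal]
    simp
  | col i g =>
    refine ⟨Language.Relations.formula (L := colLang k) (n := 1) (colSym g) ![Language.Term.var i], ?_⟩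
    intro V G c e
    let _ := colStruct G c
    rw [Language.Formula.realize_rel]
    change colRelMap G c 1 _ _ ↔ _
    simp [colRelMap, colSym]
  | bot =>
    refine ⟨⊥, ?_⟩
    intro V G c e
    exact Iff.rfl
  | imp _ _ h1 h2 =>
    obtain ⟨φ, hφ⟩ := h1
    obtain ⟨χ, hχ⟩ := h2
    refine ⟨φ.imp χ, ?_⟩
    intro V G c e
    exact imp_congr (hφ V G c e) (hχ V G c e)
  | all' _ ih =>
    obtain ⟨φ, hφ⟩ := ih
    refine ⟨Language.BoundedFormula.all (n := 0) (Language.BoundedFormula.relabel (k := 0) (n := 1)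
      (fun i : ℕ => (Nat.casesOn i (Sum.inr 0) (fun n => Sum.inl n) : ℕ ⊕ Fin 1)) φ), ?_⟩
    intro V G c e
    let _ := colStruct G c
    rw [Language.Formula.Realize, Language.BoundedFormula.realize_all]
    refine forall_congr' fun a => ?_
    rw [← hφ, Language.BoundedFormula.realize_relabel, Language.Formula.Realize]
    have h1 : (Sum.elim e (Fin.snoc (default : Fin 0 → V) a ∘ Fin.castAdd 0) ∘
      (fun i : ℕ => (Nat.casesOn i (Sum.inr 0) (fun n => Sum.inl n) : ℕ ⊕ Fin 1))) = econs a e := by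
      funext i
      cases i with
      | zero => simp [Fin.snoc]
      | succ n => rfl
    rw [← h1]
    exact iff_of_eq (congrArg _ (Subsingleton.elim _ _))

lemma transduces_of_def {C : GraphClass} {Γ : Type} [Finite Γ] {θ : Bin Γ} (hθ : IsDef2 θ)
    (h : ∀ (n : ℕ) (H : SimpleGraph (Fin n)), ∃ (N : ℕ) (G : SimpleGraph (Fin N)), C N G ∧
      ∃ (c : Fin N → Γ) (e : Fin n → Fin N), Function.Injective e ∧
        ∀ u v : Fin n, u ≠ v → (H.Adj u v ↔
          (θ _ G c (e u) (e v) ∨ θ _ G c (e v) (e u)))) : TransducesAllGraphs C := by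
  obtain ⟨k, ⟨f⟩⟩ := Finite.exists_equiv_fin Γ
  obtain ⟨φ, hφ⟩ := IsDef.toFormula (IsDef.lift f.symm hθ)
  refine ⟨k, φ.relabel (fun i : ℕ => if i = 0 then (0 : Fin 2) else 1), ?_⟩
  intro n H
  obtain ⟨N, G, hG, c, e, he, hH⟩ := h n H
  refine ⟨N, G, hG, fun v => f (c v), e, he, ?_⟩
  have key : ∀ u v, colSat G (fun v => f (c v)) (φ.relabel (fun i : ℕ => if i = 0 then (0 : Fin 2) else 1)) u v
      ↔ θ _ G c u v := by
    intro u v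
    unfold colSat
    let _ := colStruct G (fun v => f (c v))
    rw [Language.Formula.realize_relabel]
    have := hφ _ G (fun v => f (c v)) ((![u, v] : Fin 2 → Fin N) ∘ fun i : ℕ => if i = 0 then (0 : Fin 2) else 1)
    rw [this]
    simp
  intro u v
  rw [key, key]
  by_cases huv : u = v
  · subst huv; simp
  · rw [hH u v huv]
    have : e u ≠ e v := fun h => huv (he h)
    simp [this]

set_option autoImplicit false

/-! ### Ramsey's theorem for sorted lists -/

lemma ramsey_step (r : ℕ) (α : Type) [Finite α]
    (ih : ∀ m, ∃ N, ∀ (f : List ℕ → α) (S : Finset ℕ), N ≤ S.card → ∃ T ⊆ S, m ≤ T.card ∧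
      ∃ a, ∀ l : List ℕ, l.length = r → l.Pairwise (· < ·) → (∀ x ∈ l, x ∈ T) → f l = a) :
    ∀ m, ∃ N, ∀ (f : List ℕ → α) (S : Finset ℕ), N ≤ S.card → ∃ T ⊆ S, m ≤ T.card ∧
      ∃ g : ℕ → α, ∀ x ∈ T, ∀ l : List ℕ, l.length = r → l.Pairwise (· < ·) →
        (∀ y ∈ l, y ∈ T ∧ x < y) → f (x :: l) = g x := by
  intro m
  induction m with
  | zero =>
    refine ⟨0, fun f S _ => ⟨∅, by simp, by simp, fun _ => f [], by simp⟩⟩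
  | succ m ihm =>
    obtain ⟨N1, h1⟩ := ihm
    obtain ⟨N2, h2⟩ := ih N1
    refine ⟨N2 + 1, fun f S hS => ?_⟩
    have hne : S.Nonempty := Finset.card_pos.mp (by omega)
    set x := S.min' hne with hx
    obtain ⟨S', hS', hc, a, ha⟩ := h2 (fun l => f (x :: l)) (S.erase x) (by
      rw [Finset.card_erase_of_mem (S.min'_mem hne)]; omega)
    obtain ⟨T, hT, hTc, g, hg⟩ := h1 f S' hc
    have hxT : ∀ y ∈ T, x < y := fun y hy =>
      S.min'_lt_of_mem_erase_min' hne (hS' (hT hy))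
    have hxnT : x ∉ T := fun h => lt_irrefl _ (hxT x h)
    refine ⟨insert x T, ?_, ?_, Function.update g x a, ?_⟩
    · intro y hy
      rcases Finset.mem_insert.mp hy with rfl | hy
      · exact S.min'_mem hne
      · exact Finset.mem_of_mem_erase (hS' (hT hy))
    · rw [Finset.card_insert_of_notMem hxnT]; omega
    · intro y hy l hl hl2 hl3
      have hl4 : ∀ z ∈ l, z ∈ T := by
        intro z hz
        obtain ⟨h3, h4⟩ := hl3 z hz
        rcases Finset.mem_insert.mp h3 with rfl | h3
        · rcases Finset.mem_insert.mp hy with rfl | hy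
          · exact absurd h4 (lt_irrefl _)
          · exact absurd h4 (not_lt.mpr (hxT y hy).le)
        · exact h3
      rcases Finset.mem_insert.mp hy with rfl | hy
      · rw [Function.update_self]
        exact ha l hl hl2 (fun z hz => hT (hl4 z hz))
      · rw [Function.update_of_ne (hxT y hy).ne']
        exact hg y hy l hl hl2 (fun z hz => ⟨hl4 z hz, (hl3 z hz).2⟩)

lemma pigeon {α : Type} [Finite α] (m : ℕ) : ∃ N, ∀ (g : ℕ → α) (S : Finset ℕ), N ≤ S.card →
    ∃ T ⊆ S, m ≤ T.card ∧ ∃ a, ∀ x ∈ T, g x = a := by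
  classical
  have := Fintype.ofFinite α
  refine ⟨Fintype.card α * m, fun g S hS => ?_⟩
  by_cases hα : Nonempty α
  · obtain ⟨a, -, ha⟩ := Finset.exists_le_card_fiber_of_mul_le_card_of_maps_to (s := S)
      (t := (Finset.univ : Finset α)) (f := g) (n := m) (by simp) (by simpa using hα) (by simpa using hS)
    exact ⟨S.filter (fun x => g x = a), Finset.filter_subset _ _, ha, a, by simp⟩
  · exact absurd ⟨g 0⟩ hα

lemma ramsey (r : ℕ) (α : Type) [Finite α] : ∀ m, ∃ N, ∀ (f : List ℕ → α) (S : Finset ℕ),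
    N ≤ S.card → ∃ T ⊆ S, m ≤ T.card ∧
      ∃ a, ∀ l : List ℕ, l.length = r → l.Pairwise (· < ·) → (∀ x ∈ l, x ∈ T) → f l = a := by
  induction r with
  | zero =>
    intro m
    refine ⟨m, fun f S hS => ⟨S, subset_rfl, hS, f [], fun l hl _ _ => ?_⟩⟩
    rw [List.length_eq_zero_iff.mp hl]
  | succ r ih =>
    intro m
    obtain ⟨N1, h1⟩ := pigeon (α := α) m
    obtain ⟨N2, h2⟩ := ramsey_step r α ih N1
    refine ⟨N2, fun f S hS => ?_⟩
    obtain ⟨T, hT, hTc, g, hg⟩ := h2 f S hS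
    obtain ⟨U, hU, hUc, a, ha⟩ := h1 g T hTc
    refine ⟨U, hU.trans hT, hUc, a, fun l hl hl2 hl3 => ?_⟩
    match l, hl with
    | x :: l, hl =>
      rw [List.pairwise_cons] at hl2
      rw [hg x (hU (hl3 x (by simp))) l (by simpa using hl) hl2.2
        (fun y hy => ⟨hU (hl3 y (by simp [hy])), hl2.1 y hy⟩)]
      exact ha x (hl3 x (by simp))

set_option autoImplicit false

lemma enum_finset (T : Finset ℕ) : ∃ h : ℕ → ℕ, StrictMono h ∧ ∀ i < T.card, h i ∈ T := by
  classical
  let p : ℕ → Prop := fun x => x ∈ T ∨ ∀ y ∈ T, y < x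
  have hinf : {x | p x}.Infinite := by
    apply Set.infinite_of_not_bddAbove
    rintro ⟨b, hb⟩
    have hmem : (b + 1 + T.sup id) ∈ {x | p x} := by
      right
      intro y hy
      have := Finset.le_sup (f := id) hy
      simp only [id] at this
      omega
    have := hb hmem
    omega
  refine ⟨Nat.nth p, Nat.nth_strictMono hinf, fun i hi => ?_⟩
  rcases Nat.nth_mem_of_infinite hinf i with h | h
  · exact h
  · exfalso
    have h1 : T ⊆ (Finset.range i).image (Nat.nth p) := by
      intro y hy
      obtain ⟨j, hj⟩ : ∃ j, Nat.nth p j = y := by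
        have : y ∈ Set.range (Nat.nth p) := by
          rw [Nat.range_nth_of_infinite hinf]; exact Or.inl hy
        exact this
      have hlt := h y hy
      rw [← hj] at hlt
      have := (Nat.nth_strictMono hinf).lt_iff_lt.mp hlt
      exact Finset.mem_image.mpr ⟨j, by simpa using this, hj⟩
    have h2 := Finset.card_le_card h1
    have h3 := Finset.card_image_le (s := Finset.range i) (f := Nat.nth p)
    simp at h3
    omega

lemma ramseyIdx (r : ℕ) (α : Type) [Finite α] (m : ℕ) : ∃ N, ∀ f : List ℕ → α,
    ∃ h : ℕ → ℕ, StrictMono h ∧ (∀ i < m, h i < N) ∧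
      ∃ a, ∀ l : List ℕ, l.length = r → l.Pairwise (· < ·) → (∀ x ∈ l, x < m) →
        f (l.map h) = a := by
  obtain ⟨N, hN⟩ := ramsey r α m
  refine ⟨N, fun f => ?_⟩
  obtain ⟨T, hT, hm, a, ha⟩ := hN f (Finset.range N) (by simp)
  obtain ⟨h, hmono, hh⟩ := enum_finset T
  refine ⟨h, hmono, fun i hi => by simpa using hT (hh i (by omega)), a, ?_⟩
  intro l hl hs hx
  apply ha
  · simpa using hl
  · rw [List.pairwise_map]
    exact hs.imp (fun h => hmono h)
  · intro x hx'
    obtain ⟨y, hy, rfl⟩ := List.mem_map.mp hx'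
    exact hh y (by have := hx y hy; omega)

lemma pigeonIdx {α : Type} [Finite α] (m : ℕ) : ∃ N, ∀ g : ℕ → α,
    ∃ h : ℕ → ℕ, StrictMono h ∧ (∀ i < m, h i < N) ∧ ∃ a, ∀ i < m, g (h i) = a := by
  obtain ⟨N, hN⟩ := pigeon (α := α) m
  refine ⟨N, fun f => ?_⟩
  obtain ⟨T, hT, hm, a, ha⟩ := hN f (Finset.range N) (by simp)
  obtain ⟨h, hmono, hh⟩ := enum_finset T
  exact ⟨h, hmono, fun i hi => by simpa using hT (hh i (by omega)), a,
    fun i hi => ha _ (hh i (by omega))⟩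

/-- Two-two split. -/
def TT (a b c d : Prop) : Prop :=
  (a ∧ b ∧ ¬c ∧ ¬d) ∨ (a ∧ ¬b ∧ c ∧ ¬d) ∨ (a ∧ ¬b ∧ ¬c ∧ d) ∨
  (¬a ∧ b ∧ c ∧ ¬d) ∨ (¬a ∧ b ∧ ¬c ∧ d) ∨ (¬a ∧ ¬b ∧ c ∧ d)

lemma flip_aux {x a b : Prop} (h : x ↔ b) (n : ¬ (a ↔ b)) : x ↔ ¬ a := by tauto

lemma TT_none {m : ℕ} {χ : ℕ → Prop}
    (h : ∀ a b c d, a < b → b < c → c < d → d < m → ¬ TT (χ a) (χ b) (χ c) (χ d)) :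
    ∃ e : Prop, ∃ q0, ∀ i < m, i ≠ q0 → (χ i ↔ e) := by
  classical
  by_contra hcon
  push Not at hcon
  have h1 : ∃ a b, a < b ∧ b < m ∧ χ a ∧ χ b := by
    obtain ⟨i, hi, -, hi2⟩ := hcon False m
    have hi3 : χ i := by tauto
    obtain ⟨j, hj, hji, hj2⟩ := hcon False i
    have hj3 : χ j := by tauto
    rcases lt_or_gt_of_ne hji with h | h
    · exact ⟨j, i, h, hi, hj3, hi3⟩
    · exact ⟨i, j, h, hj, hi3, hj3⟩
  have h2 : ∃ a b, a < b ∧ b < m ∧ ¬ χ a ∧ ¬ χ b := by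
    obtain ⟨i, hi, -, hi2⟩ := hcon True m
    have hi3 : ¬ χ i := by tauto
    obtain ⟨j, hj, hji, hj2⟩ := hcon True i
    have hj3 : ¬ χ j := by tauto
    rcases lt_or_gt_of_ne hji with h | h
    · exact ⟨j, i, h, hi, hj3, hi3⟩
    · exact ⟨i, j, h, hj, hi3, hj3⟩
  obtain ⟨a, b, hab, hb, ha1, hb1⟩ := h1
  obtain ⟨c, d, hcd, hd, hc1, hd1⟩ := h2
  have hac : a ≠ c := by rintro rfl; exact hc1 ha1
  have had : a ≠ d := by rintro rfl; exact hd1 ha1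
  have hbc : b ≠ c := by rintro rfl; exact hc1 hb1
  have hbd : b ≠ d := by rintro rfl; exact hd1 hb1
  by_cases x1 : b < c
  · exact h a b c d (by omega) (by omega) (by omega) (by omega) (by simp [TT, ha1, hb1, hc1, hd1])
  by_cases x2 : d < a
  · exact h c d a b (by omega) (by omega) (by omega) (by omega) (by simp [TT, ha1, hb1, hc1, hd1])
  by_cases x3 : a < c <;> by_cases x4 : b < d
  · exact h a c b d (by omega) (by omega) (by omega) (by omega) (by simp [TT, ha1, hb1, hc1, hd1])
  · exact h a c d b (by omega) (by omega) (by omega) (by omega) (by simp [TT, ha1, hb1, hc1, hd1])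
  · exact h c a b d (by omega) (by omega) (by omega) (by omega) (by simp [TT, ha1, hb1, hc1, hd1])
  · exact h c a d b (by omega) (by omega) (by omega) (by omega) (by simp [TT, ha1, hb1, hc1, hd1])

/-- The three outcomes, in index form. -/
def OutA {V : Type} (χ : V → ℕ → Prop) (m : ℕ) : Prop :=
  ∀ v, ∃ e : Prop, ∃ q0, ∀ i < m, i ≠ q0 → (χ v i ↔ e)
def OutB {V : Type} (χ : V → ℕ → Prop) (m : ℕ) : Prop :=
  ∃ (e : Prop) (o : ℕ → V), ∀ i < m, ∀ j < m,
    (j < i → (χ (o i) j ↔ e)) ∧ (i < j → (χ (o i) j ↔ ¬ e))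
def OutC {V : Type} (χ : V → ℕ → Prop) (m : ℕ) : Prop :=
  ∃ (e : Prop) (v : ℕ → ℕ → V), ∀ s t, s < t → t < m → ∀ q < m,
    ((χ (v s t) q ↔ e) ↔ (q ≠ s ∧ q ≠ t))

lemma lemR_final {V : Type} (m : ℕ) (χ : V → ℕ → Prop) (v : ℕ → ℕ → ℕ → ℕ → V)
    (w0 w1 w2 w3 α0 α1 α2 α3 α4 : Prop) (hw : TT w0 w1 w2 w3) (M : ℕ) (hM : M = 4 * m + 10)
    (W : ∀ i j k l, i < j → j < k → k < l → l < M → (χ (v i j k l) i ↔ w0) ∧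
      (χ (v i j k l) j ↔ w1) ∧ (χ (v i j k l) k ↔ w2) ∧ (χ (v i j k l) l ↔ w3))
    (A : ∀ i j k l q, i < j → j < k → k < l → l < M → q < M →
      (q < i → (χ (v i j k l) q ↔ α0)) ∧
      (i < q → q < j → (χ (v i j k l) q ↔ α1)) ∧
      (j < q → q < k → (χ (v i j k l) q ↔ α2)) ∧
      (k < q → q < l → (χ (v i j k l) q ↔ α3)) ∧
      (l < q → (χ (v i j k l) q ↔ α4))) :
    OutB (fun x i => χ x (4 * (i + 1))) m ∨ OutC (fun x i => χ x (4 * (i + 1))) m := by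
  classical
  by_cases h01 : α0 ↔ α1
  swap
  · left
    refine ⟨α0, fun q => v (4 * (q + 1)) (M-3) (M-2) (M-1), fun i hi j hj => ?_⟩
    have := A (4 * (i + 1)) (M-3) (M-2) (M-1) (4 * (j + 1)) (by omega) (by omega) (by omega)
      (by omega) (by omega)
    refine ⟨fun h => this.1 (by omega), fun h => ?_⟩
    have h2 := this.2.1 (by omega) (by omega)
    exact flip_aux h2 h01
  by_cases h12 : α1 ↔ α2
  swap
  · left
    refine ⟨α1, fun q => v 0 (4 * (q + 1)) (M-2) (M-1), fun i hi j hj => ?_⟩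
    have := A 0 (4 * (i + 1)) (M-2) (M-1) (4 * (j + 1)) (by omega) (by omega) (by omega)
      (by omega) (by omega)
    refine ⟨fun h => this.2.1 (by omega) (by omega), fun h => ?_⟩
    have h2 := this.2.2.1 (by omega) (by omega)
    exact flip_aux h2 h12
  by_cases h23 : α2 ↔ α3
  swap
  · left
    refine ⟨α2, fun q => v 0 1 (4 * (q + 1)) (M-1), fun i hi j hj => ?_⟩
    have := A 0 1 (4 * (i + 1)) (M-1) (4 * (j + 1)) (by omega) (by omega) (by omega)
      (by omega) (by omega)
    refine ⟨fun h => this.2.2.1 (by omega) (by omega), fun h => ?_⟩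
    have h2 := this.2.2.2.1 (by omega) (by omega)
    exact flip_aux h2 h23
  by_cases h34 : α3 ↔ α4
  swap
  · left
    refine ⟨α3, fun q => v 0 1 2 (4 * (q + 1)), fun i hi j hj => ?_⟩
    have := A 0 1 2 (4 * (i + 1)) (4 * (j + 1)) (by omega) (by omega) (by omega)
      (by omega) (by omega)
    refine ⟨fun h => this.2.2.2.1 (by omega) (by omega), fun h => ?_⟩
    have h2 := this.2.2.2.2 (by omega)
    exact flip_aux h2 h34
  right
  have A' : ∀ i j k l q, i < j → j < k → k < l → l < M → q < M → q ≠ i → q ≠ j → q ≠ k →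
      q ≠ l → (χ (v i j k l) q ↔ α0) := by
    intro i j k l q h1 h2 h3 h4 h5 h6 h7 h8 h9
    obtain ⟨a0, a1, a2, a3, a4⟩ := A i j k l q h1 h2 h3 h4 h5
    by_cases c0 : q < i
    · exact a0 c0
    by_cases c1 : q < j
    · rw [a1 (by omega) c1, h01]
    by_cases c2 : q < k
    · rw [a2 (by omega) c2, h01, h12]
    by_cases c3 : q < l
    · rw [a3 (by omega) c3, h01, h12, h23]
    · rw [a4 (by omega), h01, h12, h23, h34]
  have key : ∀ vv : ℕ → ℕ → V, (∀ s t, s < t → t < m →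
      ∃ i j k l, vv s t = v i j k l ∧ i < j ∧ j < k ∧ k < l ∧ l < M ∧
      (∀ q < m, q ≠ s → q ≠ t → 4 * (q + 1) ≠ i ∧ 4 * (q + 1) ≠ j ∧ 4 * (q + 1) ≠ k ∧
        4 * (q + 1) ≠ l) ∧ ¬ (χ (v i j k l) (4 * (s + 1)) ↔ α0) ∧
        ¬ (χ (v i j k l) (4 * (t + 1)) ↔ α0)) →
      OutC (fun x i => χ x (4 * (i + 1))) m := by
    intro vv hvv
    refine ⟨α0, vv, fun s t hst ht q hq => ?_⟩
    obtain ⟨i, j, k, l, he, h1, h2, h3, h4, h5, h6, h7⟩ := hvv s t hst ht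
    dsimp only
    rw [he]
    constructor
    · intro h
      constructor
      · rintro rfl; exact h6 h
      · rintro rfl; exact h7 h
    · rintro ⟨hs, ht'⟩
      obtain ⟨b1, b2, b3, b4⟩ := h5 q hq hs ht'
      exact A' i j k l _ h1 h2 h3 h4 (by omega) b1 b2 b3 b4
  have six : (¬ (w0 ↔ α0) ∧ ¬ (w1 ↔ α0)) ∨ (¬ (w0 ↔ α0) ∧ ¬ (w2 ↔ α0)) ∨
      (¬ (w0 ↔ α0) ∧ ¬ (w3 ↔ α0)) ∨ (¬ (w1 ↔ α0) ∧ ¬ (w2 ↔ α0)) ∨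
      (¬ (w1 ↔ α0) ∧ ¬ (w3 ↔ α0)) ∨ (¬ (w2 ↔ α0) ∧ ¬ (w3 ↔ α0)) := by
    unfold TT at hw
    clear A A' W key h01 h12 h23 h34
    by_cases ha : α0 <;> simp only [ha, iff_true, iff_false] <;> tauto
  rcases six with ⟨x, y⟩ | ⟨x, y⟩ | ⟨x, y⟩ | ⟨x, y⟩ | ⟨x, y⟩ | ⟨x, y⟩
  · refine key (fun s t => v (4 * (s + 1)) (4 * (t + 1)) (M-2) (M-1)) fun s t hst ht => ?_
    refine ⟨_, _, _, _, rfl, by omega, by omega, by omega, by omega, fun q _ _ _ => by omega, ?_⟩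
    obtain ⟨a, b, c, d⟩ := W (4 * (s + 1)) (4 * (t + 1)) (M-2) (M-1) (by omega) (by omega)
      (by omega) (by omega)
    rw [a, b]; exact ⟨x, y⟩
  · refine key (fun s t => v (4 * (s + 1)) (4 * (s + 1) + 1) (4 * (t + 1)) (M-1))
      fun s t hst ht => ?_
    refine ⟨_, _, _, _, rfl, by omega, by omega, by omega, by omega, fun q _ _ _ => by omega, ?_⟩
    obtain ⟨a, b, c, d⟩ := W (4 * (s + 1)) (4 * (s + 1) + 1) (4 * (t + 1)) (M-1) (by omega)
      (by omega) (by omega) (by omega)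
    rw [a, c]; exact ⟨x, y⟩
  · refine key (fun s t => v (4 * (s + 1)) (4 * (s + 1) + 1) (4 * (s + 1) + 2) (4 * (t + 1)))
      fun s t hst ht => ?_
    refine ⟨_, _, _, _, rfl, by omega, by omega, by omega, by omega, fun q _ _ _ => by omega, ?_⟩
    obtain ⟨a, b, c, d⟩ := W (4 * (s + 1)) (4 * (s + 1) + 1) (4 * (s + 1) + 2) (4 * (t + 1))
      (by omega) (by omega) (by omega) (by omega)
    rw [a, d]; exact ⟨x, y⟩
  · refine key (fun s t => v 0 (4 * (s + 1)) (4 * (t + 1)) (M-1)) fun s t hst ht => ?_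
    refine ⟨_, _, _, _, rfl, by omega, by omega, by omega, by omega, fun q _ _ _ => by omega, ?_⟩
    obtain ⟨a, b, c, d⟩ := W 0 (4 * (s + 1)) (4 * (t + 1)) (M-1) (by omega) (by omega)
      (by omega) (by omega)
    rw [b, c]; exact ⟨x, y⟩
  · refine key (fun s t => v 0 (4 * (s + 1)) (4 * (s + 1) + 1) (4 * (t + 1))) fun s t hst ht => ?_
    refine ⟨_, _, _, _, rfl, by omega, by omega, by omega, by omega, fun q _ _ _ => by omega, ?_⟩
    obtain ⟨a, b, c, d⟩ := W 0 (4 * (s + 1)) (4 * (s + 1) + 1) (4 * (t + 1)) (by omega) (by omega)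
      (by omega) (by omega)
    rw [b, d]; exact ⟨x, y⟩
  · refine key (fun s t => v 0 1 (4 * (s + 1)) (4 * (t + 1))) fun s t hst ht => ?_
    refine ⟨_, _, _, _, rfl, by omega, by omega, by omega, by omega, fun q _ _ _ => by omega, ?_⟩
    obtain ⟨a, b, c, d⟩ := W 0 1 (4 * (s + 1)) (4 * (t + 1)) (by omega) (by omega)
      (by omega) (by omega)
    rw [c, d]; exact ⟨x, y⟩

lemma lemR (m : ℕ) : ∃ N, ∀ (V : Type) (χ : V → ℕ → Prop), ∃ h : ℕ → ℕ, StrictMono h ∧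
    (∀ i < m, h i < N) ∧ (OutA (fun v i => χ v (h i)) m ∨ OutB (fun v i => χ v (h i)) m ∨
      OutC (fun v i => χ v (h i)) m) := by
  classical
  obtain ⟨N2, hN2⟩ := ramseyIdx 5 (Fin 5 → Prop) (4 * m + 10)
  obtain ⟨N1, hN1⟩ := ramseyIdx 4 (Set (Fin 4 → Prop)) (N2 + m)
  refine ⟨N1, fun V χ => ?_⟩
  obtain ⟨h1, hm1, hb1, Pat, hP⟩ := hN1 (fun l => {w | ∃ v, ∀ i : Fin 4, (χ v (l.getD i 0) ↔ w i)})
  by_cases hc : ∃ w ∈ Pat, TT (w 0) (w 1) (w 2) (w 3)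
  swap
  · refine ⟨h1, hm1, fun i hi => hb1 i (by omega), Or.inl ?_⟩
    intro v
    apply TT_none
    intro a b c d hab hbc hcd hd htt
    apply hc
    have := hP [a, b, c, d] rfl (by simp; omega) (by simp; omega)
    refine ⟨![χ v (h1 a), χ v (h1 b), χ v (h1 c), χ v (h1 d)], ?_, by simpa using htt⟩
    rw [← this]
    refine ⟨v, ?_⟩
    intro i
    fin_cases i <;> simp
  · obtain ⟨w, hw, htt⟩ := hc
    have hex : ∀ i j k l, i < j ∧ j < k ∧ k < l ∧ l < N2 + m → ∃ v, (χ v (h1 i) ↔ w 0) ∧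
        (χ v (h1 j) ↔ w 1) ∧ (χ v (h1 k) ↔ w 2) ∧ (χ v (h1 l) ↔ w 3) := by
      intro a b c d hh
      have := hP [a, b, c, d] rfl (by simp; omega) (by simp; omega)
      rw [← this] at hw
      obtain ⟨v, hv⟩ := hw
      exact ⟨v, by simpa using hv 0, by simpa using hv 1, by simpa using hv 2, by simpa using hv 3⟩
    by_cases hm0 : N2 + m < 4
    · refine ⟨h1, hm1, fun i hi => hb1 i (by omega), Or.inl ?_⟩
      intro v
      apply TT_none
      intro a b c d hab hbc hcd hd htt
      omega
    obtain ⟨v0, -⟩ := hex 0 1 2 3 (by omega)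
    let v : ℕ → ℕ → ℕ → ℕ → V := fun i j k l =>
      if h : i < j ∧ j < k ∧ k < l ∧ l < N2 + m then (hex i j k l h).choose else v0
    have hv : ∀ i j k l, i < j → j < k → k < l → l < N2 + m → (χ (v i j k l) (h1 i) ↔ w 0) ∧
        (χ (v i j k l) (h1 j) ↔ w 1) ∧ (χ (v i j k l) (h1 k) ↔ w 2) ∧
        (χ (v i j k l) (h1 l) ↔ w 3) := by
      intro i j k l a b c d
      have h : i < j ∧ j < k ∧ k < l ∧ l < N2 + m := ⟨a, b, c, d⟩
      simp only [v, dif_pos h]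
      exact (hex i j k l h).choose_spec
    obtain ⟨h2, hm2, hb2, α, hα⟩ := hN2 (fun l => ![
      χ (v (l.getD 1 0) (l.getD 2 0) (l.getD 3 0) (l.getD 4 0)) (h1 (l.getD 0 0)),
      χ (v (l.getD 0 0) (l.getD 2 0) (l.getD 3 0) (l.getD 4 0)) (h1 (l.getD 1 0)),
      χ (v (l.getD 0 0) (l.getD 1 0) (l.getD 3 0) (l.getD 4 0)) (h1 (l.getD 2 0)),
      χ (v (l.getD 0 0) (l.getD 1 0) (l.getD 2 0) (l.getD 4 0)) (h1 (l.getD 3 0)),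
      χ (v (l.getD 0 0) (l.getD 1 0) (l.getD 2 0) (l.getD 3 0)) (h1 (l.getD 4 0))])
    have H := lemR_final m (fun x i => χ x (h1 (h2 i)))
      (fun i j k l => v (h2 i) (h2 j) (h2 k) (h2 l)) (w 0) (w 1) (w 2) (w 3)
      (α 0) (α 1) (α 2) (α 3) (α 4) htt _ rfl ?_ ?_
    · refine ⟨fun i => h1 (h2 (4 * (i + 1))), ?_, ?_, Or.inr H⟩
      · intro i j hij
        exact hm1 (hm2 (by omega))
      · intro i hi
        apply hb1
        have := hb2 (4 * (i + 1)) (by omega)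
        omega
    · intro i j k l a b c d
      have := hb2 l d
      exact hv _ _ _ _ (hm2 a) (hm2 b) (hm2 c) (by omega)
    · have hh : ∀ a b c d e, a < b → b < c → c < d → d < e → e < 4 * m + 10 →
        (χ (v (h2 b) (h2 c) (h2 d) (h2 e)) (h1 (h2 a)) ↔ α 0) ∧
        (χ (v (h2 a) (h2 c) (h2 d) (h2 e)) (h1 (h2 b)) ↔ α 1) ∧
        (χ (v (h2 a) (h2 b) (h2 d) (h2 e)) (h1 (h2 c)) ↔ α 2) ∧
        (χ (v (h2 a) (h2 b) (h2 c) (h2 e)) (h1 (h2 d)) ↔ α 3) ∧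
        (χ (v (h2 a) (h2 b) (h2 c) (h2 d)) (h1 (h2 e)) ↔ α 4) := by
        intro a b c d e h1 h2 h3 h4 h5
        have := hα [a, b, c, d, e] rfl (by simp; omega) (by simp; omega)
        rw [← this]
        simp
      intro i j k l q a b c d e
      refine ⟨fun x => ?_, fun x y => ?_, fun x y => ?_, fun x y => ?_, fun x => ?_⟩
      · exact (hh q i j k l x a b c d).1
      · exact (hh i q j k l x y b c d).2.1
      · exact (hh i j q k l a x y c d).2.2.1
      · exact (hh i j k q l a b x y d).2.2.2.1
      · exact (hh i j k l q a b c x e).2.2.2.2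

set_option autoImplicit false

lemma greedy {V : Type} (E : ℕ → V → Prop) (U : V → Prop) : ∀ (M : ℕ) (S : Finset ℕ), 2 ^ M ≤ S.card →
    (∀ i ∈ S, ∀ j ∈ S, i ≠ j → ∃ u, U u ∧ ¬ (E i u ↔ E j u)) →
    ∃ x : ℕ → ℕ, (∀ j < M, x j ∈ S) ∧ ∀ j < M, ∃ u, U u ∧ ∃ e : Prop, (E (x j) u ↔ e) ∧
      ∀ l < M, j < l → (E (x l) u ↔ ¬ e) := by
  classical
  intro M
  induction M with
  | zero => intro S _ _; exact ⟨fun _ => 0, by simp, by simp⟩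
  | succ M ih =>
    intro S hS hd
    have h1 : 1 < S.card := by
      have : 0 < 2 ^ M := by positivity
      rw [pow_succ] at hS; omega
    obtain ⟨a, ha, b, hb, hab⟩ := Finset.one_lt_card.mp h1
    obtain ⟨u, hu, hne⟩ := hd a ha b hb hab
    have hsplit := Finset.card_filter_add_card_filter_not (s := S) (fun i => E i u)
    have main : ∀ (S' : Finset ℕ) (z : ℕ) (e : Prop), S' ⊆ S → 2 ^ M ≤ S'.card → z ∈ S →
        (E z u ↔ e) → (∀ y ∈ S', (E y u ↔ ¬ e)) → ∃ x : ℕ → ℕ, (∀ j < M + 1, x j ∈ S) ∧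
          ∀ j < M + 1, ∃ u, U u ∧ ∃ e : Prop, (E (x j) u ↔ e) ∧
          ∀ l < M + 1, j < l → (E (x l) u ↔ ¬ e) := by
      intro S' z e hS' hc hz hze hy
      obtain ⟨x, hx, hx2⟩ := ih S' hc (fun i hi j hj => hd i (hS' hi) j (hS' hj))
      refine ⟨fun i => Nat.casesOn i z x, ?_, ?_⟩
      · intro j hj
        cases j with
        | zero => exact hz
        | succ j => exact hS' (hx j (by omega))
      · intro j hj
        cases j with
        | zero =>
          refine ⟨u, hu, e, hze, ?_⟩
          intro l hl h0
          cases l with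
          | zero => omega
          | succ l => exact hy _ (hx l (by omega))
        | succ j =>
          obtain ⟨u', hu', e', h1, h2⟩ := hx2 j (by omega)
          refine ⟨u', hu', e', h1, ?_⟩
          intro l hl h0
          cases l with
          | zero => omega
          | succ l => exact h2 l (by omega) (by omega)
    have hex : ∃ z ∈ S, E z u := by
      by_cases h : E a u
      · exact ⟨a, ha, h⟩
      · exact ⟨b, hb, by tauto⟩
    have hex' : ∃ z ∈ S, ¬ E z u := by
      by_cases h : E a u
      · exact ⟨b, hb, by tauto⟩
      · exact ⟨a, ha, h⟩
    rcases le_or_gt (2 ^ M) (S.filter (fun i => E i u)).card with h | h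
    · obtain ⟨z, hz, hz2⟩ := hex'
      exact main _ z False (Finset.filter_subset _ _) h hz (by tauto)
        (by intro y hy; simpa using (Finset.mem_filter.mp hy).2)
    · obtain ⟨z, hz, hz2⟩ := hex
      exact main (S.filter (fun i => ¬ E i u)) z True (Finset.filter_subset _ _)
        (by rw [pow_succ] at hS; omega) hz (by tauto)
        (by intro y hy; simpa using (Finset.mem_filter.mp hy).2)

lemma lemK (m : ℕ) : ∃ K, ∀ (V : Type) (E : ℕ → V → Prop) (U : V → Prop),
    (∀ i < K, ∀ j < K, i ≠ j → ∃ u, U u ∧ ¬ (E i u ↔ E j u)) →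
    ∃ h : Fin m → Fin K, ∀ i, ∃ u1 u2, U u1 ∧ U u2 ∧
      ∀ s, ((E (h s) u1 ∧ ¬ E (h s) u2) ↔ s = i) := by
  classical
  obtain ⟨M, hM⟩ := ramseyIdx 2 (Prop × Prop) (m + 4)
  refine ⟨2 ^ M, fun V E U hd => ?_⟩
  obtain ⟨x, hx, hx2⟩ := greedy E U M (Finset.range (2 ^ M)) (by simp) (by
    intro i hi j hj; exact hd i (by simpa using hi) j (by simpa using hj))
  by_cases hV : Nonempty V
  swap
  · obtain ⟨h, hh, hb, -⟩ := hM (fun _ => (True, True))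
    obtain ⟨u, -⟩ := hx2 (h 0) (hb 0 (by omega))
    exact absurd ⟨u⟩ hV
  have hx3 : ∀ j, ∃ u, ∃ e : Prop, j < M → (U u ∧ (E (x j) u ↔ e) ∧
      ∀ l < M, j < l → (E (x l) u ↔ ¬ e)) := by
    intro j
    by_cases hj : j < M
    · obtain ⟨u, a, e, b⟩ := hx2 j hj
      exact ⟨u, e, fun _ => ⟨a, b⟩⟩
    · exact ⟨Classical.choice hV, True, fun h => absurd h hj⟩
  choose u e hue using hx3
  obtain ⟨h, hh, hb, ⟨e0, f0⟩, hc⟩ := hM (fun l => (e (l.getD 0 0), E (x (l.getD 0 0)) (u (l.getD 1 0))))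
  have hc' : ∀ i j, i < j → j < m + 4 → e (h i) = e0 ∧ E (x (h i)) (u (h j)) = f0 := by
    intro i j hij hj
    have := hc [i, j] rfl (by simp; omega) (by simp; omega)
    simpa using this
  have hxb : ∀ i < m + 4, x (h i) < 2 ^ M := fun i hi => by simpa using hx (h i) (hb i hi)
  have Y : ∀ s j, s < m + 3 → j < m + 3 → (s < j → (E (x (h s)) (u (h j)) ↔ f0)) ∧
      (s = j → (E (x (h s)) (u (h j)) ↔ e0)) ∧ (j < s → (E (x (h s)) (u (h j)) ↔ ¬ e0)) := by
    intro s j hs hj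
    obtain ⟨_, h2, h3⟩ := hue (h j) (hb j (by omega))
    have h4 := (hc' j (j + 1) (by omega) (by omega)).1
    refine ⟨fun h => iff_of_eq (hc' s j h (by omega)).2, ?_, ?_⟩
    · rintro rfl; rw [h2, h4]
    · intro hjs; rw [h3 (h s) (hb s (by omega)) (hh hjs), h4]
  have hU : ∀ j < m + 4, U (u (h j)) := fun j hj => (hue (h j) (hb j hj)).1
  refine ⟨fun s => ⟨x (h (s + 1)), hxb _ (by omega)⟩, fun i => ?_⟩
  have fin : ∀ a b, a < m + 3 → b < m + 3 → (∀ s : Fin m,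
      ((E (x (h (s + 1))) (u (h a)) ∧ ¬ E (x (h (s + 1))) (u (h b))) ↔ s = i)) →
      ∃ u1 u2, U u1 ∧ U u2 ∧ ∀ s : Fin m,
      ((E (x (h (s + 1))) u1 ∧ ¬ E (x (h (s + 1))) u2) ↔ s = i) :=
    fun a b ha hb h' => ⟨u (h a), u (h b), hU a (by omega), hU b (by omega), h'⟩
  have tri : ∀ a < m + 3, ∀ s : Fin m, (E (x (h (s + 1))) (u (h a)) ↔
      (((s : ℕ) + 1 < a ∧ f0) ∨ ((s : ℕ) + 1 = a ∧ e0) ∨ (a < (s : ℕ) + 1 ∧ ¬ e0))) := by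
    intro a ha s
    obtain ⟨y1, y2, y3⟩ := Y (s + 1) a (by omega) ha
    rcases lt_trichotomy ((s : ℕ) + 1) a with h | h | h
    · rw [y1 h]; have h1 : ¬ (s : ℕ) + 1 = a := by omega
      have h2 : ¬ a < (s : ℕ) + 1 := by omega
      simp [h, h1, h2]
    · rw [y2 h]; have h1 : ¬ (s : ℕ) + 1 < a := by omega
      have h2 : ¬ a < (s : ℕ) + 1 := by omega
      simp [h]
    · rw [y3 h]; have h1 : ¬ (s : ℕ) + 1 = a := by omega
      have h2 : ¬ (s : ℕ) + 1 < a := by omega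
      simp [h, h1, h2]
  by_cases he : e0 <;> by_cases hf : f0
  · refine fin (i + 1) i (by omega) (by omega) fun s => ?_
    rw [tri _ (by omega), tri _ (by omega)]
    simp only [he, hf, Fin.ext_iff]; simp; omega
  · refine fin (i + 1) (i + 2) (by omega) (by omega) fun s => ?_
    rw [tri _ (by omega), tri _ (by omega)]
    simp only [he, hf, Fin.ext_iff]; simp; omega
  · refine fin (i + 2) (i + 1) (by omega) (by omega) fun s => ?_
    rw [tri _ (by omega), tri _ (by omega)]
    simp only [he, hf, Fin.ext_iff]; simp; omega
  · refine fin i (i + 1) (by omega) (by omega) fun s => ?_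
    rw [tri _ (by omega), tri _ (by omega)]
    simp only [he, hf, Fin.ext_iff]; simp; omega

/-- The formula of the first pattern. -/
def θ1 {Γ : Type} (σ : Bin Γ) : Bin (Γ × (Fin 4 → Prop)) := fun V G c x y =>
  ∃ u1 u2 u3 u4 : V, (c u1).2 0 ∧ (c u2).2 1 ∧ (c u3).2 2 ∧ (c u4).2 3 ∧
    σ V G (fun v => (c v).1) u1 u2 ∧ σ V G (fun v => (c v).1) u1 u3 ∧
    σ V G (fun v => (c v).1) u1 u4 ∧
    G.Adj x u1 ∧ ¬ G.Adj x u2 ∧ G.Adj y u3 ∧ ¬ G.Adj y u4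

lemma defThetaOne {Γ : Type} [Finite Γ] {σ : Bin Γ} (h : IsDef2 σ) : IsDef2 (θ1 σ) := by
  unfold IsDef2 θ1
  refine .ex (.ex (.ex (.ex (.and (.colp 3 fun (g : Γ × (Fin 4 → Prop)) => g.2 0) (.and (.colp 2 fun (g : Γ × (Fin 4 → Prop)) => g.2 1)
    (.and (.colp 1 fun (g : Γ × (Fin 4 → Prop)) => g.2 2) (.and (.colp 0 fun (g : Γ × (Fin 4 → Prop)) => g.2 3) (.and (h.lapp _ 3 2)
    (.and (h.lapp _ 3 1) (.and (h.lapp _ 3 0) (.and (.adj _ _) (.and (.not (.adj _ _))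
    (.and (.adj _ _) (.not (.adj _ _)))))))))))))))

lemma pattern1 {C : GraphClass} {Γ : Type} [Finite Γ] {σ : Bin Γ} (hσ : IsDef2 σ)
    (h : ∀ k n : ℕ, ∃ (N : ℕ) (G : SimpleGraph (Fin N)), C N G ∧
      ∃ (c : Fin N → Γ) (T : Fin N → Prop) (p : Fin N → ℕ) (v : ℕ → Fin N),
        (∀ u u', T u → T u' → (σ _ G c u u' ↔ p u = p u')) ∧
        ∀ q < n, ∀ i < k, ∀ j < k, i ≠ j → ∃ u, T u ∧ p u = q ∧ ¬ (G.Adj (v i) u ↔ G.Adj (v j) u)) :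
    TransducesAllGraphs C := by
  classical
  refine transduces_of_def (defThetaOne hσ) ?_
  intro n H
  obtain ⟨K, hK⟩ := lemK n
  obtain ⟨L, hL⟩ := pigeonIdx (α := Set (Fin n → Fin K)) (n * n + 1)
  obtain ⟨N, G, hG, c, T, p, v, hp, hd⟩ := h K L
  refine ⟨N, G, hG, ?_⟩
  obtain ⟨g, hg, hgb, A, hA⟩ := hL (fun q => {h | ∀ i, ∃ u1 u2, (T u1 ∧ p u1 = q) ∧
    (T u2 ∧ p u2 = q) ∧ ∀ s, ((G.Adj (v (h s)) u1 ∧ ¬ G.Adj (v (h s)) u2) ↔ s = i)})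
  have hq : ∀ q < n * n + 1, ∃ x, x ∈ A := by
    intro q hq
    rw [← hA q hq]
    exact hK _ (fun i u => G.Adj (v i) u) (fun u => T u ∧ p u = g q) (fun i hi j hj hij => by
      obtain ⟨u, a, b, c⟩ := hd (g q) (hgb q hq) i hi j hj hij
      exact ⟨u, ⟨a, b⟩, c⟩)
  obtain ⟨w, hw⟩ := hq 0 (by omega)
  have hw' : ∀ q < n * n + 1, ∀ i, ∃ u1 u2, (T u1 ∧ p u1 = g q) ∧
    (T u2 ∧ p u2 = g q) ∧ ∀ s, ((G.Adj (v (w s)) u1 ∧ ¬ G.Adj (v (w s)) u2) ↔ s = i) := by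
    intro q hq
    have := hw
    rw [← hA q hq] at this
    exact this
  have hw2 : ∀ (q i : Fin n), ∀ i', ∃ u1 u2, (T u1 ∧ p u1 = g (finProdFinEquiv (q, i))) ∧
    (T u2 ∧ p u2 = g (finProdFinEquiv (q, i))) ∧
    ∀ s, ((G.Adj (v (w s)) u1 ∧ ¬ G.Adj (v (w s)) u2) ↔ s = i') := by
    intro q i
    exact hw' _ (by have := (finProdFinEquiv (q, i)).2; omega)
  choose u1 u2 hu1 hu2 hu using hw2
  refine ⟨fun x => (c x, ![∃ i j, H.Adj i j ∧ x = u1 i j i, ∃ i j, H.Adj i j ∧ x = u2 i j i,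
    ∃ i j, H.Adj i j ∧ x = u1 i j j, ∃ i j, H.Adj i j ∧ x = u2 i j j]), fun s => v (w s), ?_, ?_⟩
  · intro s t hst
    dsimp only at hst
    have h1 := hu s s s s
    have h2 := hu s s s t
    rw [← hst, h1] at h2
    exact (h2.mp rfl).symm
  · have inj : ∀ {i j i' j' : Fin n}, g (finProdFinEquiv (i, j)) = g (finProdFinEquiv (i', j')) →
        i = i' ∧ j = j' := by
      intro i j i' j' h
      have := hg.injective h
      have := finProdFinEquiv.injective (Fin.ext this)
      simpa using this
    have key : ∀ s t, θ1 σ _ G (fun x => (c x, ![∃ i j, H.Adj i j ∧ x = u1 i j i, ∃ i j, H.Adj i j ∧ x = u2 i j i,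
        ∃ i j, H.Adj i j ∧ x = u1 i j j, ∃ i j, H.Adj i j ∧ x = u2 i j j])) (v (w s)) (v (w t)) ↔ H.Adj s t := by
      intro s t
      constructor
      · rintro ⟨x1, x2, x3, x4, ⟨i, j, hij, rfl⟩, ⟨i2, j2, -, rfl⟩, ⟨i3, j3, -, rfl⟩, ⟨i4, j4, -, rfl⟩,
          e12, e13, e14, a1, a2, a3, a4⟩
        have e12' := (hp _ _ (hu1 _ _ _).1 (hu2 _ _ _).1).mp e12
        have e13' := (hp _ _ (hu1 _ _ _).1 (hu1 _ _ _).1).mp e13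
        have e14' := (hp _ _ (hu1 _ _ _).1 (hu2 _ _ _).1).mp e14
        rw [(hu1 _ _ _).2, (hu2 _ _ _).2] at e12' e14'
        rw [(hu1 _ _ _).2, (hu1 _ _ _).2] at e13'
        obtain ⟨rfl, rfl⟩ := inj e12'
        obtain ⟨rfl, rfl⟩ := inj e13'
        obtain ⟨rfl, rfl⟩ := inj e14'
        rw [(hu i j i s).mp ⟨a1, a2⟩, (hu i j j t).mp ⟨a3, a4⟩]
        exact hij
      · intro hst
        refine ⟨u1 s t s, u2 s t s, u1 s t t, u2 s t t, ⟨s, t, hst, rfl⟩, ⟨s, t, hst, rfl⟩,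
          ⟨s, t, hst, rfl⟩, ⟨s, t, hst, rfl⟩, ?_, ?_, ?_, ?_⟩
        · exact (hp _ _ (hu1 _ _ _).1 (hu2 _ _ _).1).mpr (by rw [(hu1 _ _ _).2, (hu2 _ _ _).2])
        · exact (hp _ _ (hu1 _ _ _).1 (hu1 _ _ _).1).mpr (by rw [(hu1 _ _ _).2, (hu1 _ _ _).2])
        · exact (hp _ _ (hu1 _ _ _).1 (hu2 _ _ _).1).mpr (by rw [(hu1 _ _ _).2, (hu2 _ _ _).2])
        · have := (hu s t s s).mpr rfl
          have := (hu s t t t).mpr rfl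
          tauto
    intro s t _
    rw [key, key, H.adj_comm t s, or_self]

/-- The negation of agreement with some member of `S` on column `q`. -/
def NCP {V : Type} (G : SimpleGraph V) (U T S : V → Prop) (p : V → ℕ) (v : V) (q : ℕ) : Prop :=
  (U v ∧ p v = q) ∨ ∀ x, S x → ∃ u, T u ∧ p u = q ∧ ¬ (G.Adj v u ↔ G.Adj x u)

/-- Definable version of `NCP`. -/
def ncF {Γ : Type} (σ : Bin Γ) : Bin (Γ × (Fin 5 → Prop)) := fun V G c z a =>
  ((c z).2 0 ∧ σ V G (fun v => (c v).1) z a) ∨ ∀ x, (c x).2 2 → ∃ u, (c u).2 1 ∧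
    σ V G (fun v => (c v).1) u a ∧ ¬ (G.Adj z u ↔ G.Adj x u)

lemma ncF_def {Γ : Type} [Finite Γ] {σ : Bin Γ} (h : IsDef2 σ) : IsDef2 (ncF σ) := by
  unfold IsDef2 ncF
  exact .or (.and (.colp 0 fun (g : Γ × (Fin 5 → Prop)) => g.2 0) (h.lapp _ 0 1)) (.all (.imp (.colp 0 fun (g : Γ × (Fin 5 → Prop)) => g.2 2)
    (.ex (.and (.colp 0 fun (g : Γ × (Fin 5 → Prop)) => g.2 1) (.and (h.lapp _ 0 3) (.not (.iff (.adj _ _) (.adj _ _))))))))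

/-- The formula of the second pattern. -/
def θ2 {Γ : Type} (σ : Bin Γ) : Bin (Γ × (Fin 5 → Prop)) := fun V G c a b =>
  ∃ z, (c z).2 3 ∧ ¬ (ncF σ V G c z a ↔ (c z).2 4) ∧ ¬ (ncF σ V G c z b ↔ (c z).2 4)

lemma defThetaTwo {Γ : Type} [Finite Γ] {σ : Bin Γ} (h : IsDef2 σ) : IsDef2 (θ2 σ) := by
  unfold IsDef2 θ2
  exact .ex (.and (.colp 0 fun (g : Γ × (Fin 5 → Prop)) => g.2 3) (.and
    (.not (.iff ((ncF_def h).app 0 1) (.colp 0 fun (g : Γ × (Fin 5 → Prop)) => g.2 4)))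
    (.not (.iff ((ncF_def h).app 0 2) (.colp 0 fun (g : Γ × (Fin 5 → Prop)) => g.2 4)))))

lemma pattern2 {C : GraphClass} {Γ : Type} [Finite Γ] {σ : Bin Γ} (hσ : IsDef2 σ)
    (h : ∀ n : ℕ, ∃ (N : ℕ) (G : SimpleGraph (Fin N)), C N G ∧
      ∃ (c : Fin N → Γ) (U T S : Fin N → Prop) (p : Fin N → ℕ),
        (∀ u u', U u → U u' → (σ _ G c u u' ↔ p u = p u')) ∧ (∀ u, T u → U u) ∧
        (∀ q < n, ∃ u, U u ∧ p u = q) ∧ OutC (NCP G U T S p) n) :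
    TransducesAllGraphs C := by
  classical
  refine transduces_of_def (defThetaTwo hσ) ?_
  intro n H
  obtain ⟨N, G, hG, c, U, T, S, p, hp, hTU, hq, e, v, hv⟩ := h n
  have hq' : ∀ q : Fin n, ∃ u, U u ∧ p u = q := fun q => hq q q.2
  choose rep hrepU hrepp using hq'
  refine ⟨N, G, hG, fun x => (c x, ![U x, T x, S x, ∃ s t : Fin n, s < t ∧ H.Adj s t ∧ x = v s t, e]),
    rep, ?_, ?_⟩
  · intro a b hab
    have := hrepp a
    rw [hab, hrepp b] at this
    exact Fin.ext this.symm
  set c' : Fin N → Γ × (Fin 5 → Prop) := fun x => (c x, ![U x, T x, S x,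
    ∃ s t : Fin n, s < t ∧ H.Adj s t ∧ x = v s t, e])
  have k1 : ∀ z (q : Fin n), ncF σ _ G c' z (rep q) ↔ NCP G U T S p z q := by
    intro z q
    unfold ncF NCP
    apply or_congr
    · apply and_congr_right
      intro hz
      rw [← hrepp q]
      exact hp z (rep q) hz (hrepU q)
    · refine forall_congr' fun x => imp_congr_right fun hx => exists_congr fun u => ?_
      apply and_congr_right
      intro hu
      apply and_congr_left
      intro _
      rw [← hrepp q]
      exact hp u (rep q) (hTU u hu) (hrepU q)
  have k2 : ∀ s t : Fin n, s < t → ∀ q : Fin n,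
      (¬ (ncF σ _ G c' (v s t) (rep q) ↔ e) ↔ (q = s ∨ q = t)) := by
    intro s t hst q
    rw [k1, hv s t hst t.2 q q.2, Fin.ext_iff, Fin.ext_iff]
    tauto
  have key : ∀ a b, a ≠ b → (θ2 σ _ G c' (rep a) (rep b) ↔ H.Adj a b) := by
    intro a b hab
    constructor
    · rintro ⟨z, ⟨s, t, hst, hadj, rfl⟩, h1, h2⟩
      have h1' := (k2 s t hst a).mp h1
      have h2' := (k2 s t hst b).mp h2
      rcases h1' with rfl | rfl <;> rcases h2' with rfl | rfl
      · exact absurd rfl hab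
      · exact hadj
      · exact hadj.symm
      · exact absurd rfl hab
    · intro hadj
      rcases lt_or_gt_of_ne hab with h | h
      · exact ⟨v a b, ⟨a, b, h, hadj, rfl⟩, (k2 a b h a).mpr (Or.inl rfl), (k2 a b h b).mpr (Or.inr rfl)⟩
      · exact ⟨v b a, ⟨b, a, h, hadj.symm, rfl⟩, (k2 b a h a).mpr (Or.inr rfl), (k2 b a h b).mpr (Or.inl rfl)⟩
  intro a b hab
  rw [key a b hab, key b a hab.symm, H.adj_comm b a, or_self]

set_option autoImplicit false

/-! ### Insulator-like systems -/

structure OrdSys {V Γ : Type} (r n : ℕ) (ψ : Bin Γ) (G : SimpleGraph V) (W : V → Prop)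
    (c : V → Γ) (lev p : V → ℕ) : Prop where
  clev : ∀ u v, c u = c v → lev u = lev v
  base : ∀ i < n, ∃ a, W a ∧ lev a = 0 ∧ p a = i
  bd : ∀ v, lev v ≤ r → p v < n
  ord : ∀ u v, lev u ≤ r → lev v ≤ r → (ψ V G c u v ↔ p u ≤ p v)
  reg : ∀ u u' v v', lev u < r → c u = c u' → c v = c v' → 0 < p u → p u + 1 < n →
    0 < p u' → p u' + 1 < n →
    (lev u + 1 < lev v ∨ (p u + 1 < p v ∧ p u' + 1 < p v') ∨ (p v + 1 < p u ∧ p v' + 1 < p u')) →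
    (G.Adj u v ↔ G.Adj u' v')

structure OrlSys {V Γ : Type} (r n : ℕ) (ψ : Bin Γ) (G : SimpleGraph V) (W : V → Prop)
    (c : V → Γ) (lev p : V → ℕ) : Prop where
  clev : ∀ u v, c u = c v → lev u = lev v
  base : ∀ i < n, ∃ a, W a ∧ lev a = 0 ∧ p a = i
  bd : ∀ v, lev v ≤ r → p v < n
  same : ∀ u v, lev u ≤ r → lev v ≤ r → (ψ V G c u v ↔ p u = p v)
  reg : ∀ u u' v v', lev u < r → c u = c u' → c v = c v' →
    (lev u + 1 < lev v ∨ (p u ≠ p v ∧ p u' ≠ p v')) →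
    (G.Adj u v ↔ G.Adj u' v')

/-- Index of a column in an enumeration. -/
noncomputable def idx (h : ℕ → ℕ) (x : ℕ) : ℕ := Function.invFun h x

lemma idx_eq {h : ℕ → ℕ} (hh : StrictMono h) (i : ℕ) : idx h (h i) = i :=
  Function.leftInverse_invFun hh.injective i

lemma OutA.sub {V : Type} {χ : V → ℕ → Prop} {M m : ℕ} (hA : OutA χ M) {g : ℕ → ℕ}
    (hg : StrictMono g) (hb : ∀ i < m, g i < M) : OutA (fun v i => χ v (g i)) m := by
  intro v
  obtain ⟨e, q0, h⟩ := hA v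
  refine ⟨e, idx g q0, fun i hi hne => h _ (hb i hi) ?_⟩
  rintro rfl
  exact hne (idx_eq hg i).symm

lemma iterR (k : ℕ) : ∀ m, ∃ M, ∀ (V : Type) (χ : ℕ → V → ℕ → Prop), ∃ h : ℕ → ℕ, StrictMono h ∧
    (∀ i < m, h i < M) ∧ ((∃ a < k, OutB (fun v i => χ a v (h i)) m) ∨
      (∃ a < k, OutC (fun v i => χ a v (h i)) m) ∨ ∀ a < k, OutA (fun v i => χ a v (h i)) m) := by
  induction k with
  | zero => intro m; exact ⟨m, fun V χ => ⟨id, strictMono_id, fun i hi => hi, Or.inr (Or.inr (by simp))⟩⟩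
  | succ k ih =>
    intro m
    obtain ⟨M1, h1⟩ := ih m
    obtain ⟨M2, h2⟩ := lemR (M1 + m)
    refine ⟨M2, fun V χ => ?_⟩
    obtain ⟨g, hg, hgb, hout⟩ := h2 V (χ k)
    rcases hout with hA | hB | hC
    · obtain ⟨g', hg', hgb', hout'⟩ := h1 V (fun a v i => χ a v (g i))
      refine ⟨fun i => g (g' i), fun i j hij => hg (hg' hij), fun i hi => hgb _ (by have := hgb' i hi; omega), ?_⟩
      rcases hout' with ⟨a, ha, h⟩ | ⟨a, ha, h⟩ | h
      · exact Or.inl ⟨a, by omega, h⟩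
      · exact Or.inr (Or.inl ⟨a, by omega, h⟩)
      · refine Or.inr (Or.inr fun a ha => ?_)
        rcases Nat.lt_succ_iff_lt_or_eq.mp ha with ha | rfl
        · exact h a ha
        · exact hA.sub (m := m) hg' (fun i hi => by have := hgb' i hi; omega)
    · refine ⟨g, hg, fun i hi => hgb i (by omega), Or.inl ⟨k, by omega, ?_⟩⟩
      obtain ⟨e, o, h⟩ := hB
      exact ⟨e, o, fun i hi j hj => h i (by omega) j (by omega)⟩
    · refine ⟨g, hg, fun i hi => hgb i (by omega), Or.inr (Or.inl ⟨k, by omega, ?_⟩)⟩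
      obtain ⟨e, o, h⟩ := hC
      exact ⟨e, o, fun s t hst ht q hq => h s t hst (by omega) q (by omega)⟩

/-- Columns data. -/
def Dat (C : GraphClass) {Γ : Type} (σ : Bin Γ) (N : ℕ) (G : SimpleGraph (Fin N))
    (U T : Fin N → Prop) (p : Fin N → ℕ) (n : ℕ) : Prop :=
  C N G ∧ (∃ c : Fin N → Γ, ∀ u u', U u → U u' → (σ _ G c u u' ↔ p u = p u')) ∧ (∀ u, T u → U u) ∧
    ∀ q < n, ∃ u, U u ∧ p u = q

/-- Members of `s` pairwise distinguished on the columns `h i`, `i < M`. -/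
def ED {V : Type} (G : SimpleGraph V) (T : V → Prop) (p : V → ℕ) (h : ℕ → ℕ) (M k : ℕ)
    (s : ℕ → V) : Prop :=
  ∀ q < M, ∀ i < k, ∀ j < k, i ≠ j → ∃ u, T u ∧ p u = h q ∧ ¬ (G.Adj (s i) u ↔ G.Adj (s j) u)

lemma noP1 {C : GraphClass} (hC : ¬ TransducesAllGraphs C) {Γ : Type} [Finite Γ] {σ : Bin Γ}
    (hσ : IsDef2 σ) : ∃ k0 n0, ∀ N G U T p n, Dat C σ N G U T p n → ∀ h, StrictMono h →
      ∀ s, ¬ ED G T p h n0 k0 s := by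
  by_contra hcon
  push Not at hcon
  apply hC
  refine pattern1 hσ fun k n => ?_
  obtain ⟨N, G, U, T, p, n', ⟨hG, ⟨c, hc⟩, hT, -⟩, h, hm, s, hED⟩ := hcon k n
  refine ⟨N, G, hG, c, fun u => T u ∧ ∃ i, p u = h i, fun u => idx h (p u), s, ?_, ?_⟩
  · rintro u u' ⟨hu, i, hi⟩ ⟨hu', i', hi'⟩
    dsimp only
    rw [hc u u' (hT u hu) (hT u' hu'), hi, hi', idx_eq hm, idx_eq hm]
    exact hm.injective.eq_iff
  · intro q hq i hi j hj hij
    obtain ⟨u, h1, h2, h3⟩ := hED q hq i hi j hj hij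
    exact ⟨u, ⟨h1, q, h2⟩, by dsimp only; rw [h2, idx_eq hm], h3⟩

lemma noP2 {C : GraphClass} (hC : ¬ TransducesAllGraphs C) {Γ : Type} [Finite Γ] {σ : Bin Γ}
    (hσ : IsDef2 σ) : ∃ K, ∀ N G U T p n, Dat C σ N G U T p n → ∀ h, StrictMono h →
      (∀ i < K, h i < n) → ∀ S, ¬ OutC (fun v i => NCP G U T S p v (h i)) K := by
  by_contra hcon
  push Not at hcon
  apply hC
  refine pattern2 hσ fun K => ?_
  obtain ⟨N, G, U, T, p, n, ⟨hG, ⟨c, hc⟩, hT, hn⟩, h, hm, hb, S, hout⟩ := hcon K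
  refine ⟨N, G, hG, c, fun u => U u ∧ ∃ i, p u = h i, fun u => T u ∧ ∃ i, p u = h i, S,
    fun u => idx h (p u), ?_, ?_, ?_, ?_⟩
  · rintro u u' ⟨hu, i, hi⟩ ⟨hu', i', hi'⟩
    dsimp only
    rw [hc u u' hu hu', hi, hi', idx_eq hm, idx_eq hm]
    exact hm.injective.eq_iff
  · rintro u ⟨h1, h2⟩; exact ⟨hT u h1, h2⟩
  · intro q hq
    obtain ⟨u, h1, h2⟩ := hn (h q) (hb q hq)
    exact ⟨u, ⟨h1, q, h2⟩, by dsimp only; rw [h2, idx_eq hm]⟩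
  · have : (fun v i => NCP G U T S p v (h i)) = NCP G (fun u => U u ∧ ∃ i, p u = h i)
        (fun u => T u ∧ ∃ i, p u = h i) S (fun u => idx h (p u)) := by
      funext v q
      have aux : ∀ (P : Fin N → Prop) (u : Fin N), ((P u ∧ ∃ i, p u = h i) ∧ idx h (p u) = q) ↔
          (P u ∧ p u = h q) := by
        intro P u
        constructor
        · rintro ⟨⟨h1, i, hi⟩, h2⟩
          rw [hi, idx_eq hm] at h2
          exact ⟨h1, by rw [hi, h2]⟩
        · rintro ⟨h1, h2⟩
          exact ⟨⟨h1, q, h2⟩, by rw [h2, idx_eq hm]⟩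
      unfold NCP
      apply propext
      rw [aux]
      refine or_congr_right (forall_congr' fun x => imp_congr_right fun _ => exists_congr fun u => ?_)
      rw [← and_assoc, ← and_assoc, aux]
    rw [← this]
    exact hout

/-- Outcome of the column cleaning claim. -/
def ClaimOut {V : Type} (G : SimpleGraph V) (U T : V → Prop) (p : V → ℕ) (n k0 m : ℕ) : Prop :=
  (∃ x h, StrictMono h ∧ (∀ i < m, h i < n) ∧ OutB (fun v i => NCP G U T (fun y => y = x) p v (h i)) m) ∨
  (∃ (s : ℕ → V) (h : ℕ → ℕ), StrictMono h ∧ (∀ i < m, h i < n) ∧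
    ∀ v, ∃ t < k0, ∃ q0, ∀ i < m, i ≠ q0 → ¬ NCP G U T (fun y => y = s t) p v (h i))

lemma claimA {C : GraphClass} (hC : ¬ TransducesAllGraphs C) {Γ : Type} [Finite Γ] {σ : Bin Γ}
    (hσ : IsDef2 σ) : ∃ k0, ∀ m, ∃ M, ∀ N G U T p n, Dat C σ N G U T p n → M ≤ n →
      ClaimOut G U T p n k0 m := by
  classical
  obtain ⟨k0, n0, h1⟩ := noP1 hC hσ
  obtain ⟨K, h2⟩ := noP2 hC hσ
  refine ⟨k0, fun m => ?_⟩
  have main : ∀ d k, k + d = k0 → ∃ M, ∀ N G U T p n, Dat C σ N G U T p n → ∀ h, StrictMono h →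
      (∀ i < M, h i < n) → ∀ s, ED G T p h M k s → ClaimOut G U T p n k0 m := by
    intro d
    induction d with
    | zero =>
      intro k hk
      refine ⟨n0, fun N G U T p n hD h hm hb s hE => ?_⟩
      have : k = k0 := by omega
      subst this
      exact absurd hE (h1 N G U T p n hD h hm s)
    | succ d ih =>
      intro k hk
      obtain ⟨n2, hn2⟩ := ih (k + 1) (by omega)
      obtain ⟨M, hM⟩ := iterR k (m + n2 + k + 1 + K)
      refine ⟨M, fun N G U T p n hD h hm hb s hE => ?_⟩
      by_cases hcase : ∃ (v : Fin N) (g : ℕ → ℕ), StrictMono g ∧ (∀ i < n2, g i < M) ∧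
        ∀ i < n2, ∀ a < k, ∃ u, T u ∧ p u = h (g i) ∧ ¬ (G.Adj v u ↔ G.Adj (s a) u)
      · obtain ⟨v, g, hg, hgb, hd⟩ := hcase
        refine hn2 N G U T p n hD (fun i => h (g i)) (fun i j hij => hm (hg hij))
          (fun i hi => hb _ (hgb i hi)) (Function.update s k v) ?_
        intro q hq i hi j hj hij
        by_cases hik : i = k
        · subst hik
          rw [Function.update_self, Function.update_of_ne hij.symm]
          exact hd q hq j (by omega)
        · by_cases hjk : j = k
          · subst hjk
            rw [Function.update_self, Function.update_of_ne hij]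
            obtain ⟨u, a, b, c⟩ := hd q hq i (by omega)
            exact ⟨u, a, b, fun h => c h.symm⟩
          · rw [Function.update_of_ne hik, Function.update_of_ne hjk]
            exact hE _ (hgb q hq) i (by omega) j (by omega) hij
      · obtain ⟨g, hg, hgb, hout⟩ := hM (Fin N) (fun a v i => NCP G U T (fun y => y = s a) p v (h i))
        have hmono : StrictMono (fun i => h (g i)) := fun i j hij => hm (hg hij)
        rcases hout with ⟨a, ha, e, o, hB⟩ | ⟨a, ha, e, o, hc⟩ | hA
        · exact Or.inl ⟨s a, fun i => h (g i), hmono, fun i hi => hb _ (hgb i (by omega)), e, o,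
            fun i hi j hj => hB i (by omega) j (by omega)⟩
        · exfalso
          refine h2 N G U T p n hD (fun i => h (g i)) hmono (fun i hi => hb _ (hgb i (by omega))) _
            ⟨e, o, fun s t hst ht q hq => hc s t hst (by omega) q (by omega)⟩
        · refine Or.inr ⟨s, fun i => h (g i), hmono, fun i hi => hb _ (hgb i (by omega)), ?_⟩
          intro v
          by_contra hno
          push Not at hno
          apply hcase
          have hA' : ∀ a, ∃ q0, a < k → ∀ i < m + n2 + k + 1 + K, i ≠ q0 →
              NCP G U T (fun y => y = s a) p v (h (g i)) := by
            intro a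
            by_cases ha : a < k
            · obtain ⟨e, q0, he⟩ := hA a ha v
              refine ⟨q0, fun _ i hi hne => ?_⟩
              have he' : e := by
                by_contra hne
                obtain ⟨i, hi, h3, h4⟩ := hno a (by omega) q0
                exact hne ((he i (by omega) h3).mp h4)
              exact (he i hi hne).mpr he'
            · exact ⟨0, fun h => absurd h ha⟩
          choose q0 hq0 using hA'
          let B : Finset ℕ := ((Finset.range (m + n2 + k + 1 + K)) \ (Finset.range k).image q0) \
            {idx (fun i => h (g i)) (p v)}
          have hBc : n2 ≤ B.card := by
            have e1 := Finset.le_card_sdiff {idx (fun i => h (g i)) (p v)}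
              ((Finset.range (m + n2 + k + 1 + K)) \ (Finset.range k).image q0)
            have e2 := Finset.le_card_sdiff ((Finset.range k).image q0) (Finset.range (m + n2 + k + 1 + K))
            have e3 := Finset.card_image_le (s := Finset.range k) (f := q0)
            simp only [Finset.card_range, Finset.card_singleton] at e1 e2 e3
            have : B.card = (((Finset.range (m + n2 + k + 1 + K)) \ (Finset.range k).image q0) \
              {idx (fun i => h (g i)) (p v)}).card := rfl
            omega
          obtain ⟨f, hf, hfB⟩ := enum_finset B
          have hfB' : ∀ i < n2, f i < m + n2 + k + 1 + K ∧ (∀ a < k, f i ≠ q0 a) ∧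
              f i ≠ idx (fun i => h (g i)) (p v) := by
            intro i hi
            have := hfB i (by omega)
            simp only [B, Finset.mem_sdiff, Finset.mem_range, Finset.mem_image, Finset.mem_singleton,
              not_exists, not_and] at this
            exact ⟨this.1.1, fun a ha h => this.1.2 a ha h.symm, this.2⟩
          refine ⟨v, fun i => g (f i), fun i j hij => hg (hf hij), fun i hi => hgb _ (hfB' i hi).1, ?_⟩
          intro i hi a ha
          obtain ⟨b1, b2, b3⟩ := hfB' i hi
          rcases hq0 a ha (f i) b1 (b2 a ha) with ⟨-, h3⟩ | h3
          · exfalso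
            apply b3
            rw [h3]
            exact (idx_eq hmono (f i)).symm
          · exact h3 (s a) rfl
  obtain ⟨M, hM⟩ := main k0 0 (by omega)
  refine ⟨M + 1, fun N G U T p n hD hn => ?_⟩
  obtain ⟨u, -⟩ := hD.2.2.2 0 (by omega)
  exact hM N G U T p n hD id strictMono_id (fun i hi => by simp; omega) (fun _ => u)
    (by intro q hq i hi; omega)

set_option autoImplicit false

/-- kept vertices -/
def Kp {V : Type} (lev p : V → ℕ) (r : ℕ) (h : ℕ → ℕ) (m : ℕ) (v : V) : Prop :=
  lev v ≤ r ∧ ∃ i < m, p v = h i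

lemma ncF_iff {V Γ : Type} {G : SimpleGraph V} {σ : Bin Γ} {c : V → Γ × (Fin 5 → Prop)}
    {U T S : V → Prop} {p : V → ℕ}
    (hp : ∀ u u', U u → U u' → (σ V G (fun v => (c v).1) u u' ↔ p u = p u')) (hTU : ∀ u, T u → U u)
    (h0 : ∀ v, (c v).2 0 ↔ U v) (h1 : ∀ v, (c v).2 1 ↔ T v) (h2 : ∀ v, (c v).2 2 ↔ S v)
    (z a : V) (ha : U a) : ncF σ V G c z a ↔ NCP G U T S p z (p a) := by
  unfold ncF NCP
  apply or_congr
  · rw [h0]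
    apply and_congr_right
    intro hz
    exact hp z a hz ha
  · refine forall_congr' fun x => imp_congr (h2 x) (exists_congr fun u => ?_)
    rw [h1]
    apply and_congr_right
    intro hu
    apply and_congr_left
    intro _
    exact hp u a (hTU u hu) ha

/-- The order formula extracted from an orderless system. -/
def ψO {Γ : Type} (ψ : Bin Γ) : Bin ((Γ × (Fin 5 → Prop)) × Prop) := fun V G c u v =>
  ∀ z, (c z).1.2 3 → (ncF ψ V G (fun v => (c v).1) z v ↔ (c z).1.2 4) →
    (ncF ψ V G (fun v => (c v).1) z u ↔ (c z).1.2 4)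

lemma ψO_def {Γ : Type} [Finite Γ] {ψ : Bin Γ} (h : IsDef2 ψ) : IsDef2 (ψO ψ) := by
  unfold IsDef2 ψO
  exact .all (.imp (.colp 0 fun (g : (Γ × (Fin 5 → Prop)) × Prop) => g.1.2 3)
    (.imp (.iff ((ncF_def h).lapp _ 0 2) (.colp 0 fun (g : (Γ × (Fin 5 → Prop)) × Prop) => g.1.2 4))
      (.iff ((ncF_def h).lapp _ 0 1) (.colp 0 fun (g : (Γ × (Fin 5 → Prop)) × Prop) => g.1.2 4))))

lemma OrlSys.reg_dropped {V Γ : Type} {r n : ℕ} {ψ : Bin Γ} {G : SimpleGraph V} {W : V → Prop}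
    {c : V → Γ} {lev p : V → ℕ} (hS : OrlSys r n ψ G W c lev p) {h : ℕ → ℕ} {m : ℕ}
    {u u' v v' : V} (hu : lev u < r) (hcu : c u = c u') (hcv : c v = c v')
    (ku : Kp lev p r h m u) (ku' : Kp lev p r h m u')
    (kv : ¬ Kp lev p r h m v) (kv' : ¬ Kp lev p r h m v') : G.Adj u v ↔ G.Adj u' v' := by
  apply hS.reg u u' v v' hu hcu hcv
  by_cases hl : lev v ≤ r
  · right
    have hl' := hS.clev v v' hcv
    constructor
    · intro he
      exact kv ⟨hl, by rw [← he]; exact ku.2⟩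
    · intro he
      exact kv' ⟨by omega, by rw [← he]; exact ku'.2⟩
  · left; omega

lemma stepA_ord {V Γ : Type} {r n m : ℕ} {ψ : Bin Γ} {G : SimpleGraph V} {W : V → Prop}
    {c : V → Γ} {lev p : V → ℕ} (hS : OrlSys r n ψ G W c lev p) {x : V} {h : ℕ → ℕ}
    (hh : StrictMono h) (hb : ∀ i < 2 * m + 1, h i < n)
    (hB : OutB (fun v i => NCP G (fun v => lev v ≤ r) (fun v => lev v = r) (fun y => y = x) p v (h i))
      (2 * m + 1)) :
    ∃ (c' : V → (Γ × (Fin 5 → Prop)) × Prop) (lev' p' : V → ℕ), OrdSys r m (ψO ψ) G W c' lev' p' := by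
  classical
  obtain ⟨e, o, ho⟩ := hB
  set h2 : ℕ → ℕ := fun i => h (2 * i) with hh2
  have hm2 : StrictMono h2 := fun i j hij => hh (by omega)
  refine ⟨fun v => ((c v, ![lev v ≤ r, lev v = r, v = x, ∃ j < m, v = o (2 * j + 1), e]),
    Kp lev p r h2 m v), fun v => if Kp lev p r h2 m v then lev v else r + 1,
    fun v => idx h2 (p v), ?_, ?_, ?_, ?_, ?_⟩
  · intro u v huv
    simp only [Prod.mk.injEq] at huv
    have h1 := hS.clev u v huv.1.1
    simp only [huv.2, h1]
  · intro i hi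
    obtain ⟨a, ha, ha0, hap⟩ := hS.base (h2 i) (hb _ (by omega))
    refine ⟨a, ha, ?_, ?_⟩
    · rw [if_pos ⟨by omega, i, hi, hap⟩, ha0]
    · simp only [hap]; exact idx_eq hm2 i
  · intro v hv
    by_cases hk : Kp lev p r h2 m v
    · obtain ⟨_, i, hi, hp⟩ := hk
      simp only [hp]; rw [idx_eq hm2]; exact hi
    · rw [if_neg hk] at hv; omega
  · intro u v hu hv
    by_cases hku : Kp lev p r h2 m u
    swap
    · rw [if_neg hku] at hu; omega
    by_cases hkv : Kp lev p r h2 m v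
    swap
    · rw [if_neg hkv] at hv; omega
    obtain ⟨lu, i, hi, hpu⟩ := hku
    obtain ⟨lv, j, hj, hpv⟩ := hkv
    simp only [hpu, hpv]
    rw [idx_eq hm2, idx_eq hm2]
    unfold ψO
    have nc : ∀ z a, lev a ≤ r → (ncF ψ V G (fun v => (c v, ![lev v ≤ r, lev v = r, v = x,
        ∃ j < m, v = o (2 * j + 1), e])) z a ↔
        NCP G (fun v => lev v ≤ r) (fun v => lev v = r) (fun y => y = x) p z (p a)) := by
      intro z a ha
      apply ncF_iff (U := fun v => lev v ≤ r)
      · intro u u' hu hu'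
        exact hS.same u u' hu hu'
      · intro u hu; exact hu.le
      · intro v; exact Iff.rfl
      · intro v; exact Iff.rfl
      · intro v; exact Iff.rfl
      · exact ha
    have key : ∀ j < m, ∀ i < m, (NCP G (fun v => lev v ≤ r) (fun v => lev v = r) (fun y => y = x) p
        (o (2 * j + 1)) (h2 i) ↔ e) ↔ i ≤ j := by
      intro j hj i hi
      have := ho (2 * j + 1) (by omega) (2 * i) (by omega)
      constructor
      · intro h3
        by_contra hij
        have := this.2 (by omega)
        simp only [hh2] at h3
        exact iff_not_self (h3.symm.trans this)
      · intro h3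
        exact this.1 (by omega)
    simp only [nc _ u lu, nc _ v lv, hpu, hpv]
    constructor
    · intro H
      have := H (o (2 * j + 1)) ⟨j, hj, rfl⟩ ((key j hj j hj).mpr le_rfl)
      exact (key j hj i hi).mp this
    · rintro hij z ⟨k, hk, rfl⟩ h3
      exact (key k hk i hi).mpr (hij.trans ((key k hk j hj).mp h3))
  · intro u u' v v' hu hcu hcv _ _ _ _ hd
    simp only [Prod.mk.injEq] at hcu hcv
    by_cases hku : Kp lev p r h2 m u
    swap
    · rw [if_neg hku] at hu; omega
    have hku' : Kp lev p r h2 m u' := hcu.2 ▸ hku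
    rw [if_pos hku] at hu
    by_cases hkv : Kp lev p r h2 m v
    · have hkv' : Kp lev p r h2 m v' := hcv.2 ▸ hkv
      rw [if_pos hku, if_pos hkv] at hd
      apply hS.reg u u' v v' hu hcu.1.1 hcv.1.1
      rcases hd with hd | hd | hd
      · exact Or.inl hd
      · right
        exact ⟨fun he => by rw [he] at hd; omega, fun he => by rw [he] at hd; omega⟩
      · right
        exact ⟨fun he => by rw [he] at hd; omega, fun he => by rw [he] at hd; omega⟩
    · exact hS.reg_dropped hu hcu.1.1 hcv.1.1 hku hku' hkv (by rw [← hcv.2]; exact hkv)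

/-- Colors of the extended orderless system. -/
abbrev ΓA (Γ : Type) (k : ℕ) : Type := Γ × (Fin 3 → Prop) × (Fin k → Prop) × Fin k

/-- Link of a new vertex to a kept vertex. -/
def linkA {Γ : Type} {k : ℕ} (ψ : Bin Γ) : Bin (ΓA Γ k) := fun V G c v u =>
  ∃ u', (c u').2.1 2 ∧ ψ V G (fun v => (c v).1) u' u ∧ ¬ (G.Adj v u' ↔ (c u').2.2.1 (c v).2.2.2)

lemma linkA_def {Γ : Type} [Finite Γ] {k : ℕ} {ψ : Bin Γ} (h : IsDef2 ψ) :
    IsDef2 (linkA (k := k) ψ) := by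
  unfold IsDef2 linkA
  exact .ex (.and (.colp 0 fun (g : ΓA Γ k) => g.2.1 2) (.and (h.lapp _ 0 2) (.not (.iff (.adj _ _)
    (.colp2 0 1 fun (g g' : ΓA Γ k) => g.2.2.1 g'.2.2.2)))))

/-- Same-column formula in the extended orderless system. -/
def ψA {Γ : Type} {k : ℕ} (ψ : Bin Γ) : Bin (ΓA Γ k) := fun V G c a b =>
  ((c a).2.1 0 ∧ (c b).2.1 0 ∧ ψ V G (fun v => (c v).1) a b) ∨
  (¬ (c a).2.1 0 ∧ (c b).2.1 0 ∧ linkA ψ V G c a b) ∨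
  ((c a).2.1 0 ∧ ¬ (c b).2.1 0 ∧ linkA ψ V G c b a) ∨
  (¬ (c a).2.1 0 ∧ ¬ (c b).2.1 0 ∧ ∃ w, (c w).2.1 0 ∧ linkA ψ V G c a w ∧ linkA ψ V G c b w)

lemma ψA_def {Γ : Type} [Finite Γ] {k : ℕ} {ψ : Bin Γ} (h : IsDef2 ψ) :
    IsDef2 (ψA (k := k) ψ) := by
  have k0 : ∀ i, IsDef (ΓA Γ k) (fun V G c e => (c (e i)).2.1 0) := fun i =>
    .colp i fun (g : ΓA Γ k) => g.2.1 0
  have l := linkA_def (k := k) h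
  unfold IsDef2 ψA
  exact .or (.and (k0 _) (.and (k0 _) (h.lapp _ 0 1))) (.or (.and (.not (k0 _)) (.and (k0 _) (l.app 0 1)))
    (.or (.and (k0 _) (.and (.not (k0 _)) (l.app 1 0)))
    (.and (.not (k0 _)) (.and (.not (k0 _)) (.ex (.and (k0 0) (.and (l.app 1 0) (l.app 2 0))))))))

lemma stepA_orl {V Γ : Type} {r n m k : ℕ} {ψ : Bin Γ} {G : SimpleGraph V} {W : V → Prop}
    {c : V → Γ} {lev p : V → ℕ} (hS : OrlSys r n ψ G W c lev p) {s : ℕ → V} {h : ℕ → ℕ}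
    (hh : StrictMono h) (hb : ∀ i < m, h i < n)
    (hA : ∀ v, ∃ t < k, ∃ q0, ∀ i < m, i ≠ q0 →
      ¬ NCP G (fun v => lev v ≤ r) (fun v => lev v = r) (fun y => y = s t) p v (h i)) :
    ∃ (c' : V → ΓA Γ k) (lev' p' : V → ℕ), OrlSys (r + 1) m (ψA ψ) G W c' lev' p' := by
  classical
  have hA' : ∀ v, ∃ t : Fin k, ∃ q0, ∀ i < m, i ≠ q0 →
      ¬ NCP G (fun v => lev v ≤ r) (fun v => lev v = r) (fun y => y = s t) p v (h i) := by
    intro v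
    obtain ⟨t, ht, h⟩ := hA v
    exact ⟨⟨t, ht⟩, h⟩
  choose x q0 hx using hA'
  set irr : V → ℕ → Prop := fun v i => ∃ u, lev u = r ∧ p u = h i ∧ ¬ (G.Adj v u ↔ G.Adj (s (x v)) u)
    with hirr
  have irr_q0 : ∀ v i, i < m → irr v i → i = q0 v := by
    rintro v i hi ⟨u, h1, h2, h3⟩
    by_contra hne
    exact hx v i hi hne (Or.inr fun y hy => ⟨u, h1, h2, by rw [hy]; exact h3⟩)
  have kp_q0 : ∀ v i, i < m → lev v ≤ r → p v = h i → i = q0 v := by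
    intro v i hi h1 h2
    by_contra hne
    exact hx v i hi hne (Or.inl ⟨h1, h2⟩)
  set K : V → Prop := Kp lev p r h m with hK
  set I : V → Prop := fun v => ∃ i < m, irr v i with hI
  set c' : V → ΓA Γ k := fun v => (c v, ![K v, I v, K v ∧ lev v = r], fun t => G.Adj (s t) v, x v) with hc'
  set lev' : V → ℕ := fun v => if K v then lev v else if I v then r + 1 else r + 2 with hlev'
  have levK : ∀ v, K v → lev' v = lev v := fun v hv => by simp [hlev', hv]
  have levI : ∀ v, ¬ K v → I v → lev' v = r + 1 := fun v hv hi => by simp [hlev', hv, hi]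
  have levN : ∀ v, ¬ K v → ¬ I v → lev' v = r + 2 := fun v hv hi => by simp [hlev', hv, hi]
  -- p' v = q0 v
  have pK : ∀ v, K v → q0 v < m ∧ p v = h (q0 v) := by
    rintro v ⟨h1, i, hi, h2⟩
    rw [← kp_q0 v i hi h1 h2]; exact ⟨hi, h2⟩
  have pI : ∀ v, I v → q0 v < m ∧ irr v (q0 v) := by
    rintro v ⟨i, hi, h1⟩
    rw [← irr_q0 v i hi h1]; exact ⟨hi, h1⟩
  have agree : ∀ v u, K u → lev u = r → q0 u ≠ q0 v → (G.Adj v u ↔ G.Adj (s (x v)) u) := by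
    intro v u hu hl hne
    by_contra hno
    obtain ⟨h1, h2⟩ := pK u hu
    exact hne (irr_q0 v _ h1 ⟨u, hl, h2, hno⟩)
  have agreeN : ∀ v u, K u → lev u = r → ¬ I v → (G.Adj v u ↔ G.Adj (s (x v)) u) := by
    intro v u hu hl hne
    by_contra hno
    obtain ⟨h1, h2⟩ := pK u hu
    exact hne ⟨_, h1, ⟨u, hl, h2, hno⟩⟩
  have link : ∀ v u, I v → K u → (linkA ψ V G c' v u ↔ q0 v = q0 u) := by
    intro v u hv hu
    constructor
    · rintro ⟨u', ⟨hu'K, hu'l⟩, h2, h3⟩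
      have e1 : p u' = p u := (hS.same u' u hu'l.le hu.1).mp h2
      rw [(pK u' hu'K).2, (pK u hu).2] at e1
      have e2 := hh.injective e1
      by_contra hne
      exact h3 (agree v u' hu'K hu'l (by rw [e2]; exact fun h => hne h.symm))
    · intro he
      obtain ⟨h1, u', h2, h3, h4⟩ := pI v hv
      have hu'K : K u' := ⟨h2.le, q0 v, h1, h3⟩
      refine ⟨u', ⟨hu'K, h2⟩, (hS.same u' u h2.le hu.1).mpr ?_, h4⟩
      rw [h3, he, (pK u hu).2]
  have lev_cases : ∀ v, lev' v ≤ r + 1 → K v ∨ (¬ K v ∧ I v) := by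
    intro v hv
    by_cases h1 : K v
    · exact Or.inl h1
    · by_cases h2 : I v
      · exact Or.inr ⟨h1, h2⟩
      · rw [levN v h1 h2] at hv; omega
  have baseK : ∀ i < m, ∃ a, W a ∧ K a ∧ lev a = 0 ∧ q0 a = i := by
    intro i hi
    obtain ⟨a, ha, h1, h2⟩ := hS.base (h i) (hb i hi)
    exact ⟨a, ha, ⟨by omega, i, hi, h2⟩, h1, (kp_q0 a i hi (by omega) h2).symm⟩
  refine ⟨c', lev', q0, ?_, ?_, ?_, ?_, ?_⟩
  · intro u v huv
    have e1 : c u = c v := congrArg Prod.fst huv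
    have e2 : K u = K v := congrFun (congrArg (fun z => z.2.1) huv) 0
    have e3 : I u = I v := congrFun (congrArg (fun z => z.2.1) huv) 1
    simp only [hlev', e2, e3, hS.clev u v e1]
  · intro i hi
    obtain ⟨a, ha, h1, h2, h3⟩ := baseK i hi
    exact ⟨a, ha, by rw [levK a h1, h2], h3⟩
  · intro v hv
    rcases lev_cases v hv with h1 | ⟨h1, h2⟩
    · exact (pK v h1).1
    · exact (pI v h2).1
  · intro u v hu hv
    change ((K u ∧ K v ∧ ψ V G c u v) ∨ (¬ K u ∧ K v ∧ linkA ψ V G c' u v) ∨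
      (K u ∧ ¬ K v ∧ linkA ψ V G c' v u) ∨
      (¬ K u ∧ ¬ K v ∧ ∃ w, K w ∧ linkA ψ V G c' u w ∧ linkA ψ V G c' v w)) ↔ _
    rcases lev_cases u hu with h1 | ⟨h1, h2⟩ <;> rcases lev_cases v hv with h3 | ⟨h3, h4⟩
    · simp only [h1, h3, not_true, false_and, and_false, or_false, true_and]
      rw [hS.same u v h1.1 h3.1, (pK u h1).2, (pK v h3).2]
      exact hh.injective.eq_iff
    · simp only [h1, h3, not_true, not_false_eq_true, false_and, false_or, or_false, true_and]
      rw [link v u h4 h1]; exact eq_comm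
    · simp only [h1, h3, not_true, not_false_eq_true, false_and, false_or, or_false, true_and]
      rw [link u v h2 h3]
    · simp only [h1, h3, not_false_eq_true, false_and, false_or, true_and]
      constructor
      · rintro ⟨w, hw, l1, l2⟩
        rw [(link u w h2 hw).mp l1, (link v w h4 hw).mp l2]
      · intro he
        obtain ⟨a, ha, k1, k2, k3⟩ := baseK _ (pI u h2).1
        exact ⟨a, k1, (link u a h2 k1).mpr k3.symm, (link v a h4 k1).mpr (by rw [k3, he])⟩
  · intro u u' v v' hu hcu hcv hd
    have cu : c u = c u' := congrArg Prod.fst hcu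
    have Ku : K u = K u' := congrFun (congrArg (fun z => z.2.1) hcu) 0
    have tu : ∀ t : Fin k, G.Adj (s t) u = G.Adj (s t) u' := fun t =>
      congrFun (congrArg (fun z => z.2.2.1) hcu) t
    have cv : c v = c v' := congrArg Prod.fst hcv
    have Kv : K v = K v' := congrFun (congrArg (fun z => z.2.1) hcv) 0
    have Iv : I v = I v' := congrFun (congrArg (fun z => z.2.1) hcv) 1
    have xv : x v = x v' := congrArg (fun z => z.2.2.2) hcv
    have hKu : K u := by
      by_contra hno
      by_cases hi : I u
      · rw [levI u hno hi] at hu; omega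
      · rw [levN u hno hi] at hu; omega
    have hKu' : K u' := Ku ▸ hKu
    have lu := hS.clev u u' cu
    have lv := hS.clev v v' cv
    rw [levK u hKu] at hu hd
    by_cases hr : lev u < r
    · by_cases hKv : K v
      · have hKv' : K v' := Kv ▸ hKv
        apply hS.reg u u' v v' hr cu cv
        rw [levK v hKv] at hd
        refine hd.imp_right fun hd => ⟨fun he => hd.1 ?_, fun he => hd.2 ?_⟩
        · rw [(pK u hKu).2, (pK v hKv).2] at he
          exact hh.injective he
        · rw [(pK u' hKu').2, (pK v' hKv').2] at he
          exact hh.injective he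
      · exact hS.reg_dropped hr cu cv hKu hKu' hKv (by have hz : ¬ K v' := Kv ▸ hKv; exact hz)
    · have hur : lev u = r := by omega
      have hu'r : lev u' = r := by omega
      have fin : (G.Adj v u ↔ G.Adj (s (x v)) u) → (G.Adj v' u' ↔ G.Adj (s (x v')) u') →
          (G.Adj u v ↔ G.Adj u' v') := by
        intro a b
        rw [G.adj_comm u v, G.adj_comm u' v', a, b, tu, xv]
      by_cases hKv : K v
      · have hKv' : K v' := Kv ▸ hKv
        rw [levK v hKv] at hd
        have hvr : lev v ≤ r := hKv.1
        rcases hd with hd | ⟨hd1, hd2⟩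
        · omega
        · exact fin (agree v u hKu hur hd1) (agree v' u' hKu' hu'r hd2)
      · by_cases hIv : I v
        · rw [levI v hKv hIv] at hd
          rcases hd with hd | ⟨hd1, hd2⟩
          · omega
          · exact fin (agree v u hKu hur hd1) (agree v' u' hKu' hu'r hd2)
        · exact fin (agreeN v u hKu hur hIv) (agreeN v' u' hKu' hu'r (Iv ▸ hIv))

lemma stepA {C : GraphClass} (hC : ¬ TransducesAllGraphs C) (r : ℕ) {Γ : Type} [Finite Γ] {ψ : Bin Γ}
    (hψ : IsDef2 ψ) : ∃ k, ∀ m, ∃ M, ∀ N (G : SimpleGraph (Fin N)), C N G → ∀ W c lev p n, M ≤ n →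
      OrlSys r n ψ G W c lev p →
      (∃ (c' : Fin N → (Γ × (Fin 5 → Prop)) × Prop) (lev' p' : Fin N → ℕ),
        OrdSys r m (ψO ψ) G W c' lev' p') ∨
      (∃ (c' : Fin N → ΓA Γ k) (lev' p' : Fin N → ℕ), OrlSys (r + 1) m (ψA ψ) G W c' lev' p') := by
  obtain ⟨k, hk⟩ := claimA hC hψ
  refine ⟨k, fun m => ?_⟩
  obtain ⟨M, hM⟩ := hk (2 * m + 1)
  refine ⟨M, fun N G hG W c lev p n hn hS => ?_⟩
  have hD : Dat C ψ N G (fun v => lev v ≤ r) (fun v => lev v = r) p n := by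
    refine ⟨hG, ⟨c, hS.same⟩, fun u hu => hu.le, ?_⟩
    intro q hq
    obtain ⟨a, -, h1, h2⟩ := hS.base q hq
    exact ⟨a, by dsimp only; omega, h2⟩
  rcases hM N G (fun v => lev v ≤ r) (fun v => lev v = r) p n hD hn
    with ⟨x, h, h1, h2, h3⟩ | ⟨s, h, h1, h2, h3⟩
  · exact Or.inl (stepA_ord hS h1 h2 h3)
  · refine Or.inr (stepA_orl hS h1 (fun i hi => h2 i (by omega)) (s := s) fun v => ?_)
    obtain ⟨t, ht, q0, h⟩ := h3 v
    exact ⟨t, ht, q0, fun i hi => h i (by omega)⟩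

set_option autoImplicit false

/-! ### Extending an ordered system by one level -/

/-- Colors of the extended ordered system. -/
abbrev ΓE (Γ : Type) (k : ℕ) : Type := Γ × (Fin 3 → Prop) × (Fin k → Prop) × Fin k × Fin k

/-- new below kept -/
def leNK {Γ : Type} {k : ℕ} (ψ : Bin Γ) : Bin (ΓE Γ k) := fun V G c v u =>
  ∃ u', (c u').2.1 1 ∧ ψ V G (fun v => (c v).1) u' u ∧ ¬ (G.Adj v u' ↔ (c u').2.2.1 (c v).2.2.2.1)

/-- kept below new -/
def leKN {Γ : Type} {k : ℕ} (ψ : Bin Γ) : Bin (ΓE Γ k) := fun V G c u v =>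
  ¬ ∃ u', (c u').2.1 1 ∧ ψ V G (fun v => (c v).1) u' u ∧ ¬ ψ V G (fun v => (c v).1) u u' ∧
    ¬ (G.Adj v u' ↔ (c u').2.2.1 (c v).2.2.2.1)

lemma leNK_def {Γ : Type} [Finite Γ] {k : ℕ} {ψ : Bin Γ} (h : IsDef2 ψ) :
    IsDef2 (leNK (k := k) ψ) := by
  unfold IsDef2 leNK
  exact .ex (.and (.colp 0 fun (g : ΓE Γ k) => g.2.1 1) (.and (h.lapp _ 0 2) (.not (.iff (.adj _ _)
    (.colp2 0 1 fun (g g' : ΓE Γ k) => g.2.2.1 g'.2.2.2.1)))))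

lemma leKN_def {Γ : Type} [Finite Γ] {k : ℕ} {ψ : Bin Γ} (h : IsDef2 ψ) :
    IsDef2 (leKN (k := k) ψ) := by
  unfold IsDef2 leKN
  exact .not (.ex (.and (.colp 0 fun (g : ΓE Γ k) => g.2.1 1) (.and (h.lapp _ 0 1)
    (.and (.not (h.lapp _ 1 0)) (.not (.iff (.adj _ _)
    (.colp2 0 2 fun (g g' : ΓE Γ k) => g.2.2.1 g'.2.2.2.1)))))))

/-- Order formula in the extended ordered system. -/
def ψE {Γ : Type} {k : ℕ} (ψ : Bin Γ) : Bin (ΓE Γ k) := fun V G c a b =>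
  ((c a).2.1 0 ∧ (c b).2.1 0 ∧ ψ V G (fun v => (c v).1) a b) ∨
  (¬ (c a).2.1 0 ∧ (c b).2.1 0 ∧ leNK ψ V G c a b) ∨
  ((c a).2.1 0 ∧ ¬ (c b).2.1 0 ∧ leKN ψ V G c a b) ∨
  (¬ (c a).2.1 0 ∧ ¬ (c b).2.1 0 ∧ ∃ w, (c w).2.1 0 ∧ leNK ψ V G c a w ∧ leKN ψ V G c w b)

lemma ψE_def {Γ : Type} [Finite Γ] {k : ℕ} {ψ : Bin Γ} (h : IsDef2 ψ) :
    IsDef2 (ψE (k := k) ψ) := by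
  have k0 : ∀ i, IsDef (ΓE Γ k) (fun V G c e => (c (e i)).2.1 0) := fun i =>
    .colp i fun (g : ΓE Γ k) => g.2.1 0
  have l := leNK_def (k := k) h
  have l' := leKN_def (k := k) h
  unfold IsDef2 ψE
  exact .or (.and (k0 _) (.and (k0 _) (h.lapp _ 0 1))) (.or (.and (.not (k0 _)) (.and (k0 _) (l.app 0 1)))
    (.or (.and (k0 _) (.and (.not (k0 _)) (l'.app 0 1)))
    (.and (.not (k0 _)) (.and (.not (k0 _)) (.ex (.and (k0 0) (.and (l.app 1 0) (l'.app 0 2))))))))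

lemma extendO {V Γ : Type} {r n k : ℕ} {ψ : Bin Γ} {G : SimpleGraph V} {W : V → Prop}
    {c : V → Γ} {lev p : V → ℕ} (hS : OrdSys r n ψ G W c lev p) {s : Fin k → V}
    (H1 : ∀ v, lev v ≤ r → ∃ x y, ∀ u, lev u = r →
      (p u + 1 < p v → (G.Adj v u ↔ G.Adj (s x) u)) ∧ (p v + 1 < p u → (G.Adj v u ↔ G.Adj (s y) u)))
    (H2 : ∀ v, r < lev v → ∃ i x y, ∀ u, lev u = r →
      (p u < i → (G.Adj v u ↔ G.Adj (s x) u)) ∧ (i + 1 < p u → (G.Adj v u ↔ G.Adj (s y) u))) :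
    ∃ (c' : V → ΓE Γ k) (lev' p' : V → ℕ), OrdSys (r + 1) n (ψE ψ) G W c' lev' p' := by
  classical
  have H : ∀ v, ∃ x y i, (lev v ≤ r → ∀ u, lev u = r →
      (p u + 1 < p v → (G.Adj v u ↔ G.Adj (s x) u)) ∧ (p v + 1 < p u → (G.Adj v u ↔ G.Adj (s y) u))) ∧
      (r < lev v → ∀ u, lev u = r →
      (p u < i → (G.Adj v u ↔ G.Adj (s x) u)) ∧ (i + 1 < p u → (G.Adj v u ↔ G.Adj (s y) u))) := by
    intro v
    by_cases hv : lev v ≤ r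
    · obtain ⟨x, y, h⟩ := H1 v hv
      exact ⟨x, y, 0, fun _ => h, fun h => by omega⟩
    · obtain ⟨i, x, y, h⟩ := H2 v (by omega)
      exact ⟨x, y, i, fun h => by omega, fun _ => h⟩
  choose x y i HK HN using H
  set D : V → ℕ → Prop := fun v q => ∃ u, lev u = r ∧ p u = q ∧ ¬ (G.Adj v u ↔ G.Adj (s (x v)) u) with hD
  set I : V → Prop := fun v => ∃ q, D v q with hI
  set p' : V → ℕ := fun v => if lev v ≤ r then p v else if h : I v then Nat.find h else 0 with hp'
  set lev' : V → ℕ := fun v => if lev v ≤ r then lev v else if I v then r + 1 else r + 2 with hlev'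
  set c' : V → ΓE Γ k := fun v => (c v, ![lev v ≤ r, lev v = r, I v], fun t => G.Adj (s t) v, x v, y v) with hc'
  have levK : ∀ v, lev v ≤ r → lev' v = lev v := fun v hv => by simp [hlev', hv]
  have levI : ∀ v, ¬ lev v ≤ r → I v → lev' v = r + 1 := fun v hv hi => by simp only [hlev', hv, hi]; simp
  have levN : ∀ v, ¬ lev v ≤ r → ¬ I v → lev' v = r + 2 := fun v hv hi => by simp only [hlev', hv, hi]; simp
  have pK : ∀ v, lev v ≤ r → p' v = p v := fun v hv => by simp [hp', hv]
  have pI : ∀ v, ¬ lev v ≤ r → I v → D v (p' v) ∧ ∀ q < p' v, ¬ D v q := fun v hv hi => by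
    have : p' v = Nat.find hi := by simp only [hp', hv, hi]; simp
    rw [this]
    exact ⟨Nat.find_spec hi, fun q hq => Nat.find_min hi hq⟩
  have pIi : ∀ v, ¬ lev v ≤ r → I v → i v ≤ p' v := by
    intro v hv hi
    obtain ⟨⟨u, h1, h2, h3⟩, -⟩ := pI v hv hi
    by_contra hlt
    exact h3 ((HN v (by omega) u h1).1 (by omega))
  have nk : ∀ v u, ¬ lev v ≤ r → I v → lev u ≤ r → (leNK ψ V G c' v u ↔ p' v ≤ p u) := by
    intro v u hv hi hu
    obtain ⟨h1, h2⟩ := pI v hv hi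
    constructor
    · rintro ⟨u', a1, a2, a3⟩
      have a1 : lev u' = r := a1
      have a2 := (hS.ord u' u a1.le hu).mp a2
      by_contra hlt
      exact h2 (p u') (by omega) ⟨u', a1, rfl, a3⟩
    · intro hle
      obtain ⟨u', a1, a2, a3⟩ := h1
      exact ⟨u', a1, (hS.ord u' u a1.le hu).mpr (by omega), a3⟩
  have kn : ∀ v u, ¬ lev v ≤ r → I v → lev u ≤ r → (leKN ψ V G c' u v ↔ p u ≤ p' v) := by
    intro v u hv hi hu
    obtain ⟨h1, h2⟩ := pI v hv hi
    constructor
    · intro hno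
      by_contra hlt
      obtain ⟨u', a1, a2, a3⟩ := h1
      refine hno ⟨u', a1, (hS.ord u' u a1.le hu).mpr (by omega), ?_, a3⟩
      rintro a4
      have := (hS.ord u u' hu a1.le).mp a4
      omega
    · rintro hle ⟨u', a1, a2, a3, a4⟩
      have a1 : lev u' = r := a1
      have a2 := (hS.ord u' u a1.le hu).mp a2
      have a3 : ¬ p u ≤ p u' := fun h => a3 ((hS.ord u u' hu a1.le).mpr h)
      exact h2 (p u') (by omega) ⟨u', a1, rfl, a4⟩
  have lev_cases : ∀ v, lev' v ≤ r + 1 → lev v ≤ r ∨ (¬ lev v ≤ r ∧ I v) := by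
    intro v hv
    by_cases h1 : lev v ≤ r
    · exact Or.inl h1
    · by_cases h2 : I v
      · exact Or.inr ⟨h1, h2⟩
      · rw [levN v h1 h2] at hv; omega
  have pIn : ∀ v, ¬ lev v ≤ r → I v → p' v < n := by
    intro v hv hi
    obtain ⟨⟨u, h1, h2, h3⟩, -⟩ := pI v hv hi
    have := hS.bd u h1.le
    omega
  refine ⟨c', lev', p', ?_, ?_, ?_, ?_, ?_⟩
  · intro u v huv
    have e1 : c u = c v := congrArg Prod.fst huv
    have e3 : I u = I v := congrFun (congrArg (fun z => z.2.1) huv) 2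
    simp only [hlev', e3, hS.clev u v e1]
  · intro i hi
    obtain ⟨a, ha, h1, h2⟩ := hS.base i hi
    exact ⟨a, ha, by rw [levK a (by omega), h1], by rw [pK a (by omega), h2]⟩
  · intro v hv
    rcases lev_cases v hv with h1 | ⟨h1, h2⟩
    · rw [pK v h1]; exact hS.bd v h1
    · exact pIn v h1 h2
  · intro u v hu hv
    change ((lev u ≤ r ∧ lev v ≤ r ∧ ψ V G c u v) ∨ (¬ lev u ≤ r ∧ lev v ≤ r ∧ leNK ψ V G c' u v) ∨
      (lev u ≤ r ∧ ¬ lev v ≤ r ∧ leKN ψ V G c' u v) ∨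
      (¬ lev u ≤ r ∧ ¬ lev v ≤ r ∧ ∃ w, lev w ≤ r ∧ leNK ψ V G c' u w ∧ leKN ψ V G c' w v)) ↔ _
    rcases lev_cases u hu with h1 | ⟨h1, h2⟩ <;> rcases lev_cases v hv with h3 | ⟨h3, h4⟩
    · simp only [h1, h3, not_true, false_and, and_false, or_false, true_and]
      rw [hS.ord u v h1 h3, pK u h1, pK v h3]
    · simp only [h1, h3, not_true, not_false_eq_true, false_and, false_or, or_false, true_and]
      rw [kn v u h3 h4 h1, pK u h1]
    · simp only [h1, h3, not_true, not_false_eq_true, false_and, false_or, or_false, true_and]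
      rw [nk u v h1 h2 h3, pK v h3]
    · simp only [h1, h3, not_false_eq_true, false_and, false_or, true_and]
      constructor
      · rintro ⟨w, hw, l1, l2⟩
        have := (nk u w h1 h2 hw).mp l1
        have := (kn v w h3 h4 hw).mp l2
        omega
      · intro he
        obtain ⟨a, ha, k1, k2⟩ := hS.base _ (pIn u h1 h2)
        exact ⟨a, by omega, (nk u a h1 h2 (by omega)).mpr (by omega), (kn v a h3 h4 (by omega)).mpr (by omega)⟩
  · intro u u' v v' hu hcu hcv b1 b2 b3 b4 hd
    have cu : c u = c u' := congrArg Prod.fst hcu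
    have tu : ∀ t : Fin k, G.Adj (s t) u = G.Adj (s t) u' := fun t =>
      congrFun (congrArg (fun z => z.2.2.1) hcu) t
    have cv : c v = c v' := congrArg Prod.fst hcv
    have Iv : I v = I v' := congrFun (congrArg (fun z => z.2.1) hcv) 2
    have xv : x v = x v' := congrArg (fun z => z.2.2.2.1) hcv
    have yv : y v = y v' := congrArg (fun z => z.2.2.2.2) hcv
    have lu := hS.clev u u' cu
    have lv := hS.clev v v' cv
    have hKu : lev u ≤ r := by
      by_contra hno
      by_cases hi : I u
      · rw [levI u hno hi] at hu; omega
      · rw [levN u hno hi] at hu; omega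
    have hKu' : lev u' ≤ r := by omega
    rw [levK u hKu] at hu hd
    rw [pK u hKu] at b1 b2 hd
    rw [pK u' hKu'] at b3 b4 hd
    by_cases hr : lev u < r
    · apply hS.reg u u' v v' hr cu cv b1 b2 b3 b4
      by_cases hKv : lev v ≤ r
      · rw [levK v hKv, pK v hKv, pK v' (by omega)] at hd
        exact hd
      · left; omega
    · have hur : lev u = r := by omega
      have hu'r : lev u' = r := by omega
      have finx : (G.Adj v u ↔ G.Adj (s (x v)) u) → (G.Adj v' u' ↔ G.Adj (s (x v')) u') →
          (G.Adj u v ↔ G.Adj u' v') := by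
        intro a b
        rw [G.adj_comm u v, G.adj_comm u' v', a, b, tu, xv]
      have finy : (G.Adj v u ↔ G.Adj (s (y v)) u) → (G.Adj v' u' ↔ G.Adj (s (y v')) u') →
          (G.Adj u v ↔ G.Adj u' v') := by
        intro a b
        rw [G.adj_comm u v, G.adj_comm u' v', a, b, tu, yv]
      by_cases hKv : lev v ≤ r
      · have hKv' : lev v' ≤ r := by omega
        rw [levK v hKv, pK v hKv, pK v' hKv'] at hd
        rcases hd with hd | ⟨hd1, hd2⟩ | ⟨hd1, hd2⟩
        · omega
        · exact finx ((HK v hKv u hur).1 hd1) ((HK v' hKv' u' hu'r).1 hd2)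
        · exact finy ((HK v hKv u hur).2 hd1) ((HK v' hKv' u' hu'r).2 hd2)
      · have hKv' : ¬ lev v' ≤ r := by omega
        by_cases hIv : I v
        · have hIv' : I v' := Iv ▸ hIv
          rw [levI v hKv hIv] at hd
          have ag : ∀ v u, ¬ lev v ≤ r → I v → lev u = r → p u < p' v → (G.Adj v u ↔ G.Adj (s (x v)) u) := by
            intro v u h1 h2 h3 h4
            by_contra h5
            exact (pI v h1 h2).2 (p u) h4 ⟨u, h3, rfl, h5⟩
          have i1 := pIi v hKv hIv
          have i2 := pIi v' hKv' hIv'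
          rcases hd with hd | ⟨hd1, hd2⟩ | ⟨hd1, hd2⟩
          · omega
          · exact finx (ag v u hKv hIv hur (by omega)) (ag v' u' hKv' hIv' hu'r (by omega))
          · exact finy ((HN v (by omega) u hur).2 (by omega)) ((HN v' (by omega) u' hu'r).2 (by omega))
        · have hIv' : ¬ I v' := Iv ▸ hIv
          have ag : ∀ v u, ¬ I v → lev u = r → (G.Adj v u ↔ G.Adj (s (x v)) u) := by
            intro v u h2 h3
            by_contra h5
            exact h2 ⟨p u, u, h3, rfl, h5⟩
          exact finx (ag v u hIv hur) (ag v' u' hIv' hu'r)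

/-! ### Coarsening -/

/-- Index of the interval containing `x`. -/
def cix (g : ℕ → ℕ) (x : ℕ) : ℕ := Nat.findGreatest (fun i => g i ≤ x) x

lemma cix_spec {g : ℕ → ℕ} (hg : StrictMono g) {x : ℕ} (h0 : g 0 ≤ x) :
    g (cix g x) ≤ x ∧ x < g (cix g x + 1) := by
  constructor
  · exact Nat.findGreatest_spec (P := fun i => g i ≤ x) (Nat.zero_le x) h0
  · by_contra h
    push Not at h
    have h1 : cix g x + 1 ≤ x := (hg.id_le _).trans h
    have := Nat.le_findGreatest (P := fun i => g i ≤ x) h1 h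
    unfold cix at this
    omega

lemma cix_eq {g : ℕ → ℕ} (hg : StrictMono g) {x q : ℕ} (h0 : g 0 ≤ x) :
    cix g x = q ↔ g q ≤ x ∧ x < g (q + 1) := by
  obtain ⟨h1, h2⟩ := cix_spec hg h0
  constructor
  · rintro rfl; exact ⟨h1, h2⟩
  · rintro ⟨h3, h4⟩
    have a := hg.lt_iff_lt.mp (h1.trans_lt h4)
    have b := hg.lt_iff_lt.mp (h3.trans_lt h2)
    omega

lemma cix_ge {g : ℕ → ℕ} (hg : StrictMono g) {x q : ℕ} (h0 : g 0 ≤ x) :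
    q ≤ cix g x ↔ g q ≤ x := by
  obtain ⟨h1, h2⟩ := cix_spec hg h0
  constructor
  · intro h; exact (hg.monotone h).trans h1
  · intro h
    have b := hg.lt_iff_lt.mp (h.trans_lt h2)
    omega

/-- vertices kept in a coarsening -/
def Kc {V : Type} (lev p : V → ℕ) (r : ℕ) (g : ℕ → ℕ) (m : ℕ) (v : V) : Prop :=
  lev v ≤ r ∧ g 0 ≤ p v ∧ p v < g m

/-- coarse order -/
def ψC {Γ : Type} (ψ : Bin Γ) : Bin (Γ × (Prop × Prop) × Prop) := fun V G c u v =>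
  ¬ ∃ w, (c w).2.2 ∧ ψ V G (fun v => (c v).1) w u ∧ ¬ ψ V G (fun v => (c v).1) w v

lemma ψC_def {Γ : Type} [Finite Γ] {ψ : Bin Γ} (h : IsDef2 ψ) : IsDef2 (ψC ψ) := by
  unfold IsDef2 ψC
  exact .not (.ex (.and (.colp 0 fun (g : Γ × (Prop × Prop) × Prop) => g.2.2) (.and (h.lapp _ 0 1)
    (.not (h.lapp _ 0 2)))))

open Classical in
lemma coarsen {V Γ : Type} {r n : ℕ} {ψ : Bin Γ} {G : SimpleGraph V} {W : V → Prop}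
    {c : V → Γ} {lev p : V → ℕ} (hS : OrdSys r n ψ G W c lev p) {g : ℕ → ℕ} (hg : StrictMono g)
    {m : ℕ} (hm : g m ≤ n) :
    OrdSys r m (ψC ψ) G W (fun v => (c v, (Kc lev p r g m v, p v < g 0), lev v ≤ r ∧ ∃ i < m, p v = g i))
      (fun v => if Kc lev p r g m v then lev v else r + 1) (fun v => cix g (p v)) := by
  have bdK : ∀ v, Kc lev p r g m v → cix g (p v) < m := by
    intro v hv
    have := (cix_spec hg hv.2.1).1
    exact hg.lt_iff_lt.mp (this.trans_lt hv.2.2)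
  have isK : ∀ v, (if Kc lev p r g m v then lev v else r + 1) ≤ r → Kc lev p r g m v := by
    intro v hv
    by_contra h
    rw [if_neg h] at hv; omega
  constructor
  · intro u v huv
    simp only [Prod.mk.injEq] at huv
    have h1 := hS.clev u v huv.1
    simp only [huv.2.1.1, h1]
  · intro i hi
    have h1 := hg hi
    obtain ⟨a, ha, h2, h3⟩ := hS.base (g i) (by omega)
    have h0 : g 0 ≤ p a := by rw [h3]; exact hg.monotone (Nat.zero_le _)
    refine ⟨a, ha, ?_, (cix_eq hg h0).mpr ?_⟩
    · rw [if_pos ⟨by omega, h0, by omega⟩, h2]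
    · rw [h3]; exact ⟨le_rfl, hg (by omega)⟩
  · intro v hv
    exact bdK v (isK v hv)
  · intro u v hu hv
    have hu := isK u hu
    have hv := isK v hv
    constructor
    · intro hno
      by_contra hlt
      have h1 := (cix_spec hg hu.2.1).1
      have h2 : ¬ g (cix g (p u)) ≤ p v := fun h => hlt ((cix_ge hg hv.2.1).mpr h)
      have h3 := hu.2.2
      obtain ⟨a, -, h5, h6⟩ := hS.base (g (cix g (p u))) (by omega)
      refine hno ⟨a, ⟨by omega, _, bdK u hu, h6⟩, (hS.ord a u (by omega) hu.1).mpr (by omega), ?_⟩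
      intro h7
      have := (hS.ord a v (by omega) hv.1).mp h7
      omega
    · rintro hle ⟨w, ⟨h1, i, hi, h2⟩, h3, h4⟩
      have h3 := (hS.ord w u h1 hu.1).mp h3
      have h4 : ¬ p w ≤ p v := fun h => h4 ((hS.ord w v h1 hv.1).mpr h)
      rw [h2] at h3 h4
      exact h4 ((cix_ge hg hv.2.1).mp (((cix_ge hg hu.2.1).mpr h3).trans hle))
  · intro u u' v v' hu hcu hcv b1 b2 b3 b4 hd
    simp only [Prod.mk.injEq] at hcu hcv
    have hKu := isK u (by omega)
    have hKu' : Kc lev p r g m u' := hcu.2.1.1 ▸ hKu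
    rw [if_pos hKu] at hu hd
    have lv := hS.clev v v' hcv.1
    have g1 : g 0 < g 1 := hg (by omega)
    have gm : g (m - 1) < g m := hg (by omega)
    have aux : ∀ u, Kc lev p r g m u → 0 < cix g (p u) → cix g (p u) + 1 < m → g 1 ≤ p u ∧ p u < g (m - 1) := by
      intro u hu h1 h2
      refine ⟨(cix_ge hg hu.2.1).mp h1, ?_⟩
      by_contra h3
      have := (cix_ge hg hu.2.1).mpr (not_lt.mp h3)
      omega
    obtain ⟨i1, i2⟩ := aux u hKu b1 b2
    obtain ⟨i3, i4⟩ := aux u' hKu' b3 b4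
    refine hS.reg u u' v v' hu hcu.1 hcv.1 (by omega) (by omega) (by omega) (by omega) ?_
    by_cases hKv : Kc lev p r g m v
    · have hKv' : Kc lev p r g m v' := hcv.2.1.1 ▸ hKv
      rw [if_pos hKv] at hd
      have sep : ∀ a b, Kc lev p r g m a → Kc lev p r g m b → cix g (p a) + 1 < cix g (p b) → p a + 1 < p b := by
        intro a b ha hb h
        have h1 := (cix_spec hg ha.2.1).2
        have h2 := (cix_spec hg hb.2.1).1
        have h3 := hg h
        omega
      rcases hd with hd | ⟨h1, h2⟩ | ⟨h1, h2⟩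
      · exact Or.inl hd
      · exact Or.inr (Or.inl ⟨sep _ _ hKu hKv h1, sep _ _ hKu' hKv' h2⟩)
      · exact Or.inr (Or.inr ⟨sep _ _ hKv hKu h1, sep _ _ hKv' hKu' h2⟩)
    · have hKv' : ¬ Kc lev p r g m v' := hcv.2.1.1 ▸ hKv
      by_cases hl : lev v ≤ r
      · right
        have hs := hcv.2.1.2
        have out : ∀ z, lev z ≤ r → ¬ Kc lev p r g m z → ¬ p z < g 0 → g m ≤ p z := by
          intro z h1 h2 h3
          by_contra h4
          exact h2 ⟨h1, by omega, by omega⟩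
        by_cases hl0 : p v < g 0
        · have hl0' : p v' < g 0 := hs ▸ hl0
          right; omega
        · have hl0' : ¬ p v' < g 0 := hs ▸ hl0
          have := out v hl hKv hl0
          have := out v' (by omega) hKv' hl0'
          left; omega
      · left; omega

set_option autoImplicit false

/-! ### Step B: ordered systems -/

/-- not close to `S` on the interval `[b, b')` -/
def NCI {V : Type} (G : SimpleGraph V) (lev p : V → ℕ) (r : ℕ) (S : V → Prop) (v : V) (b b' : ℕ) : Prop :=
  (lev v ≤ r ∧ b ≤ p v ∧ p v < b') ∨
    ∀ x, S x → ∃ u, lev u = r ∧ b ≤ p u ∧ p u < b' ∧ ¬ (G.Adj v u ↔ G.Adj x u)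

/-- coarse same column -/
def σB {Γ : Type} (ψ : Bin Γ) : Bin (Γ × (Prop × Prop) × Prop) := fun V G c u v =>
  ψC ψ V G c u v ∧ ψC ψ V G c v u

lemma σB_def {Γ : Type} [Finite Γ] {ψ : Bin Γ} (h : IsDef2 ψ) : IsDef2 (σB ψ) := by
  have l := ψC_def h
  unfold IsDef2 σB
  exact .and (l.app 0 1) (l.app 1 0)

lemma coarse_dat {C : GraphClass} {N : ℕ} {Γ : Type} {r n : ℕ} {ψ : Bin Γ} {G : SimpleGraph (Fin N)}
    {W : Fin N → Prop} {c : Fin N → Γ} {lev p : Fin N → ℕ} (hG : C N G) (hS : OrdSys r n ψ G W c lev p)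
    {g : ℕ → ℕ} (hg : StrictMono g) {m : ℕ} (hm : g m ≤ n) :
    Dat C (σB ψ) N G (Kc lev p r g m) (fun v => Kc lev p r g m v ∧ lev v = r) (fun v => cix g (p v)) m := by
  classical
  have hc := coarsen hS hg hm
  refine ⟨hG, ⟨fun v => (c v, (Kc lev p r g m v, p v < g 0), lev v ≤ r ∧ ∃ i < m, p v = g i),
    fun u u' hu hu' => ?_⟩, fun u hu => hu.1, ?_⟩
  · have lu : (if Kc lev p r g m u then lev u else r + 1) ≤ r := by rw [if_pos hu]; exact hu.1
    have lu' : (if Kc lev p r g m u' then lev u' else r + 1) ≤ r := by rw [if_pos hu']; exact hu'.1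
    have h1 := hc.ord u u' lu lu'
    have h2 := hc.ord u' u lu' lu
    unfold σB
    rw [h1, h2]
    exact le_antisymm_iff.symm
  · intro q hq
    obtain ⟨a, -, h1, h2⟩ := hc.base q hq
    refine ⟨a, ?_, h2⟩
    by_contra hno
    rw [if_neg hno] at h1
    omega

lemma ncp_nci {V : Type} {G : SimpleGraph V} {lev p : V → ℕ} {r m : ℕ} {S : V → Prop} {g : ℕ → ℕ}
    (hg : StrictMono g) (v : V) {q : ℕ} (hq : q < m) :
    NCP G (Kc lev p r g m) (fun v => Kc lev p r g m v ∧ lev v = r) S (fun v => cix g (p v)) v q ↔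
      NCI G lev p r S v (g q) (g (q + 1)) := by
  have h0 : g 0 ≤ g q := hg.monotone (Nat.zero_le _)
  have hq' : g (q + 1) ≤ g m := hg.monotone hq
  have aux : ∀ u, (Kc lev p r g m u ∧ cix g (p u) = q) ↔ (lev u ≤ r ∧ g q ≤ p u ∧ p u < g (q + 1)) := by
    intro u
    constructor
    · rintro ⟨h1, h2⟩
      exact ⟨h1.1, (cix_eq hg h1.2.1).mp h2⟩
    · rintro ⟨h1, h2, h3⟩
      exact ⟨⟨h1, by omega, by omega⟩, (cix_eq hg (by omega)).mpr ⟨h2, h3⟩⟩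
  unfold NCP NCI
  apply or_congr
  · exact aux v
  · refine forall_congr' fun x => imp_congr_right fun _ => exists_congr fun u => ?_
    have := aux u
    constructor
    · rintro ⟨⟨h1, h2⟩, h3, h4⟩
      have := this.mp ⟨h1, h3⟩
      exact ⟨h2, this.2.1, this.2.2, h4⟩
    · rintro ⟨h1, h2, h3, h4⟩
      have := this.mpr ⟨h1.le, h2, h3⟩
      exact ⟨⟨this.1, h1⟩, this.2, h4⟩

/-- Outcome of claim B. -/
def OutOrd {V : Type} (G : SimpleGraph V) (lev p : V → ℕ) (r n k0 m : ℕ) : Prop :=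
  ∃ (s : ℕ → V) (g : ℕ → ℕ), StrictMono g ∧ g m ≤ n ∧ ∀ a b c d, a < b → b < c → c < d → d ≤ m → ∀ v,
    ¬ (NCI G lev p r (fun y => ∃ t < k0, y = s t) v (g a) (g b) ∧
      NCI G lev p r (fun y => ∃ t < k0, y = s t) v (g c) (g d))

/-- Members of `s` pairwise distinguished on the intervals of `g`. -/
def EDI {V : Type} (G : SimpleGraph V) (lev p : V → ℕ) (r : ℕ) (g : ℕ → ℕ) (M k : ℕ)
    (s : ℕ → V) : Prop :=
  ∀ q < M, ∀ i < k, ∀ j < k, i ≠ j → ∃ u, lev u = r ∧ g q ≤ p u ∧ p u < g (q + 1) ∧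
    ¬ (G.Adj (s i) u ↔ G.Adj (s j) u)

lemma claimB {C : GraphClass} (hC : ¬ TransducesAllGraphs C) {Γ : Type} [Finite Γ] {ψ : Bin Γ}
    (hψ : IsDef2 ψ) (r : ℕ) : ∃ k0, ∀ m, ∃ M, ∀ N G, C N G → ∀ W c lev p n, OrdSys r n ψ G W c lev p → M ≤ n →
      OutOrd (V := Fin N) G lev p r n k0 m := by
  classical
  obtain ⟨k0, n0, h1⟩ := noP1 hC (σB_def hψ)
  obtain ⟨K, h2⟩ := noP2 hC (σB_def hψ)
  refine ⟨k0, fun m => ?_⟩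
  have main : ∀ d k, k + d = k0 → ∃ M, ∀ N G, C N G → ∀ W c lev p n, OrdSys r n ψ G W c lev p →
      ∀ g, StrictMono g → g M ≤ n → ∀ s, EDI (V := Fin N) G lev p r g M k s → OutOrd G lev p r n k0 m := by
    intro d
    induction d with
    | zero =>
      intro k hk
      refine ⟨n0, fun N G hG W c lev p n hS g hg hgn s hE => ?_⟩
      have : k = k0 := by omega
      subst this
      refine absurd ?_ (h1 N G _ _ _ _ (coarse_dat hG hS hg hgn) id strictMono_id s)
      intro q hq i hi j hj hij
      obtain ⟨u, a1, a2, a3, a4⟩ := hE q hq i hi j hj hij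
      have h0 : g 0 ≤ g q := hg.monotone (Nat.zero_le _)
      have h3 : g (q + 1) ≤ g n0 := hg.monotone hq
      exact ⟨u, ⟨⟨a1.le, by omega, by omega⟩, a1⟩, (cix_eq hg (by omega)).mpr ⟨a2, a3⟩, a4⟩
    | succ d ih =>
      intro k hk
      obtain ⟨n2, hn2⟩ := ih (k + 1) (by omega)
      obtain ⟨L, hL⟩ := lemR (n2 + K + 4)
      obtain ⟨M, hM⟩ := ramseyIdx 4 Prop (m + 2 * L + 6)
      refine ⟨M, fun N G hG W c lev p n hS g hg hgn s hE => ?_⟩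
      set NC : Fin N → ℕ → ℕ → Prop := fun v a b => NCI G lev p r (fun y => ∃ t < k, y = s t) v a b with hNC
      obtain ⟨h, hh, hhb, a, ha⟩ := hM (fun l => ∃ v, NC v (g (l.getD 0 0)) (g (l.getD 1 0)) ∧
        NC v (g (l.getD 2 0)) (g (l.getD 3 0)))
      have hgh : StrictMono (fun i => g (h i)) := fun i j hij => hg (hh hij)
      have hghn : ∀ i < m + 2 * L + 6, g (h i) ≤ n := fun i hi =>
        (hg.monotone (hhb i hi).le).trans hgn
      have ha' : ∀ x y z w, x < y → y < z → z < w → w < m + 2 * L + 6 →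
          ((∃ v, NC v (g (h x)) (g (h y)) ∧ NC v (g (h z)) (g (h w))) ↔ a) := by
        intro x y z w hxy hyz hzw hw
        have := ha [x, y, z, w] rfl (by simp; omega) (by
          intro q hq
          simp only [List.mem_cons, List.not_mem_nil, or_false] at hq
          omega)
        simp only [List.map_cons, List.map_nil, List.getD_cons_zero, List.getD_cons_succ] at this
        exact Iff.of_eq this
      by_cases haa : a
      swap
      · refine ⟨s, fun i => g (h i), hgh, hghn m (by omega), fun x y z w hxy hyz hzw hw v hv => ?_⟩
        apply haa
        rw [← ha' x y z w hxy hyz hzw (by omega)]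
        have mono : ∀ b b', NCI G lev p r (fun y => ∃ t < k0, y = s t) v b b' → NC v b b' := by
          intro b b' hb
          refine hb.imp_right fun hb x ⟨t, ht, hx⟩ => hb x ⟨t, by omega, hx⟩
        exact ⟨v, mono _ _ hv.1, mono _ _ hv.2⟩
      · -- a vertex which is not close on many intervals
        suffices hmany : ∃ (v : Fin N) (Q : Finset ℕ), n2 + 2 ≤ Q.card ∧ ∀ q ∈ Q, q < L ∧
            NC v (g (h (2 * q))) (g (h (2 * q + 1))) by
          obtain ⟨v, Q, hQc, hQ⟩ := hmany
          let B := Q.filter (fun q => ¬ (g (h (2 * q)) ≤ p v ∧ p v < g (h (2 * q + 1))))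
          have hB : n2 + 1 ≤ B.card := by
            have e1 := Finset.card_filter_add_card_filter_not (s := Q)
              (fun q => (g (h (2 * q)) ≤ p v ∧ p v < g (h (2 * q + 1))))
            have e2 : (Q.filter (fun q => (g (h (2 * q)) ≤ p v ∧ p v < g (h (2 * q + 1))))).card ≤ 1 := by
              rw [Finset.card_le_one]
              intro x hx y hy
              simp only [Finset.mem_filter] at hx hy
              have e3 := hgh.lt_iff_lt.mp (hx.2.1.trans_lt hy.2.2)
              have e4 := hgh.lt_iff_lt.mp (hy.2.1.trans_lt hx.2.2)
              omega
            have e3 : B.card = (Q.filter (fun q => ¬ (g (h (2 * q)) ≤ p v ∧ p v < g (h (2 * q + 1))))).card := rfl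
            omega
          obtain ⟨f, hf, hfB⟩ := enum_finset B
          have hfB' : ∀ i < n2 + 1, f i < L ∧ ∀ t < k, ∃ u, lev u = r ∧ g (h (2 * f i)) ≤ p u ∧
              p u < g (h (2 * f i + 1)) ∧ ¬ (G.Adj v u ↔ G.Adj (s t) u) := by
            intro i hi
            have hm1 := hfB i (by omega)
            simp only [B, Finset.mem_filter] at hm1
            obtain ⟨hm1, hm2⟩ := hm1
            obtain ⟨h3, h4⟩ := hQ _ hm1
            refine ⟨h3, fun t ht => ?_⟩
            rcases h4 with h4 | h4
            · exact absurd h4.2 hm2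
            · exact h4 _ ⟨t, ht, rfl⟩
          have hmono : StrictMono (fun i => g (h (2 * f i))) := fun i j hij => hgh (by have := hf hij; omega)
          refine hn2 N G hG W c lev p n hS (fun i => g (h (2 * f i))) hmono
            (hghn _ (by have := (hfB' n2 (by omega)).1; omega)) (Function.update s k v) ?_
          have hd : ∀ q < n2, ∀ t < k, ∃ u, lev u = r ∧ g (h (2 * f q)) ≤ p u ∧
              p u < g (h (2 * f (q + 1))) ∧ ¬ (G.Adj v u ↔ G.Adj (s t) u) := by
            intro q hq t ht
            obtain ⟨u, a1, a2, a3, a4⟩ := (hfB' q (by omega)).2 t ht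
            refine ⟨u, a1, a2, a3.trans_le ?_, a4⟩
            apply hgh.monotone
            have := hf (Nat.lt_succ_self q)
            simp only [Nat.succ_eq_add_one] at this
            omega
          intro q hq i hi j hj hij
          by_cases hik : i = k
          · subst hik
            rw [Function.update_self, Function.update_of_ne hij.symm]
            exact hd q hq j (by omega)
          · by_cases hjk : j = k
            · subst hjk
              rw [Function.update_self, Function.update_of_ne hij]
              obtain ⟨u, b1, b2, b3, b4⟩ := hd q hq i (by omega)
              exact ⟨u, b1, b2, b3, fun h => b4 h.symm⟩
            · rw [Function.update_of_ne hik, Function.update_of_ne hjk]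
              have b1 : h (2 * f q) + 1 ≤ h (2 * f (q + 1)) := hh (by have := hf (Nat.lt_add_one q); omega)
              obtain ⟨u, a1, a2, a3, a4⟩ := hE (h (2 * f q)) (hhb _ (by
                have := (hfB' q (by omega)).1; omega)) i (by omega) j (by omega) hij
              exact ⟨u, a1, a2, a3.trans_le (hg.monotone b1), a4⟩
        obtain ⟨h', hh', hhb', hout⟩ := hL (Fin N) (fun v q => NC v (g (h (2 * q))) (g (h (2 * q + 1))))
        have fromP : ∀ (v : Fin N) (P : Finset ℕ), n2 + 2 ≤ P.card → (∀ i ∈ P, i < n2 + K + 4 ∧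
            NC v (g (h (2 * h' i))) (g (h (2 * h' i + 1)))) → ∃ (v : Fin N) (Q : Finset ℕ), n2 + 2 ≤ Q.card ∧
            ∀ q ∈ Q, q < L ∧ NC v (g (h (2 * q))) (g (h (2 * q + 1))) := by
          intro v P hP hv
          refine ⟨v, P.image h', by rw [Finset.card_image_of_injective _ hh'.injective]; exact hP, ?_⟩
          intro q hq
          obtain ⟨i, hi, rfl⟩ := Finset.mem_image.mp hq
          exact ⟨hhb' i (hv i hi).1, (hv i hi).2⟩
        rcases hout with hA | hB | hCC
        · have l01 : h' 0 < h' 1 := hh' (by omega)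
          have l1 : h' 1 < L := hhb' 1 (by omega)
          obtain ⟨v, hv1, hv2⟩ := (ha' (2 * h' 0) (2 * h' 0 + 1) (2 * h' 1) (2 * h' 1 + 1) (by omega) (by omega)
            (by omega) (by omega)).mpr haa
          obtain ⟨e, q0, he⟩ := hA v
          have hee : e := by
            by_cases h0 : q0 = 0
            · exact (he 1 (by omega) (by omega)).mp hv2
            · exact (he 0 (by omega) (by omega)).mp hv1
          refine fromP v ((Finset.range (n2 + K + 4)).erase q0) ?_ ?_
          · have := Finset.pred_card_le_card_erase (s := Finset.range (n2 + K + 4)) (a := q0)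
            simp only [Finset.card_range] at this
            omega
          · intro i hi
            simp only [Finset.mem_erase, Finset.mem_range] at hi
            exact ⟨hi.2, (he i hi.2 hi.1).mpr hee⟩
        · obtain ⟨e, o, ho⟩ := hB
          by_cases hee : e
          · refine fromP (o (n2 + K + 3)) (Finset.range (n2 + K + 3)) (by simp; omega) ?_
            intro i hi
            rw [Finset.mem_range] at hi
            exact ⟨by omega, ((ho (n2 + K + 3) (by omega) i (by omega)).1 hi).mpr hee⟩
          · refine fromP (o 0) ((Finset.range (n2 + K + 4)).erase 0) ?_ ?_
            · have := Finset.pred_card_le_card_erase (s := Finset.range (n2 + K + 4)) (a := 0)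
              simp only [Finset.card_range] at this
              omega
            · intro i hi
              simp only [Finset.mem_erase, Finset.mem_range] at hi
              exact ⟨by omega, ((ho 0 (by omega) i (by omega)).2 (by omega)).mpr hee⟩
        · exfalso
          obtain ⟨e, o, ho⟩ := hCC
          have hm2 : StrictMono (fun i => 2 * h' i) := fun i j hij => by
            have := hh' hij
            dsimp only
            omega
          refine h2 N G _ _ _ _ (coarse_dat hG hS hgh (m := 2 * L) (hghn _ (by omega))) (fun i => 2 * h' i)
            hm2 (fun i hi => by have := hhb' i (by omega); omega) (fun y => ∃ t < k, y = s t) ⟨e, o, ?_⟩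
          intro x y hxy hy q hq
          dsimp only
          rw [ncp_nci hgh _ (by have := hhb' q (by omega); omega)]
          exact ho x y hxy (by omega) q (by omega)
  obtain ⟨M, hM⟩ := main k0 0 (by omega)
  refine ⟨M + 1, fun N G hG W c lev p n hS hn => ?_⟩
  obtain ⟨u, -⟩ := hS.base 0 (by omega)
  exact hM N G hG W c lev p n hS id strictMono_id (by simp; omega) (fun _ => u)
    (by intro q hq i hi; omega)

/-- Color type after step B. -/
abbrev ΓB (Γ : Type) (k : ℕ) : Type := ΓE (Γ × (Prop × Prop) × Prop) k

lemma stepB {C : GraphClass} (hC : ¬ TransducesAllGraphs C) (r : ℕ) {Γ : Type} [Finite Γ] {ψ : Bin Γ}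
    (hψ : IsDef2 ψ) : ∃ k, ∀ m, ∃ M, ∀ N (G : SimpleGraph (Fin N)), C N G → ∀ W c lev p n, M ≤ n →
      OrdSys r n ψ G W c lev p →
      ∃ (c' : Fin N → ΓB Γ k) (lev' p' : Fin N → ℕ), OrdSys (r + 1) m (ψE (ψC ψ)) G W c' lev' p' := by
  classical
  obtain ⟨k, hk⟩ := claimB hC hψ r
  refine ⟨k + 1, fun m => ?_⟩
  obtain ⟨M, hM⟩ := hk m
  refine ⟨M, fun N G hG W c lev p n hn hS => ?_⟩
  obtain ⟨s, g, hg, hgn, H⟩ := hM N G hG W c lev p n hS hn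
  have hc := coarsen hS hg hgn
  -- closeness from failure of NCI
  have close : ∀ v a b, ¬ NCI G lev p r (fun y => ∃ t < k, y = s t) v (g a) (g b) →
      ∃ x : Fin (k + 1), ∀ u, Kc lev p r g m u → lev u = r → a ≤ cix g (p u) → cix g (p u) < b →
        (G.Adj v u ↔ G.Adj (s x) u) := by
    intro v a b hno
    unfold NCI at hno
    push Not at hno
    obtain ⟨x, ⟨t, ht, rfl⟩, h1⟩ := hno.2
    refine ⟨⟨t, by omega⟩, fun u hu hl ha hb => ?_⟩
    have := h1 u hl ((cix_ge hg hu.2.1).mp ha) (by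
      by_contra hcon
      have := (cix_ge hg hu.2.1).mpr (not_lt.mp hcon)
      omega)
    tauto
  have isK : ∀ v, (if Kc lev p r g m v then lev v else r + 1) ≤ r → Kc lev p r g m v := by
    intro v hv
    by_contra h
    rw [if_neg h] at hv; omega
  have isT : ∀ v, (if Kc lev p r g m v then lev v else r + 1) = r → Kc lev p r g m v ∧ lev v = r := by
    intro v hv
    have h := isK v hv.le
    rw [if_pos h] at hv
    exact ⟨h, hv⟩
  refine extendO hc (s := fun t : Fin (k + 1) => s t) ?_ ?_
  · intro v hv
    have hv := isK v hv
    have hq : cix g (p v) < m := by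
      have := (cix_spec hg hv.2.1).1
      exact hg.lt_iff_lt.mp (this.trans_lt hv.2.2)
    have self : ∀ _ : ℕ, NCI G lev p r (fun y => ∃ t < k, y = s t) v (g (cix g (p v))) (g (cix g (p v) + 1)) :=
      fun _ => Or.inl ⟨hv.1, cix_spec hg hv.2.1⟩
    have hx : ∃ x : Fin (k + 1), ∀ u, Kc lev p r g m u → lev u = r → cix g (p u) + 1 < cix g (p v) →
        (G.Adj v u ↔ G.Adj (s x) u) := by
      by_cases h1 : 0 < cix g (p v) - 1
      · obtain ⟨x, hx⟩ := close v 0 (cix g (p v) - 1) (fun h => H 0 (cix g (p v) - 1) (cix g (p v))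
          (cix g (p v) + 1) h1 (by omega) (by omega) (by omega) v ⟨h, self 0⟩)
        exact ⟨x, fun u h2 h3 h4 => hx u h2 h3 (Nat.zero_le _) (by omega)⟩
      · exact ⟨0, fun u h2 h3 h4 => by omega⟩
    have hy : ∃ x : Fin (k + 1), ∀ u, Kc lev p r g m u → lev u = r → cix g (p v) + 1 < cix g (p u) →
        (G.Adj v u ↔ G.Adj (s x) u) := by
      have bd : ∀ u, Kc lev p r g m u → cix g (p u) < m := by
        intro u hu
        have := (cix_spec hg hu.2.1).1
        exact hg.lt_iff_lt.mp (this.trans_lt hu.2.2)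
      by_cases h1 : cix g (p v) + 2 < m
      · obtain ⟨x, hx⟩ := close v (cix g (p v) + 2) m (fun h => H (cix g (p v)) (cix g (p v) + 1)
          (cix g (p v) + 2) m (by omega) (by omega) (by omega) (by omega) v ⟨self 0, h⟩)
        exact ⟨x, fun u h2 h3 h4 => hx u h2 h3 (by omega) (bd u h2)⟩
      · exact ⟨0, fun u h2 h3 h4 => by have := bd u h2; omega⟩
    obtain ⟨x, hx⟩ := hx
    obtain ⟨y, hy⟩ := hy
    refine ⟨x, y, fun u hu => ?_⟩
    obtain ⟨h1, h2⟩ := isT u hu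
    exact ⟨hx u h1 h2, hy u h1 h2⟩
  · intro v _
    set P : ℕ → Prop := fun i => 0 < i ∧ ¬ NCI G lev p r (fun y => ∃ t < k, y = s t) v (g 0) (g i) with hP
    set i := Nat.findGreatest P m with hi
    have bd : ∀ u, Kc lev p r g m u → cix g (p u) < m := by
      intro u hu
      have := (cix_spec hg hu.2.1).1
      exact hg.lt_iff_lt.mp (this.trans_lt hu.2.2)
    have hx : ∃ x : Fin (k + 1), ∀ u, Kc lev p r g m u → lev u = r → cix g (p u) < i →
        (G.Adj v u ↔ G.Adj (s x) u) := by
      by_cases h0 : i = 0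
      · exact ⟨0, fun u _ _ h => by omega⟩
      · have := (Nat.findGreatest_of_ne_zero (P := P) (n := m) hi.symm h0)
        obtain ⟨x, hx⟩ := close v 0 i this.2
        exact ⟨x, fun u h2 h3 h4 => hx u h2 h3 (Nat.zero_le _) h4⟩
    have hy : ∃ x : Fin (k + 1), ∀ u, Kc lev p r g m u → lev u = r → i + 1 < cix g (p u) →
        (G.Adj v u ↔ G.Adj (s x) u) := by
      by_cases h1 : i + 2 < m
      · have h3 : ¬ P (i + 1) := Nat.findGreatest_is_greatest (n := m) (by omega) (by omega)
        have h4 : NCI G lev p r (fun y => ∃ t < k, y = s t) v (g 0) (g (i + 1)) := by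
          by_contra h5
          exact h3 ⟨by omega, h5⟩
        obtain ⟨x, hx⟩ := close v (i + 2) m (fun h => H 0 (i + 1)
          (i + 2) m (by omega) (by omega) (by omega) (by omega) v ⟨h4, h⟩)
        exact ⟨x, fun u h2 h3 h4 => hx u h2 h3 (by omega) (bd u h2)⟩
      · exact ⟨0, fun u h2 h3 h4 => by have := bd u h2; omega⟩
    obtain ⟨x, hx⟩ := hx
    obtain ⟨y, hy⟩ := hy
    refine ⟨i, x, y, fun u hu => ?_⟩
    obtain ⟨h1, h2⟩ := isT u hu
    exact ⟨hx u h1 h2, hy u h1 h2⟩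

set_option autoImplicit false

/-! ### Monadically dependent classes are flip-breakable -/

/-- There is a good flip. -/
def Break {V : Type} (R k m : ℕ) (G : SimpleGraph V) (W : V → Prop) : Prop :=
  ∃ A B : Finset V, (∀ a ∈ A, W a) ∧ (∀ b ∈ B, W b) ∧ m ≤ A.card ∧ m ≤ B.card ∧
    ∃ H : SimpleGraph V, IsKFlip k G H ∧ ∀ a ∈ A, ∀ b ∈ B, ∀ p : H.Walk a b, R < p.length

lemma Break.mono {V : Type} {R k k' m : ℕ} {G : SimpleGraph V} {W : V → Prop} (h : Break R k m G W)
    (hk : k ≤ k') : Break R k' m G W := by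
  obtain ⟨A, B, h1, h2, h3, h4, H, ⟨P, F, hF, hPF⟩, h5⟩ := h
  refine ⟨A, B, h1, h2, h3, h4, H, ⟨fun v => Fin.castLE hk (P v),
    fun i j => ∃ a b, Fin.castLE hk a = i ∧ Fin.castLE hk b = j ∧ F a b, ?_, ?_⟩, h5⟩
  · rintro i j ⟨a, b, ha, hb, hab⟩
    exact ⟨b, a, hb, ha, hF hab⟩
  · intro u v huv
    rw [hPF u v huv]
    have : F (P u) (P v) ↔ ∃ a b, Fin.castLE hk a = Fin.castLE hk (P u) ∧
        Fin.castLE hk b = Fin.castLE hk (P v) ∧ F a b := by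
      constructor
      · intro h; exact ⟨_, _, rfl, rfl, h⟩
      · rintro ⟨a, b, ha, hb, hab⟩
        rw [Fin.castLE_injective hk ha, Fin.castLE_injective hk hb] at hab
        exact hab
    rw [this]

/-- Number of classes in the final flip. -/
noncomputable def finK (Γ : Type) (R : ℕ) : ℕ := Nat.card (Γ × Fin (2 * R + 4))

lemma finalFlip {V Γ : Type} [Finite Γ] {R n m : ℕ} {G : SimpleGraph V} {W : V → Prop}
    {c : V → Γ} {lev p : V → ℕ} (clev : ∀ u v, c u = c v → lev u = lev v)
    (base : ∀ i < n, ∃ a, W a ∧ lev a = 0 ∧ p a = i)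
    (reg : ∀ u u' v v', lev u < R → c u = c u' → c v = c v' → 0 < p u → p u + 1 < n →
      0 < p u' → p u' + 1 < n →
      (lev u + 1 < lev v ∨ (p u + 1 < p v ∧ p u' + 1 < p v') ∨ (p v + 1 < p u ∧ p v' + 1 < p u')) →
      (G.Adj u v ↔ G.Adj u' v'))
    (hn : (2 * R + 3) * (m + 1) + 1 ≤ n) : Break R (finK Γ R) m G W := by
  classical
  set z : V → ℕ := fun v => min (p v / (m + 1)) (2 * R + 3) with hz
  set cl : V → Γ × Fin (2 * R + 4) := fun v => (c v, ⟨z v, by simp only [hz]; omega⟩) with hcl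
  let e : Γ × Fin (2 * R + 4) ≃ Fin (finK Γ R) := Finite.equivFin _
  set F : Fin (finK Γ R) → Fin (finK Γ R) → Prop := fun i j =>
    ∃ u v, e (cl u) = i ∧ e (cl v) = j ∧ G.Adj u v with hF
  have hFs : Symmetric F := by
    rintro i j ⟨u, v, h1, h2, h3⟩
    exact ⟨v, u, h2, h1, h3.symm⟩
  let H : SimpleGraph V :=
    { Adj := fun u v => u ≠ v ∧ Xor' (G.Adj u v) (F (e (cl u)) (e (cl v)))
      symm := by
        constructor
        rintro u v ⟨h1, h2⟩
        refine ⟨h1.symm, ?_⟩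
        rw [G.adj_comm v u]
        have : F (e (cl v)) (e (cl u)) ↔ F (e (cl u)) (e (cl v)) := ⟨fun h => hFs h, fun h => hFs h⟩
        rw [this]; exact h2
      loopless := by
        constructor
        rintro u ⟨h1, h2⟩
        exact h1 rfl }
  -- zones
  have zlo : ∀ v k, k ≤ z v → k * (m + 1) ≤ p v := by
    intro v k hk
    have : k ≤ p v / (m + 1) := by simp only [hz] at hk; omega
    exact (Nat.le_div_iff_mul_le (by omega)).mp this
  have zhi : ∀ v, z v < 2 * R + 3 → p v < (z v + 1) * (m + 1) := by
    intro v hv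
    have h1 : z v = p v / (m + 1) := by simp only [hz] at hv ⊢; omega
    rw [h1]
    have := Nat.lt_mul_div_succ (p v) (Nat.succ_pos m)
    rw [mul_comm]
    exact this
  have zsep : ∀ u v, z u + 1 < z v → p u + 1 < p v := by
    intro u v h
    have h1 := zlo v (z u + 2) h
    have h0 : z v ≤ 2 * R + 3 := by simp only [hz]; omega
    have h2 := zhi u (by omega)
    have : (z u + 2) * (m + 1) = (z u + 1) * (m + 1) + (m + 1) := by ring
    omega
  have hstep : ∀ u v, H.Adj u v → lev u < R → 0 < z u → z u < 2 * R + 3 →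
      lev v ≤ lev u + 1 ∧ z v ≤ z u + 1 ∧ z u ≤ z v + 1 := by
    rintro u v ⟨hne, hx⟩ hl hz0 hz1
    have ex : ∃ u' v', cl u' = cl u ∧ cl v' = cl v ∧ ¬ (G.Adj u v ↔ G.Adj u' v') := by
      rcases hx with ⟨h1, h2⟩ | ⟨h1, h2⟩
      · exact absurd ⟨u, v, rfl, rfl, h1⟩ h2
      · obtain ⟨u', v', h3, h4, h5⟩ := h1
        exact ⟨u', v', e.injective h3, e.injective h4, fun h => h2 (h.mpr h5)⟩
    obtain ⟨u', v', h1, h2, h3⟩ := ex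
    simp only [hcl, Prod.mk.injEq, Fin.mk.injEq] at h1 h2
    have in1 : ∀ w, z w = z u → 0 < p w ∧ p w + 1 < n := by
      intro w hw
      have a1 := zlo w 1 (by omega)
      have a2 := zhi w (by omega)
      have : (z w + 1) * (m + 1) ≤ (2 * R + 3) * (m + 1) := Nat.mul_le_mul_right _ (by omega)
      omega
    by_contra hcon
    apply h3
    apply reg u u' v v' hl h1.1.symm h2.1.symm (in1 u rfl).1 (in1 u rfl).2 (in1 u' h1.2).1 (in1 u' h1.2).2
    by_cases g1 : lev u + 1 < lev v
    · exact Or.inl g1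
    · right
      by_cases g2 : z u + 1 < z v
      · left
        exact ⟨zsep u v g2, zsep u' v' (by omega)⟩
      · right
        exact ⟨zsep v u (by omega), zsep v' u' (by omega)⟩
  have hwalk : ∀ (u b : V) (w : H.Walk u b) (j : ℕ), lev u ≤ j → R + 1 ≤ z u + j → z u ≤ R + 1 + j →
      j + w.length ≤ R → z b ≤ R + 1 + R := by
    intro u b w
    induction w with
    | nil => intro j h1 h2 h3 h4; simp at h4; omega
    | cons hadj w ih =>
      intro j h1 h2 h3 h4
      rw [SimpleGraph.Walk.length_cons] at h4
      obtain ⟨a1, a2, a3⟩ := hstep _ _ hadj (by omega) (by omega) (by omega)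
      exact ih (j + 1) (by omega) (by omega) (by omega) (by omega)
  have hset : ∀ q, q < 2 * R + 3 → ∃ A : Finset V, (∀ a ∈ A, W a ∧ lev a = 0 ∧ z a = q) ∧ m ≤ A.card := by
    intro q hq
    have hlt : ∀ i : Fin m, q * (m + 1) + i < n := by
      intro i
      have : (q + 1) * (m + 1) ≤ (2 * R + 3) * (m + 1) := Nat.mul_le_mul_right _ (by omega)
      have : (q + 1) * (m + 1) = q * (m + 1) + (m + 1) := by ring
      have := i.2
      omega
    choose f hf1 hf2 hf3 using fun i : Fin m => base (q * (m + 1) + i) (hlt i)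
    have hinj : Function.Injective f := by
      intro i j hij
      have := hf3 i
      rw [hij, hf3 j] at this
      apply Fin.ext
      omega
    refine ⟨Finset.univ.map ⟨f, hinj⟩, ?_, by simp⟩
    intro a ha
    simp only [Finset.mem_map, Finset.mem_univ, true_and, Function.Embedding.coeFn_mk] at ha
    obtain ⟨i, rfl⟩ := ha
    refine ⟨hf1 i, hf2 i, ?_⟩
    have : p (f i) / (m + 1) = q := by
      rw [hf3, Nat.div_eq_iff (by omega)]
      have := i.2
      constructor
      · omega
      · have : (q + 1) * (m + 1) = q * (m + 1) + (m + 1) := by ring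
        omega
    simp only [hz, this]
    omega
  obtain ⟨A, hA, hAc⟩ := hset (R + 1) (by omega)
  obtain ⟨B, hB, hBc⟩ := hset (2 * R + 2) (by omega)
  refine ⟨A, B, fun a ha => (hA a ha).1, fun b hb => (hB b hb).1, hAc, hBc, H,
    ⟨fun v => e (cl v), F, hFs, fun u v huv => ?_⟩, ?_⟩
  · change (u ≠ v ∧ _) ↔ _
    simp [huv]
  · intro a ha b hb w
    by_contra hlt
    obtain ⟨-, l1, l2⟩ := hA a ha
    obtain ⟨-, l3, l4⟩ := hB b hb
    have := hwalk a b w 0 (by omega) (by omega) (by omega) (by omega)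
    omega

lemma breakOrd {C : GraphClass} (hC : ¬ TransducesAllGraphs C) (R : ℕ) : ∀ d r, r + d = R →
    ∀ (Γ : Type) [Finite Γ] (ψ : Bin Γ), IsDef2 ψ → ∃ k, ∀ m, ∃ M, ∀ N (G : SimpleGraph (Fin N)), C N G →
      ∀ W c lev p n, M ≤ n → OrdSys r n ψ G W c lev p → Break R k m G W := by
  intro d
  induction d with
  | zero =>
    intro r hr Γ _ ψ hψ
    have : r = R := by omega
    subst this
    exact ⟨finK Γ r, fun m => ⟨_, fun N G hG W c lev p n hn hS => finalFlip hS.clev hS.base hS.reg hn⟩⟩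
  | succ d ih =>
    intro r hr Γ _ ψ hψ
    obtain ⟨k1, h1⟩ := stepB hC r hψ
    obtain ⟨k, hk⟩ := ih (r + 1) (by omega) (ΓB Γ k1) (ψE (ψC ψ)) (ψE_def (ψC_def hψ))
    refine ⟨k, fun m => ?_⟩
    obtain ⟨M1, hM1⟩ := hk m
    obtain ⟨M, hM⟩ := h1 M1
    refine ⟨M, fun N G hG W c lev p n hn hS => ?_⟩
    obtain ⟨c', lev', p', hS'⟩ := hM N G hG W c lev p n hn hS
    exact hM1 N G hG W c' lev' p' M1 le_rfl hS'

lemma breakOrl {C : GraphClass} (hC : ¬ TransducesAllGraphs C) (R : ℕ) : ∀ d r, r + d = R →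
    ∀ (Γ : Type) [Finite Γ] (ψ : Bin Γ), IsDef2 ψ → ∃ k, ∀ m, ∃ M, ∀ N (G : SimpleGraph (Fin N)), C N G →
      ∀ W c lev p n, M ≤ n → OrlSys r n ψ G W c lev p → Break R k m G W := by
  intro d
  induction d with
  | zero =>
    intro r hr Γ _ ψ hψ
    have : r = R := by omega
    subst this
    refine ⟨finK Γ r, fun m => ⟨_, fun N G hG W c lev p n hn hS => finalFlip hS.clev hS.base ?_ hn⟩⟩
    intro u u' v v' h1 h2 h3 _ _ _ _ h4
    apply hS.reg u u' v v' h1 h2 h3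
    omega
  | succ d ih =>
    intro r hr Γ _ ψ hψ
    obtain ⟨k1, h1⟩ := stepA hC r hψ
    obtain ⟨k, hk⟩ := ih (r + 1) (by omega) (ΓA Γ k1) (ψA ψ) (ψA_def hψ)
    obtain ⟨k', hk'⟩ := breakOrd hC R (d + 1) r hr _ (ψO ψ) (ψO_def hψ)
    refine ⟨max k k', fun m => ?_⟩
    obtain ⟨M1, hM1⟩ := hk m
    obtain ⟨M2, hM2⟩ := hk' m
    obtain ⟨M, hM⟩ := h1 (max M1 M2)
    refine ⟨M, fun N G hG W c lev p n hn hS => ?_⟩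
    rcases hM N G hG W c lev p n hn hS with ⟨c', lev', p', hS'⟩ | ⟨c', lev', p', hS'⟩
    · exact (hM2 N G hG W c' lev' p' _ (le_max_right _ _) hS').mono (le_max_right _ _)
    · exact (hM1 N G hG W c' lev' p' _ (le_max_left _ _) hS').mono (le_max_left _ _)

theorem flipBreakable_of_not_transduces {C : GraphClass} (hC : ¬ TransducesAllGraphs C) :
    FlipBreakable C := by
  classical
  intro R
  obtain ⟨k, hk⟩ := breakOrl hC R R 0 (by omega) Prop (fun V _ _ u v => u = v) (IsDef.eq 0 1)
  choose M hM using hk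
  refine ⟨M, k, fun m n G hG W hW => ?_⟩
  obtain ⟨A, B, h1, h2, h3, h4, H, h5, h6⟩ := hM m n G hG (fun v => v ∈ W) (fun v => v ∈ W)
    (fun v => if v ∈ W then 0 else 1) (fun v => if h : v ∈ W then (W.equivFin ⟨v, h⟩).val else 0) W.card hW (by
      constructor
      · intro u v huv
        have huv : (u ∈ W) = (v ∈ W) := huv
        simp only [huv]
      · intro i hi
        refine ⟨(W.equivFin.symm ⟨i, hi⟩).1, (W.equivFin.symm ⟨i, hi⟩).2, ?_, ?_⟩
        · simp
        · simp
      · intro v hv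
        by_cases h : v ∈ W
        · simp only [h, dif_pos]
          exact (W.equivFin ⟨v, h⟩).2
        · simp [h] at hv
      · intro u v hu hv
        by_cases h : u ∈ W
        swap
        · simp [h] at hu
        by_cases h' : v ∈ W
        swap
        · simp [h'] at hv
        simp only [h, h', dif_pos]
        constructor
        · rintro rfl; rfl
        · intro heq
          have := W.equivFin.injective (Fin.ext heq)
          simpa using this
      · intro u u' v v' hu
        omega)
  exact ⟨A, B, h1, h2, h3, h4, H, h5, h6⟩

set_option autoImplicit false

/-! ### Flip-breakable classes are monadically dependent -/

/-- distance at most `R` -/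
def DL {V : Type} (H : SimpleGraph V) (R : ℕ) (u v : V) : Prop := ∃ w : H.Walk u v, w.length ≤ R

lemma DL.symm {V : Type} {H : SimpleGraph V} {R : ℕ} {u v : V} (h : DL H R u v) : DL H R v u := by
  obtain ⟨w, hw⟩ := h
  exact ⟨w.reverse, by rw [SimpleGraph.Walk.length_reverse]; exact hw⟩

lemma DL.trans {V : Type} {H : SimpleGraph V} {R S Q : ℕ} {u v x : V} (h : DL H R u v) (h' : DL H S v x)
    (hQ : R + S ≤ Q) : DL H Q u x := by
  obtain ⟨w, hw⟩ := h
  obtain ⟨w', hw'⟩ := h'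
  exact ⟨w.append w', by rw [SimpleGraph.Walk.length_append]; omega⟩

lemma DL.mono {V : Type} {H : SimpleGraph V} {R S : ℕ} {u v : V} (h : DL H R u v) (hQ : R ≤ S) :
    DL H S u v := by
  obtain ⟨w, hw⟩ := h
  exact ⟨w, by omega⟩

/-- clusters are far apart -/
def Far {V : Type} (H : SimpleGraph V) (R : ℕ) {n : ℕ} (κ : Fin n → Fin n) (a : Fin n → V) : Prop :=
  ∀ x y, κ x ≠ κ y → ¬ DL H R (a x) (a y)

/-- Locality and separation of types. -/
def SepTy {V : Type} (H : SimpleGraph V) (R : ℕ) {n : ℕ} (P : (Fin n → V) → Prop) (T : Type)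
    (κ : Fin n → Fin n) (τ : Fin n → (Fin n → V) → T) : Prop :=
  (∀ i a b, (∀ x, κ x = i → a x = b x) → τ i a = τ i b) ∧
    ∀ a b, Far H R κ a → Far H R κ b → (∀ i, τ i a = τ i b) → (P a ↔ P b)

/-- Separability of a family of predicates. -/
def SepF {Γ : Type} {n : ℕ} (P : ∀ V : Type, SimpleGraph V → (V → Γ) → (Fin n → V) → Prop) : Prop :=
  ∃ R, ∀ k, ∃ T : Type, Finite T ∧ ∀ (V : Type) [Nonempty V] (G H : SimpleGraph V) (c : V → Γ),
    IsKFlip k G H → ∀ κ : Fin n → Fin n, ∃ τ : Fin n → (Fin n → V) → T, SepTy H R (P V G c) T κ τ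

lemma SepF.bot {Γ : Type} {n : ℕ} : SepF (Γ := Γ) (n := n) (fun _ _ _ _ => False) :=
  ⟨0, fun _ => ⟨Unit, inferInstance, fun _ _ _ _ _ _ _ => ⟨fun _ _ => (), fun _ _ _ _ => rfl,
    fun _ _ _ _ _ => Iff.rfl⟩⟩⟩

lemma SepF.congr {Γ : Type} {n : ℕ} {P Q : ∀ V : Type, SimpleGraph V → (V → Γ) → (Fin n → V) → Prop}
    (h : SepF P) (hPQ : ∀ V G c a, P V G c a ↔ Q V G c a) : SepF Q := by
  have : P = Q := by
    funext V G c a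
    exact propext (hPQ V G c a)
  exact this ▸ h

lemma SepF.col {Γ : Type} {n : ℕ} (x : Fin n) (p : Γ → Prop) : SepF (Γ := Γ) (n := n)
    (fun _ _ c a => p (c (a x))) := by
  refine ⟨0, fun _ => ⟨Prop, inferInstance, fun V _ G H c _ κ => ⟨fun i a => κ x = i ∧ p (c (a x)), ?_, ?_⟩⟩⟩
  · intro i a b hab
    apply propext
    apply and_congr_right
    intro h
    rw [hab x h]
  · intro a b _ _ h
    have := h (κ x)
    simpa using this

lemma SepF.eq {Γ : Type} {n : ℕ} (x y : Fin n) : SepF (Γ := Γ) (n := n)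
    (fun _ _ _ a => a x = a y) := by
  refine ⟨0, fun _ => ⟨Prop, inferInstance, fun V _ G H c _ κ =>
    ⟨fun i a => κ x = i ∧ κ y = i ∧ a x = a y, ?_, ?_⟩⟩⟩
  · intro i a b hab
    apply propext
    apply and_congr_right
    intro h
    apply and_congr_right
    intro h'
    rw [hab x h, hab y h']
  · intro a b ha hb h
    by_cases hxy : κ x = κ y
    · have := h (κ x)
      simpa [hxy] using this
    · have aux : ∀ a : Fin n → V, Far H 0 κ a → ¬ a x = a y := by
        intro a ha he
        apply ha x y hxy
        rw [he]
        exact ⟨.nil, by simp⟩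
      simp [aux a ha, aux b hb]

lemma SepF.adj {Γ : Type} {n : ℕ} (x y : Fin n) : SepF (Γ := Γ) (n := n)
    (fun _ G _ a => G.Adj (a x) (a y)) := by
  classical
  refine ⟨1, fun k => ⟨Prop × Option (Fin k) × Option (Fin k), inferInstance, fun V _ G H c hk κ => ?_⟩⟩
  obtain ⟨Pt, F, hF, hPF⟩ := hk
  refine ⟨fun i a => (κ x = i ∧ κ y = i ∧ G.Adj (a x) (a y), if κ x = i then some (Pt (a x)) else none,
    if κ y = i then some (Pt (a y)) else none), ?_, ?_⟩
  · intro i a b hab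
    refine Prod.ext ?_ (Prod.ext ?_ ?_)
    · apply propext
      apply and_congr_right
      intro h
      apply and_congr_right
      intro h'
      rw [hab x h, hab y h']
    · by_cases h : κ x = i
      · simp [h, hab x h]
      · simp [h]
    · by_cases h : κ y = i
      · simp [h, hab y h]
      · simp [h]
  · intro a b ha hb h
    simp only [Prod.mk.injEq] at h
    by_cases hxy : κ x = κ y
    · have := (h (κ x)).1
      simpa [hxy] using this
    · have aux : ∀ a : Fin n → V, Far H 1 κ a → (G.Adj (a x) (a y) ↔ F (Pt (a x)) (Pt (a y))) := by
        intro a ha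
        have h1 : ¬ a x = a y := by
          intro he
          apply ha x y hxy
          rw [he]
          exact ⟨.nil, by simp⟩
        have h2 : ¬ H.Adj (a x) (a y) := by
          intro he
          apply ha x y hxy
          exact ⟨.cons he .nil, by simp⟩
        have h3 := fun hx => h2 ((hPF _ _ h1).mpr hx)
        exact not_not.mp fun h4 => h3 ((xor_iff_not_iff _ _).mpr h4)
      have e1 := (h (κ x)).2.1
      have e2 := (h (κ y)).2.2
      simp only [if_true, Option.some.injEq] at e1 e2
      change G.Adj (a x) (a y) ↔ G.Adj (b x) (b y)
      rw [aux a ha, aux b hb, e1, e2]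

lemma Far.mono {V : Type} {H : SimpleGraph V} {R S n : ℕ} {κ : Fin n → Fin n} {a : Fin n → V}
    (h : Far H S κ a) (hRS : R ≤ S) : Far H R κ a := fun x y hxy hd => h x y hxy (hd.mono hRS)

lemma SepF.imp {Γ : Type} {n : ℕ} {P Q : ∀ V : Type, SimpleGraph V → (V → Γ) → (Fin n → V) → Prop}
    (hP : SepF P) (hQ : SepF Q) : SepF (fun V G c a => P V G c a → Q V G c a) := by
  obtain ⟨R, hP⟩ := hP
  obtain ⟨S, hQ⟩ := hQ
  refine ⟨max R S, fun k => ?_⟩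
  obtain ⟨T, hT, h1⟩ := hP k
  obtain ⟨T', hT', h2⟩ := hQ k
  refine ⟨T × T', inferInstance, fun V _ G H c hk κ => ?_⟩
  obtain ⟨τ, t1, t2⟩ := h1 V G H c hk κ
  obtain ⟨τ', t1', t2'⟩ := h2 V G H c hk κ
  refine ⟨fun i a => (τ i a, τ' i a), ?_, ?_⟩
  · intro i a b hab
    exact Prod.ext (t1 i a b hab) (t1' i a b hab)
  · intro a b ha hb h
    simp only [Prod.mk.injEq] at h
    exact imp_congr (t2 a b (ha.mono (le_max_left _ _)) (hb.mono (le_max_left _ _)) fun i => (h i).1)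
      (t2' a b (ha.mono (le_max_right _ _)) (hb.mono (le_max_right _ _)) fun i => (h i).2)

/-- extended cluster map -/
def exκ {n : ℕ} (κ : Fin n → Fin n) (j : Fin (n + 1)) : Fin (n + 1) → Fin (n + 1) :=
  Fin.snoc (α := fun _ => Fin (n + 1)) (fun x => (κ x).castSucc) j

/-- extended assignment -/
def exA {V : Type} {n : ℕ} (a : Fin n → V) (z : V) : Fin (n + 1) → V := Fin.snoc (α := fun _ => V) a z

lemma exκ_cast {n : ℕ} (κ : Fin n → Fin n) (j : Fin (n + 1)) (x : Fin n) :
    exκ κ j x.castSucc = (κ x).castSucc := by simp [exκ]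

lemma exκ_last {n : ℕ} (κ : Fin n → Fin n) (j : Fin (n + 1)) : exκ κ j (Fin.last n) = j := by simp [exκ]

lemma exA_cast {V : Type} {n : ℕ} (a : Fin n → V) (z : V) (x : Fin n) :
    exA a z x.castSucc = a x := by simp [exA]

lemma exA_last {V : Type} {n : ℕ} (a : Fin n → V) (z : V) : exA a z (Fin.last n) = z := by simp [exA]

lemma far_ex {V : Type} {H : SimpleGraph V} {R n : ℕ} {κ : Fin n → Fin n} {j : Fin (n + 1)} {a : Fin n → V}
    {z : V} (ha : Far H R κ a) (hz : ∀ x, (κ x).castSucc ≠ j → ¬ DL H R (a x) z) :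
    Far H R (exκ κ j) (exA a z) := by
  intro x y hxy
  induction x using Fin.lastCases with
  | last =>
    induction y using Fin.lastCases with
    | last => exact absurd rfl hxy
    | cast y =>
      rw [exκ_cast, exκ_last] at hxy
      rw [exA_cast, exA_last]
      exact fun h => hz y hxy.symm h.symm
  | cast x =>
    induction y using Fin.lastCases with
    | last =>
      rw [exκ_cast, exκ_last] at hxy
      rw [exA_cast, exA_last]
      exact hz x hxy
    | cast y =>
      rw [exκ_cast, exκ_cast] at hxy
      rw [exA_cast, exA_cast]
      exact ha x y (fun h => hxy (by rw [h]))

lemma SepF.all {Γ : Type} {n : ℕ} {P : ∀ V : Type, SimpleGraph V → (V → Γ) → (Fin (n + 1) → V) → Prop}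
    (hP : SepF P) : SepF (fun V G c (a : Fin n → V) => ∀ z, P V G c (exA a z)) := by
  classical
  obtain ⟨R, hP⟩ := hP
  refine ⟨4 * R, fun k => ?_⟩
  obtain ⟨T, hT, hP⟩ := hP k
  refine ⟨(T → Prop) × (Fin n → T) × T × (T → Fin n → Prop), inferInstance, fun V _ G H c hk κ => ?_⟩
  obtain ⟨v0⟩ := ‹Nonempty V›
  choose τ hl hs using fun j : Fin (n + 1) => hP V G H c hk (exκ κ j)
  set D := DL H R with hD
  -- type of a far vertex
  let g : V → T := fun z => τ (Fin.last n) (Fin.last n) (fun _ => z)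
  have hg : ∀ a z, τ (Fin.last n) (Fin.last n) (exA a z) = g z := by
    intro a z
    apply hl
    intro x hx
    induction x using Fin.lastCases with
    | last => rw [exA_last]
    | cast x =>
      rw [exκ_cast] at hx
      exact absurd hx (Fin.castSucc_lt_last _).ne
  have hcen : ∀ s : T, ∃ cen : Fin n → V, (∃ cen : Fin n → V, ∀ z, g z = s → ∃ l, D (cen l) z) →
      ∀ z, g z = s → ∃ l, D (cen l) z := by
    intro s
    by_cases h : ∃ cen : Fin n → V, ∀ z, g z = s → ∃ l, D (cen l) z
    · obtain ⟨cen, h⟩ := h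
      exact ⟨cen, fun _ => h⟩
    · exact ⟨fun _ => v0, fun h' => absurd h' h⟩
  choose cen hcen using hcen
  -- changing `z` outside of the cluster
  have hloc : ∀ (j : Fin (n + 1)) (i : Fin n) (a b : Fin n → V) (z z' : V), (∀ x, κ x = i → a x = b x) →
      (j = i.castSucc → z = z') → τ j i.castSucc (exA a z) = τ j i.castSucc (exA b z') := by
    intro j i a b z z' hab hz
    apply hl
    intro x hx
    induction x using Fin.lastCases with
    | last =>
      rw [exκ_last] at hx
      rw [exA_last, exA_last]; exact hz hx
    | cast x =>
      rw [exκ_cast] at hx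
      rw [exA_cast, exA_cast]
      exact hab x (Fin.castSucc_injective _ hx)
  refine ⟨fun i a => (fun t => ∃ z, (∃ x, κ x = i ∧ D (a x) z) ∧ τ i.castSucc i.castSucc (exA a z) = t,
    fun j => τ j.castSucc i.castSucc (exA a v0), τ (Fin.last n) i.castSucc (exA a v0),
    fun s l => ∀ z, g z = s → D (cen s l) z → ∃ x, κ x = i ∧ D (a x) z), ?_, ?_⟩
  · intro i a b hab
    have e1 : ∀ z, (∃ x, κ x = i ∧ D (a x) z) ↔ (∃ x, κ x = i ∧ D (b x) z) := by
      intro z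
      refine exists_congr fun x => and_congr_right fun hx => ?_
      rw [hab x hx]
    refine Prod.ext ?_ (Prod.ext ?_ (Prod.ext ?_ ?_))
    · funext t
      apply propext
      refine exists_congr fun z => ?_
      rw [e1 z, hloc i.castSucc i a b z z hab (fun _ => rfl)]
    · funext j
      exact hloc _ _ _ _ _ _ hab (fun _ => rfl)
    · exact hloc _ _ _ _ _ _ hab (fun _ => rfl)
    · funext s l
      apply propext
      refine forall_congr' fun z => imp_congr_right fun _ => imp_congr_right fun _ => e1 z
  · -- separation
    suffices key : ∀ a b : Fin n → V, Far H (4 * R) κ a → Far H (4 * R) κ b →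
        (∀ i : Fin n, (∀ t, (∃ z, (∃ x, κ x = i ∧ D (a x) z) ∧ τ i.castSucc i.castSucc (exA a z) = t) →
          ∃ z, (∃ x, κ x = i ∧ D (b x) z) ∧ τ i.castSucc i.castSucc (exA b z) = t) ∧
          (∀ j : Fin n, τ j.castSucc i.castSucc (exA a v0) = τ j.castSucc i.castSucc (exA b v0)) ∧
          τ (Fin.last n) i.castSucc (exA a v0) = τ (Fin.last n) i.castSucc (exA b v0) ∧
          ∀ s l, (∀ z, g z = s → D (cen s l) z → ∃ x, κ x = i ∧ D (b x) z) →
            ∀ z, g z = s → D (cen s l) z → ∃ x, κ x = i ∧ D (a x) z) →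
        (∀ z, P V G c (exA b z)) → ∀ z, P V G c (exA a z) by
      intro a b ha hb h
      simp only [Prod.mk.injEq] at h
      constructor
      · refine key b a hb ha fun i => ⟨fun t ht => ?_, fun j => ?_, (h i).2.2.1.symm, fun s l => ?_⟩
        · have := congrFun (h i).1 t
          exact (iff_of_eq this).mpr ht
        · exact (congrFun (h i).2.1 j).symm
        · exact (iff_of_eq (congrFun (congrFun (h i).2.2.2 s) l)).mp
      · refine key a b ha hb fun i => ⟨fun t ht => ?_, fun j => ?_, (h i).2.2.1, fun s l => ?_⟩
        · have := congrFun (h i).1 t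
          exact (iff_of_eq this).mp ht
        · exact (congrFun (h i).2.1 j)
        · exact (iff_of_eq (congrFun (congrFun (h i).2.2.2 s) l)).mpr
    intro a b ha hb h hall z
    have far2 : ∀ (a : Fin n → V) (j : Fin n) (z : V), Far H (4 * R) κ a → (∃ x, κ x = j ∧ D (a x) z) →
        Far H R (exκ κ j.castSucc) (exA a z) := by
      rintro a j z ha ⟨x, hx, hxz⟩
      refine far_ex (ha.mono (by omega)) fun y hy hyz => ?_
      refine ha y x (fun hyx => hy (by rw [hyx, hx])) (hyz.trans hxz.symm (by omega))
    by_cases hz : ∃ x, D (a x) z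
    · obtain ⟨x, hx⟩ := hz
      obtain ⟨h1, h2, -, -⟩ := h (κ x)
      obtain ⟨z', hz', ht⟩ := h1 _ ⟨z, ⟨x, rfl, hx⟩, rfl⟩
      refine (hs (κ x).castSucc (exA a z) (exA b z') (far2 a _ z ha ⟨x, rfl, hx⟩) (far2 b _ z' hb hz') ?_).mpr
        (hall z')
      intro i
      induction i using Fin.lastCases with
      | last =>
        apply hl
        intro y hy
        exfalso
        induction y using Fin.lastCases with
        | last =>
          rw [exκ_last] at hy
          exact (Fin.castSucc_lt_last _).ne hy
        | cast y =>
          rw [exκ_cast] at hy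
          exact (Fin.castSucc_lt_last _).ne hy
      | cast i =>
        by_cases hi : i = κ x
        · subst hi; exact ht.symm
        · have hne : ∀ z z' : V, (κ x).castSucc = i.castSucc → z = z' :=
            fun _ _ h => absurd (Fin.castSucc_injective _ h).symm hi
          rw [hloc _ i a a z v0 (fun _ _ => rfl) (hne _ _), hloc _ i b b z' v0 (fun _ _ => rfl) (hne _ _)]
          exact (h i).2.1 (κ x)
    · have hz' : ∃ z', g z' = g z ∧ ∀ x, ¬ D (b x) z' := by
        by_contra hno
        push Not at hno
        have hc := hcen (g z) ⟨b, hno⟩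
        obtain ⟨l, hl⟩ := hc z rfl
        obtain ⟨x0, hx0⟩ := hno z rfl
        obtain ⟨x, -, hx⟩ := (h (κ x0)).2.2.2 (g z) l (by
          intro w hw hlw
          obtain ⟨x1, hx1⟩ := hno w hw
          refine ⟨x1, ?_, hx1⟩
          by_contra hne
          refine hb x1 x0 hne ?_
          have d1 : DL H (2 * R) (b x1) (cen (g z) l) := hx1.trans hlw.symm (by omega)
          have d2 : DL H (2 * R) (cen (g z) l) (b x0) := hl.trans hx0.symm (by omega)
          exact d1.trans d2 (by omega)) z rfl hl
        exact hz ⟨x, hx⟩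
      obtain ⟨z', hgz, hfz⟩ := hz'
      push Not at hz
      refine (hs (Fin.last n) (exA a z) (exA b z') (far_ex (ha.mono (by omega)) fun x _ => hz x)
        (far_ex (hb.mono (by omega)) fun x _ => hfz x) ?_).mpr (hall z')
      intro i
      induction i using Fin.lastCases with
      | last => rw [hg, hg, hgz]
      | cast i =>
        have hne : ∀ z z' : V, Fin.last n = i.castSucc → z = z' :=
          fun _ _ h => absurd h.symm (Fin.castSucc_lt_last _).ne
        rw [hloc _ i a a z v0 (fun _ _ => rfl) (hne _ _), hloc _ i b b z' v0 (fun _ _ => rfl) (hne _ _)]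
        exact (h i).2.2.1

set_option autoImplicit false

open FirstOrder

lemma colTerm_var {ℓ : ℕ} {α : Type} (t : (colLang ℓ).Term α) : ∃ x, t = Language.Term.var x := by
  cases t with
  | var x => exact ⟨x, rfl⟩
  | func f _ => exact Empty.elim f

/-- position of a variable -/
def vpos {n : ℕ} : Fin 2 ⊕ Fin n → Fin (2 + n) := Sum.elim (Fin.castAdd n) (Fin.natAdd 2)

lemma vpos_eq {n : ℕ} {V : Type} (a : Fin (2 + n) → V) (x : Fin 2 ⊕ Fin n) :
    Sum.elim (fun i => a (Fin.castAdd n i)) (fun i => a (Fin.natAdd 2 i)) x = a (vpos x) := by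
  cases x <;> rfl

lemma sepF_formula {ℓ n : ℕ} (φ : (colLang ℓ).BoundedFormula (Fin 2) n) :
    SepF (Γ := Fin ℓ) (n := 2 + n) (fun V G c a =>
      letI := colStruct G c
      φ.Realize (fun i => a (Fin.castAdd n i)) (fun i => a (Fin.natAdd 2 i))) := by
  induction φ with
  | falsum => exact SepF.bot
  | equal t₁ t₂ =>
    obtain ⟨x, rfl⟩ := colTerm_var t₁
    obtain ⟨y, rfl⟩ := colTerm_var t₂
    refine (SepF.eq (vpos x) (vpos y)).congr fun V G c a => ?_
    rw [← vpos_eq a x, ← vpos_eq a y]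
    rfl
  | @rel n l R ts =>
    choose f hf using fun i => colTerm_var (ts i)
    obtain rfl : ts = fun i => Language.Term.var (f i) := funext hf
    match l, R with
    | 0, R => exact Empty.elim R
    | 1, R =>
      refine (SepF.col (vpos (f 0)) (fun d => d = R)).congr fun V G c a => ?_
      rw [← vpos_eq a (f 0)]
      rfl
    | 2, R =>
      refine (SepF.adj (vpos (f 0)) (vpos (f 1))).congr fun V G c a => ?_
      rw [← vpos_eq a (f 0), ← vpos_eq a (f 1)]
      rfl
    | l + 3, R => exact Empty.elim R
  | imp φ ψ h1 h2 => exact (h1.imp h2).congr fun V G c a => Iff.rfl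
  | @all n φ h =>
    refine (SepF.all (n := 2 + n) h).congr fun V G c a => ?_
    refine forall_congr' fun z => ?_
    have e1 : (fun i => exA a z (Fin.castAdd (n + 1) i)) = fun i => a (Fin.castAdd n i) := by
      funext i
      exact exA_cast a z (Fin.castAdd n i)
    have e2 : (fun i => exA a z (Fin.natAdd 2 i)) =
        Fin.snoc (α := fun _ => V) (fun i => a (Fin.natAdd 2 i)) z := by
      funext i
      induction i using Fin.lastCases with
      | last => rw [Fin.snoc_last]; exact exA_last a z
      | cast i => rw [Fin.snoc_castSucc]; exact exA_cast a z (Fin.natAdd 2 i)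
    letI := colStruct G c
    change Language.BoundedFormula.Realize φ _ _ ↔ Language.BoundedFormula.Realize φ _ _
    rw [← e2, ← e1]

lemma sepF_colSat {ℓ : ℕ} (φ : (colLang ℓ).Formula (Fin 2)) :
    SepF (Γ := Fin ℓ) (n := 2) (fun _ G c a => colSat G c φ (a 0) (a 1)) := by
  refine (sepF_formula (n := 0) φ).congr fun V G c a => ?_
  unfold colSat Language.Formula.Realize
  have e1 : (fun i : Fin 2 => a (Fin.castAdd 0 i)) = ![a 0, a 1] := by
    funext i; fin_cases i <;> rfl
  have e2 : (fun i : Fin 0 => a (Fin.natAdd 2 i)) = default := Subsingleton.elim _ _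
  rw [← e1, ← e2]

/-- The subdivided clique. -/
def subdivK (n : ℕ) : SimpleGraph (Fin n ⊕ Fin n × Fin n) where
  Adj u v := match u, v with
    | .inl a, .inr p => a = p.1 ∨ a = p.2
    | .inr p, .inl a => a = p.1 ∨ a = p.2
    | _, _ => False
  symm := ⟨by
    rintro (a | p) (b | q) h <;> exact h⟩
  loopless := ⟨by
    rintro (a | p) h <;> exact h⟩

lemma pigeonTy {V T : Type} [Finite T] (A : Finset V) (f : V → T) (h : Nat.card T < A.card) :
    ∃ a ∈ A, ∃ b ∈ A, a ≠ b ∧ f a = f b := by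
  classical
  haveI := Fintype.ofFinite T
  refine Finset.exists_ne_map_eq_of_card_lt_of_maps_to (t := Finset.univ) ?_ (fun _ _ => Finset.mem_univ _)
  rwa [Finset.card_univ, ← Nat.card_eq_fintype_card]

theorem not_transduces_of_flipBreakable {C : GraphClass} (hC : FlipBreakable C) :
    ¬ TransducesAllGraphs C := by
  classical
  rintro ⟨ℓ, φ, hφ⟩
  obtain ⟨R, hR⟩ := sepF_colSat φ
  obtain ⟨Nr, k, hN⟩ := hC (2 * R)
  obtain ⟨T, hT, hR⟩ := hR k
  obtain ⟨N, G, hG, c, e, he, hadj⟩ := hφ (Fintype.card (Fin (Nr (Nat.card (T × T) + 1)) ⊕ Fin (Nr (Nat.card (T × T) + 1)) × Fin (Nr (Nat.card (T × T) + 1))))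
    ((subdivK (Nr (Nat.card (T × T) + 1))).comap (Fintype.equivFin _).symm)
  generalize hm : Nat.card (T × T) + 1 = m at *
  generalize hn : Nr m = n0 at *
  let E : Fin n0 ⊕ Fin n0 × Fin n0 → Fin N := fun u => e (Fintype.equivFin _ u)
  have hE : Function.Injective E := fun u v h => (Fintype.equivFin _).injective (he h)
  have hA : ∀ u v, (subdivK n0).Adj u v ↔
      (E u ≠ E v ∧ (colSat G c φ (E u) (E v) ∨ colSat G c φ (E v) (E u))) := by
    intro u v
    rw [← hadj, SimpleGraph.comap_adj, Equiv.symm_apply_apply, Equiv.symm_apply_apply]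
  obtain ⟨A, B, hAW, hBW, hAm, hBm, H, hk, hfar⟩ := hN m N G hG
    (Finset.univ.image fun i : Fin n0 => E (.inl i)) (by
      rw [Finset.card_image_of_injective _ (fun i j h => Sum.inl_injective (hE h)), Finset.card_univ,
        Fintype.card_fin, hn])
  have hA0 : A.Nonempty := Finset.card_pos.mp (by omega)
  haveI : Nonempty (Fin N) := ⟨hA0.choose⟩
  obtain ⟨τ, hl, hs⟩ := hR (Fin N) G H c hk id
  let f : Fin N → T × T := fun v => (τ 0 ![v, v], τ 1 ![v, v])
  have hl0 : ∀ u v, τ 0 ![u, v] = τ 0 ![u, u] := by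
    intro u v
    apply hl
    rintro x rfl
    rfl
  have hl1 : ∀ u v, τ 1 ![u, v] = τ 1 ![v, v] := by
    intro u v
    apply hl
    rintro x rfl
    rfl
  have hfr : ∀ u v, ¬ DL H R u v → Far H R (id : Fin 2 → Fin 2) ![u, v] := by
    intro u v h x y hxy
    fin_cases x <;> fin_cases y
    · exact absurd rfl hxy
    · exact h
    · exact fun h' => h h'.symm
    · exact absurd rfl hxy
  -- same types
  have key : ∀ s a a', f a = f a' → ¬ DL H R s a → ¬ DL H R s a' →
      ((colSat G c φ s a ∨ colSat G c φ a s) ↔ (colSat G c φ s a' ∨ colSat G c φ a' s)) := by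
    intro s a a' hf h1 h2
    have hf1 : τ 0 ![a, a] = τ 0 ![a', a'] := congrArg Prod.fst hf
    have hf2 : τ 1 ![a, a] = τ 1 ![a', a'] := congrArg Prod.snd hf
    refine or_congr ?_ ?_
    · refine hs ![s, a] ![s, a'] (hfr _ _ h1) (hfr _ _ h2) fun i => ?_
      fin_cases i
      · exact (hl0 s a).trans (hl0 s a').symm
      · exact (hl1 s a).trans (hf2.trans (hl1 s a').symm)
    · refine hs ![a, s] ![a', s] (hfr _ _ fun h => h1 h.symm) (hfr _ _ fun h => h2 h.symm) fun i => ?_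
      fin_cases i
      · exact (hl0 a s).trans (hf1.trans (hl0 a' s).symm)
      · exact (hl1 a s).trans (hl1 a' s).symm
  obtain ⟨a, haA, a', haA', hne, hfa⟩ := pigeonTy A f (by omega)
  obtain ⟨b, hbB, b', hbB', hneb, hfb⟩ := pigeonTy B f (by omega)
  have hdis : ∀ u ∈ A, ∀ v ∈ B, u ≠ v := by
    rintro u hu v hv rfl
    have := hfar u hu u hv .nil
    simp at this
  have hmem : ∀ v ∈ (Finset.univ.image fun i : Fin n0 => E (.inl i)), ∃ i, E (.inl i) = v := by
    intro v hv
    simpa using hv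
  obtain ⟨x, rfl⟩ := hmem _ (hAW haA)
  obtain ⟨x', rfl⟩ := hmem _ (hAW haA')
  obtain ⟨y, rfl⟩ := hmem _ (hBW hbB)
  obtain ⟨y', rfl⟩ := hmem _ (hBW hbB')
  have hx1 : x' ≠ x := fun h => hne (by rw [h])
  have hx2 : x' ≠ y := fun h => hdis _ haA' _ hbB (by rw [h])
  have hy1 : y' ≠ y := fun h => hneb (by rw [h])
  have hy2 : y' ≠ x := fun h => hdis _ haA _ hbB' (by rw [h])
  have hne2 : ∀ i : Fin n0, E (.inr (x, y)) ≠ E (.inl i) := fun i h => by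
    have := hE h
    simp at this
  have step : ∀ i i' : Fin n0, (i = x ∨ i = y) → ¬ (i' = x ∨ i' = y) → f (E (.inl i)) = f (E (.inl i')) →
      DL H R (E (.inr (x, y))) (E (.inl i)) ∨ DL H R (E (.inr (x, y))) (E (.inl i')) := by
    intro i i' hi hi' hf
    by_contra hcon
    push Not at hcon
    have hk := key _ _ _ hf hcon.1 hcon.2
    have c1 := (hA (.inr (x, y)) (.inl i)).mp hi
    exact hi' ((hA (.inr (x, y)) (.inl i')).mpr ⟨hne2 _, hk.mp c1.2⟩)
  have fin : ∀ s u v, u ∈ A → v ∈ B → DL H R s u → DL H R s v → False := by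
    intro s u v hu hv h1 h2
    obtain ⟨w, hw⟩ := h1.symm.trans h2 (Q := 2 * R) (by omega)
    have := hfar u hu v hv w
    omega
  have s1 := step x x' (Or.inl rfl) (by tauto) hfa
  have s2 := step y y' (Or.inr rfl) (by tauto) hfb
  rcases s1 with s1 | s1 <;> rcases s2 with s2 | s2
  · exact fin _ _ _ haA hbB s1 s2
  · exact fin _ _ _ haA hbB' s1 s2
  · exact fin _ _ _ haA' hbB s1 s2
  · exact fin _ _ _ haA' hbB' s1 s2

/-- A class of finite graphs is monadically dependent
if and only if it is flip-breakable. -/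
theorem monadicallyDependent_iff_flipBreakable (C : GraphClass) :
    MonadicallyDependent C ↔ FlipBreakable C := by
  exact ⟨fun h => flipBreakable_of_not_transduces h, fun h => not_transduces_of_flipBreakable h⟩
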